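/- Assume g satisfies conditions (2.4) and let N ≥ 2. Let Ω₀ and Ω₁ be bounded convex open subsets of ℝ^N with closure(Ω₁) ⊂ Ω₀, set Ω = Ω₀ \ closure(Ω₁), Γ₀ = ∂Ω₀ and Γ₁ = ∂Ω₁. Let q₀ > 0 and c₁ > 0, and suppose u is C³ on an open neighborhood of closure(Ω), satisfies Σ_{i=1}^N ∂_i(g(q²) ∂_i u) = N in Ω with q = |∇u| and ∇u ≠ 0 in Ω, and satisfies the overdetermined boundary conditions u = 0 and |∇u| = q₀ on Γ₀, u = −c₁ and ∇u = 0 on Γ₁. Then Γ₀ and Γ₁ are concentric spheres: there exist x₀ ∈ ℝ^N and radii 0 < r₁ < r₀ such that Γ₁ = {x : |x − x₀| = r₁} and Γ₀ = {x : |x − x₀| = r₀}, and u is a radial function about x₀. -/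

import Mathlib

open Set Filter

noncomputable section

/-- `G(ξ) = g(ξ) + 2ξ g'(ξ)`, from (1.2). -/
def Gfun (g : ℝ → ℝ) (ξ : ℝ) : ℝ := g ξ + 2 * ξ * deriv g ξ

/-- Conditions (2.4) on `g`. -/
def Cond24 (g : ℝ → ℝ) : Prop :=
  ContDiffOn ℝ (⊤ : ℕ∞) g (Ioi 0) ∧ (∀ ξ > (0:ℝ), 0 < g ξ) ∧
  Tendsto (fun ξ : ℝ => g (ξ ^ 2) * ξ) (nhdsWithin 0 (Ioi 0)) (nhds 0) ∧
  Tendsto (fun ξ : ℝ => g (ξ ^ 2) * ξ) atTop atTop ∧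
  (∀ ξ > (0:ℝ), 0 < Gfun g ξ)

/-- The `i`-th standard basis vector of `ℝ^N`. -/
def eb (N : ℕ) (i : Fin N) : EuclideanSpace ℝ (Fin N) := EuclideanSpace.single i 1

open scoped Topology

set_option linter.unusedSectionVars false

section LinearTheory


variable {E : Type*} [NormedAddCommGroup E] [InnerProductSpace ℝ E]

/-- The second derivative of `f` at `x`, as a bilinear form. -/
def hess (f : E → ℝ) (x : E) : E →L[ℝ] E →L[ℝ] ℝ := fderiv ℝ (fderiv ℝ f) x

/-- The bilinear form `(v, w) ↦ ⟪a, v⟫ * ⟪b, w⟫`. -/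
def outer (a b : E) : E →L[ℝ] E →L[ℝ] ℝ := (innerSL ℝ a).smulRight (innerSL ℝ b)

/-- The inner product, as a bilinear form. -/
def innerForm : E →L[ℝ] E →L[ℝ] ℝ := innerSL ℝ

@[simp] lemma innerForm_apply (v w : E) : innerForm v w = inner ℝ v w := rfl

@[simp] lemma outer_apply (a b v w : E) : outer a b v w = inner ℝ a v * inner ℝ b w := by
  simp [outer]

/-- A linear functional on bilinear forms which is uniformly elliptic with constants `l`, `L`. -/
structure Elliptic (l L : ℝ) (A : (E →L[ℝ] E →L[ℝ] ℝ) →ₗ[ℝ] ℝ) : Prop where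
  nonpos : ∀ H, (∀ v, H v v ≤ 0) → A H ≤ 0
  lower : ∀ ξ, l * ‖ξ‖ ^ 2 ≤ A (outer ξ ξ)
  upper : A innerForm ≤ L

/-- The function `f` satisfies at `x` an elliptic differential inequality. -/
def SubAt (l L C : ℝ) (f : E → ℝ) (x : E) : Prop :=
  ∃ A : (E →L[ℝ] E →L[ℝ] ℝ) →ₗ[ℝ] ℝ, Elliptic l L A ∧ -(C * ‖fderiv ℝ f x‖) ≤ A (hess f x)

lemma second_deriv_nonpos {G G' : ℝ → ℝ} {c : ℝ}
    (hG : ∀ᶠ s in 𝓝 (0 : ℝ), HasDerivAt G (G' s) s) (hG' : HasDerivAt G' c 0) (h0 : G' 0 = 0)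
    (hle : ∀ᶠ s in 𝓝[>] (0 : ℝ), G s ≤ G 0) : c ≤ 0 := by
  by_contra! hc
  have h1 : ∀ᶠ s in 𝓝[>] (0 : ℝ), 0 < G' s := by
    have := hasDerivAt_iff_tendsto_slope.1 hG'
    have h2 : ∀ᶠ s in 𝓝[≠] (0 : ℝ), 0 < slope G' 0 s := this.eventually (lt_mem_nhds hc)
    have h3 : ∀ᶠ s in 𝓝[>] (0 : ℝ), 0 < slope G' 0 s :=
      h2.filter_mono (nhdsWithin_mono _ (fun s hs => ne_of_gt hs))
    filter_upwards [h3, self_mem_nhdsWithin] with s hs hs0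
    rw [slope_def_field, h0, sub_zero, sub_zero] at hs
    have hs0' : (0 : ℝ) < s := hs0
    exact (div_pos_iff_of_pos_right hs0').1 hs
  have h4 := (h1.and (hle.and (hG.filter_mono nhdsWithin_le_nhds)))
  obtain ⟨δ, hδ, hδ'⟩ := (mem_nhdsGT_iff_exists_Ioo_subset).1 h4
  have hδ0 : (0 : ℝ) < δ := hδ
  have hd0 : HasDerivAt G (G' 0) 0 := hG.self_of_nhds
  have hmem : ∀ s ∈ Ioo (0 : ℝ) δ, 0 < G' s ∧ G s ≤ G 0 ∧ HasDerivAt G (G' s) s :=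
    fun s hs => hδ' hs
  have hmono : StrictMonoOn G (Icc 0 (δ / 2)) := by
    apply strictMonoOn_of_deriv_pos (convex_Icc _ _)
    · intro s hs
      rcases eq_or_lt_of_le hs.1 with h | h
      · subst h; exact hd0.continuousAt.continuousWithinAt
      · exact (hmem s ⟨h, by linarith [hs.2]⟩).2.2.continuousAt.continuousWithinAt
    · intro s hs
      rw [interior_Icc] at hs
      have := hmem s ⟨hs.1, by linarith [hs.2]⟩
      rw [this.2.2.deriv]; exact this.1
  have := hmono (left_mem_Icc.2 (by linarith)) (right_mem_Icc.2 (by linarith)) (by linarith)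
  linarith [(hmem (δ / 2) ⟨by linarith, by linarith⟩).2.1]

lemma hasDerivAt_line (x v : E) (s : ℝ) : HasDerivAt (fun s : ℝ => x + s • v) v s := by
  simpa using ((hasDerivAt_id s).smul_const v).const_add x

lemma ContDiffAt.eventually_hasDerivAt_line {f : E → ℝ} {x : E} (hf : ContDiffAt ℝ 2 f x) (v : E) :
    ∀ᶠ s in 𝓝 (0 : ℝ), HasDerivAt (fun s : ℝ => f (x + s • v)) (fderiv ℝ f (x + s • v) v) s := by
  have h1 : ∀ᶠ y in 𝓝 x, ContDiffAt ℝ 2 f y := hf.eventually (by simp)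
  have hc : Tendsto (fun s : ℝ => x + s • v) (𝓝 0) (𝓝 x) := by
    have := (hasDerivAt_line x v 0).continuousAt.tendsto
    simpa using this
  filter_upwards [hc.eventually h1] with s hs
  exact (hs.differentiableAt (by simp)).hasFDerivAt.comp_hasDerivAt s (hasDerivAt_line x v s)

lemma ContDiffAt.differentiableAt_fderiv {f : E → ℝ} {x : E} (hf : ContDiffAt ℝ 2 f x) :
    DifferentiableAt ℝ (fderiv ℝ f) x :=
  (hf.fderiv_right (m := 1) (by norm_num)).differentiableAt (by simp)

lemma ContDiffAt.hasDerivAt_fderiv_line {f : E → ℝ} {x : E} (hf : ContDiffAt ℝ 2 f x) (v w : E) :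
    HasDerivAt (fun s : ℝ => fderiv ℝ f (x + s • v) w) (hess f x v w) 0 := by
  have h1 : HasFDerivAt (fderiv ℝ f) (hess f x) (x + (0 : ℝ) • v) := by
    simpa [hess] using hf.differentiableAt_fderiv.hasFDerivAt
  have h2 := h1.comp_hasDerivAt (0 : ℝ) (hasDerivAt_line x v 0)
  exact h2.clm_apply (hasDerivAt_const _ _) |>.congr_deriv (by simp)

lemma hess_nonpos_of_isLocalMax {f : E → ℝ} {x : E} (hf : ContDiffAt ℝ 2 f x)
    (h : IsLocalMax f x) (v : E) : hess f x v v ≤ 0 := by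
  apply second_deriv_nonpos (hf.eventually_hasDerivAt_line v) (hf.hasDerivAt_fderiv_line v v)
  · simp [h.fderiv_eq_zero]
  · have hc : Tendsto (fun s : ℝ => x + s • v) (𝓝 0) (𝓝 x) := by
      have := (hasDerivAt_line x v 0).continuousAt.tendsto
      simpa using this
    have := hc.eventually h
    simpa using this.filter_mono nhdsWithin_le_nhds

lemma hess_add {f g : E → ℝ} {x : E} (hf : ContDiffAt ℝ 2 f x) (hg : ContDiffAt ℝ 2 g x) :
    hess (f + g) x = hess f x + hess g x := by
  have h : fderiv ℝ (f + g) =ᶠ[𝓝 x] fderiv ℝ f + fderiv ℝ g := by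
    filter_upwards [hf.eventually (by simp), hg.eventually (by simp)] with y h1 h2
    exact fderiv_add (h1.differentiableAt (by simp)) (h2.differentiableAt (by simp))
  unfold hess
  rw [h.fderiv_eq, fderiv_add hf.differentiableAt_fderiv hg.differentiableAt_fderiv]

lemma hess_const_smul {f : E → ℝ} {x : E} (c : ℝ) :
    hess (c • f) x = c • hess f x := by
  have h : fderiv ℝ (c • f) = c • fderiv ℝ f := by
    ext1 y; exact congrFun (fderiv_const_smul_field (𝕜 := ℝ) (f := f) c) y
  unfold hess
  rw [h]
  exact congrFun (fderiv_const_smul_field (𝕜 := ℝ) (f := fderiv ℝ f) c) x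

lemma hess_mul {f g : E → ℝ} (hf : ContDiff ℝ 2 f) (hg : ContDiff ℝ 2 g) (x : E) :
    hess (fun y => f y * g y) x = f x • hess g x + g x • hess f x
      + (fderiv ℝ f x).smulRight (fderiv ℝ g x) + (fderiv ℝ g x).smulRight (fderiv ℝ f x) := by
  have h : fderiv ℝ (fun y => f y * g y) = fun y => f y • fderiv ℝ g y + g y • fderiv ℝ f y := by
    ext1 y
    exact fderiv_fun_mul (hf.differentiable (by simp) y) (hg.differentiable (by simp) y)
  have h1 := ((hf.differentiable (by simp) x).hasFDerivAt.smul
    (hg.contDiffAt.differentiableAt_fderiv (x := x)).hasFDerivAt).add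
    ((hg.differentiable (by simp) x).hasFDerivAt.smul
    (hf.contDiffAt.differentiableAt_fderiv (x := x)).hasFDerivAt)
  unfold hess
  rw [h]
  refine h1.fderiv.trans ?_
  abel

omit [InnerProductSpace ℝ E] in
/-- A function which is nonpositive on the boundary and has no interior maximum is
nonpositive. -/
lemma nonpos_of_no_interior_max [ProperSpace E] {V : Set E} (hV : IsOpen V)
    (hVb : Bornology.IsBounded V) {f : E → ℝ} (hf : ContinuousOn f (closure V))
    (hfr : ∀ x ∈ frontier V, f x ≤ 0)
    (hmax_int : ∀ x ∈ V, IsLocalMax f x → False) : ∀ x ∈ V, f x ≤ 0 := by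
  intro x hx
  by_contra! hpos
  have hK : IsCompact (closure V) := hVb.isCompact_closure
  obtain ⟨y, hy, hmax⟩ := hK.exists_isMaxOn ⟨x, subset_closure hx⟩ hf
  have hyx := hmax (subset_closure hx)
  simp only [mem_ofPred_eq] at hyx
  by_cases hyV : y ∈ V
  · exact hmax_int y hyV (hmax.isLocalMax (mem_of_superset (hV.mem_nhds hyV) subset_closure))
  · have : y ∈ frontier V := by rw [hV.frontier_eq]; exact ⟨hy, hyV⟩
    linarith [hfr y this]

/-- A strict subsolution barrier `z`, added to a subsolution, has no interior maximum. -/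
lemma SubAt.not_isLocalMax_add {l L C ε : ℝ} {f z : E → ℝ} {x : E} (hε : 0 < ε) 
    (A : (E →L[ℝ] E →L[ℝ] ℝ) →ₗ[ℝ] ℝ) (hA : Elliptic l L A)
    (hsub : -(C * ‖fderiv ℝ f x‖) ≤ A (hess f x))
    (hf : ContDiffAt ℝ 2 f x) (hz : ContDiffAt ℝ 2 z x)
    (hlt : C * ‖fderiv ℝ z x‖ < A (hess z x)) : ¬ IsLocalMax (f + ε • z) x := by
  intro hmax
  have hεz : ContDiffAt ℝ 2 (ε • z) x := hz.const_smul ε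
  have h1 := hA.nonpos _ (hess_nonpos_of_isLocalMax (hf.add hεz) hmax)
  change A (hess (f + ε • z) x) ≤ 0 at h1
  rw [hess_add hf hεz, hess_const_smul, map_add, map_smul, smul_eq_mul] at h1
  have h2 := hmax.fderiv_eq_zero
  rw [fderiv_add (hf.differentiableAt (by simp)) (hεz.differentiableAt (by simp)),
    fderiv_const_smul_field] at h2
  have h3 : fderiv ℝ f x = -(ε • fderiv ℝ z x) := by
    rw [eq_neg_iff_add_eq_zero]; exact h2
  rw [h3, norm_neg, norm_smul, Real.norm_of_nonneg hε.le] at hsub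
  have := mul_lt_mul_of_pos_left hlt hε
  nlinarith

/-- The radial barrier of Hopf's lemma. -/
def radialBarrier (k R : ℝ) (c : E) (x : E) : ℝ :=
  Real.exp (-k * ‖x - c‖ ^ 2) - Real.exp (-k * R ^ 2)

lemma contDiff_radialBarrier (k R : ℝ) (c : E) : ContDiff ℝ 2 (radialBarrier k R c) := by
  unfold radialBarrier
  exact ((contDiff_const.mul ((contDiff_id.sub contDiff_const).norm_sq ℝ)).exp).sub contDiff_const

lemma fderiv_radialBarrier (k R : ℝ) (c x : E) : fderiv ℝ (radialBarrier k R c) x =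
    (-2 * k * Real.exp (-k * ‖x - c‖ ^ 2)) • innerSL ℝ (x - c) := by
  have h1 : HasFDerivAt (fun x : E => x - c) (ContinuousLinearMap.id ℝ E) x :=
    (hasFDerivAt_id x).sub_const c
  have h2 := ((h1.norm_sq.const_mul (-k)).exp).sub_const (Real.exp (-k * R ^ 2))
  refine h2.fderiv.trans ?_
  ext v
  simp
  ring

lemma hess_radialBarrier (k R : ℝ) (c x : E) : hess (radialBarrier k R c) x =
    (4 * k ^ 2 * Real.exp (-k * ‖x - c‖ ^ 2)) • outer (x - c) (x - c)
      - (2 * k * Real.exp (-k * ‖x - c‖ ^ 2)) • innerForm := by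
  unfold hess
  have h0 : fderiv ℝ (radialBarrier k R c) = fun x =>
    (-2 * k * Real.exp (-k * ‖x - c‖ ^ 2)) • innerSL ℝ (x - c) := by
    ext1 x; exact fderiv_radialBarrier k R c x
  rw [h0]
  have h1 : HasFDerivAt (fun x : E => x - c) (ContinuousLinearMap.id ℝ E) x :=
    (hasFDerivAt_id x).sub_const c
  have h2 := ((h1.norm_sq.const_mul (-k)).exp).const_mul (-2 * k)
  have h3 := h2.smul ((innerForm (E := E)).hasFDerivAt.comp x h1)
  refine h3.fderiv.trans ?_
  ext v w
  simp [outer]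
  ring

end LinearTheory

section LinearTheory

variable {E : Type*} [NormedAddCommGroup E] [InnerProductSpace ℝ E]

lemma radialBarrier_strict {l L C R k D : ℝ} (hl : 0 < l) (hC : 0 ≤ C) (hR : 0 < R) (hk : 0 < k)
    (hkR : L + C * R + D ≤ k * l * R ^ 2 / 2) {A : (E →L[ℝ] E →L[ℝ] ℝ) →ₗ[ℝ] ℝ}
    (hA : Elliptic l L A) {c x : E} (h1 : R / 2 ≤ ‖x - c‖) (h2 : ‖x - c‖ ≤ R) :
    C * ‖fderiv ℝ (radialBarrier k R c) x‖ + 2 * k * Real.exp (-k * ‖x - c‖ ^ 2) * D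
      ≤ A (hess (radialBarrier k R c) x) := by
  have hE := Real.exp_pos (-k * ‖x - c‖ ^ 2)
  rw [fderiv_radialBarrier, hess_radialBarrier, norm_smul, innerSL_apply_norm]
  have hA' : ∀ (a b : ℝ) (H K : E →L[ℝ] E →L[ℝ] ℝ), A (a • H - b • K) = a * A H - b * A K := by
    intro a b H K
    rw [show a • H - b • K = a • H + (-b) • K by ext; simp; ring, map_add, map_smul, map_smul,
      smul_eq_mul, smul_eq_mul]
    ring
  rw [hA']
  have hn : ‖-2 * k * Real.exp (-k * ‖x - c‖ ^ 2)‖ = 2 * k * Real.exp (-k * ‖x - c‖ ^ 2) := by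
    rw [Real.norm_eq_abs, abs_of_nonpos (by nlinarith [mul_pos hk hE])]; ring
  rw [hn]
  set e := Real.exp (-k * ‖x - c‖ ^ 2)
  set ρ := ‖x - c‖
  have hlow := hA.lower (x - c)
  have hup := hA.upper
  have hρ : (R / 2) ^ 2 ≤ ρ ^ 2 := by gcongr
  have h3 : C * ρ ≤ C * R := by gcongr
  have h4 : k * l * (R / 2) ^ 2 ≤ k * l * ρ ^ 2 := by gcongr
  have h5 : C * ρ + D ≤ 2 * k * A (outer (x - c) (x - c)) - A innerForm := by
    have : k * (l * ρ ^ 2) ≤ k * A (outer (x - c) (x - c)) := by gcongr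
    nlinarith
  have h6 := mul_le_mul_of_nonneg_left h5 (by positivity : 0 ≤ 2 * k * e)
  calc _ = 2 * k * e * (C * ρ + D) := by ring
    _ ≤ _ := h6
    _ = _ := by ring

lemma radialBarrier_self {k R : ℝ} {c x : E} (hx : ‖x - c‖ = R) : radialBarrier k R c x = 0 := by
  simp [radialBarrier, hx]

lemma radialBarrier_le_one {k R : ℝ} (hk : 0 < k) (c x : E) : radialBarrier k R c x ≤ 1 := by
  unfold radialBarrier
  have h1 : Real.exp (-k * ‖x - c‖ ^ 2) ≤ 1 := Real.exp_le_one_iff.2 (by nlinarith [sq_nonneg ‖x - c‖])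
  linarith [Real.exp_pos (-k * R ^ 2)]

lemma radialBarrier_nonneg {k R : ℝ} (hk : 0 < k) {c x : E} (hx : ‖x - c‖ ≤ R) :
    0 ≤ radialBarrier k R c x := by
  unfold radialBarrier
  rw [sub_nonneg, Real.exp_le_exp]
  have : ‖x - c‖ ^ 2 ≤ R ^ 2 := by gcongr
  nlinarith

/-- Hopf's boundary point lemma. -/
lemma hopf_boundary_point [ProperSpace E] {l L C R : ℝ} (hl : 0 < l) (hC : 0 ≤ C) (hR : 0 < R)
    {f : E → ℝ} {c p : E} (hp : ‖p - c‖ = R)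
    (hsub : ∀ x ∈ Metric.ball c R, ContDiffAt ℝ 2 f x ∧ SubAt l L C f x)
    (hcont : ContinuousOn f (Metric.closedBall c R)) (hneg : ∀ x ∈ Metric.ball c R, f x < 0)
    (hfp : f p = 0) (hd : DifferentiableAt ℝ f p) : 0 < fderiv ℝ f p (p - c) := by
  set k : ℝ := 2 * (|L| + C * R + 1) / (l * R ^ 2) with hk
  have hkpos : 0 < k := by positivity
  have hkR : L + C * R + 1 ≤ k * l * R ^ 2 / 2 := by
    have : k * l * R ^ 2 / 2 = |L| + C * R + 1 := by rw [hk]; field_simp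
    rw [this]; linarith [le_abs_self L]
  have hle : ∀ x ∈ Metric.closedBall c R, f x ≤ 0 := by
    rw [← closure_ball c hR.ne'] at hcont ⊢
    intro x hx
    exact le_on_closure (fun y hy => (hneg y hy).le) hcont continuousOn_const hx
  have hsph : IsCompact (Metric.sphere c (R / 2)) := isCompact_sphere _ _
  have hsphsub : Metric.sphere c (R / 2) ⊆ Metric.ball c R := by
    intro x hx; rw [Metric.mem_sphere] at hx; rw [Metric.mem_ball, hx]; linarith
  obtain ⟨q, hq, hqmax⟩ := hsph.exists_isMaxOn
    ⟨c + (1 / 2 : ℝ) • (p - c), by simp [norm_smul, hp]; ring⟩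
    (hcont.mono (hsphsub.trans Metric.ball_subset_closedBall))
  set ε : ℝ := - f q with hε
  have hεpos : 0 < ε := by rw [hε]; linarith [hneg q (hsphsub hq)]
  set z := radialBarrier k R c with hz
  have hzc : ContDiff ℝ 2 z := contDiff_radialBarrier k R c
  set V : Set E := {x | R / 2 < ‖x - c‖ ∧ ‖x - c‖ < R} with hV
  have hnc : Continuous fun x : E => ‖x - c‖ := by fun_prop
  have hVopen : IsOpen V := (isOpen_lt continuous_const hnc).inter (isOpen_lt hnc continuous_const)
  have hclV : closure V ⊆ {x | R / 2 ≤ ‖x - c‖ ∧ ‖x - c‖ ≤ R} := by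
    apply closure_minimal
    · intro x hx; exact ⟨hx.1.le, hx.2.le⟩
    · exact (isClosed_le continuous_const hnc).inter (isClosed_le hnc continuous_const)
  have key : ∀ x ∈ V, (f + ε • z) x ≤ 0 := by
    apply nonpos_of_no_interior_max hVopen
    · refine (Metric.isBounded_ball (x := c) (r := R)).subset fun x hx => ?_
      rw [mem_ball_iff_norm]; exact hx.2
    · refine ContinuousOn.add (hcont.mono fun x hx => ?_) (hzc.continuous.const_smul ε).continuousOn
      rw [mem_closedBall_iff_norm]; exact (hclV hx).2
    · intro x hx
      rw [hVopen.frontier_eq] at hx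
      obtain ⟨hx1, hx2⟩ := hx
      have hx1' := hclV hx1
      by_cases h : ‖x - c‖ = R
      · have := hle x (by rw [mem_closedBall_iff_norm]; exact h.le)
        simpa [hz, radialBarrier_self h] using this
      · have h' : ‖x - c‖ = R / 2 := by
          by_contra hne
          exact hx2 ⟨lt_of_le_of_ne hx1'.1 (Ne.symm hne), lt_of_le_of_ne hx1'.2 h⟩
        have h3 : f x ≤ f q := hqmax (mem_sphere_iff_norm.2 h')
        have h4 : z x ≤ 1 := radialBarrier_le_one hkpos c x
        have h5 : ε * z x ≤ ε := by nlinarith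
        simp only [Pi.add_apply, Pi.smul_apply, smul_eq_mul]
        linarith
    · intro x hx
      obtain ⟨h1, A, hA, h2⟩ := hsub x (by rw [mem_ball_iff_norm]; exact hx.2)
      apply SubAt.not_isLocalMax_add hεpos A hA h2 h1 hzc.contDiffAt
      have := radialBarrier_strict hl hC hR hkpos hkR hA hx.1.le hx.2.le
      have h3 : 0 < 2 * k * Real.exp (-k * ‖x - c‖ ^ 2) * 1 := by positivity
      linarith
  have hdz : fderiv ℝ z p (p - c) = -2 * k * Real.exp (-k * R ^ 2) * R ^ 2 := by
    rw [hz, fderiv_radialBarrier, smul_apply, innerSL_apply_apply, real_inner_self_eq_norm_sq, hp,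
      smul_eq_mul]
  have hline : HasDerivAt (fun s : ℝ => (f + ε • z) (p + s • (-(p - c))))
      ((fderiv ℝ f p + ε • fderiv ℝ z p) (-(p - c))) 0 := by
    have h1 : HasFDerivAt (f + ε • z) (fderiv ℝ f p + ε • fderiv ℝ z p)
        (p + (0 : ℝ) • (-(p - c))) := by
      simpa using hd.hasFDerivAt.add ((hzc.differentiable (by simp) p).hasFDerivAt.const_smul ε)
    exact h1.comp_hasDerivAt (0 : ℝ) (hasDerivAt_line p _ 0)
  have hnonpos : (fderiv ℝ f p + ε • fderiv ℝ z p) (-(p - c)) ≤ 0 := by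
    have h1 := hline.tendsto_slope_zero_right
    refine le_of_tendsto h1 ?_
    have : Ioo (0 : ℝ) (1 / 2) ∈ 𝓝[>] (0 : ℝ) := Ioo_mem_nhdsGT (by norm_num)
    filter_upwards [this] with s hs
    have h2 : (f + ε • z) (p + s • (-(p - c))) ≤ 0 := by
      apply key
      have : ‖p + s • (-(p - c)) - c‖ = (1 - s) * R := by
        rw [show p + s • (-(p - c)) - c = (1 - s) • (p - c) by module, norm_smul, hp,
          Real.norm_of_nonneg (by linarith [hs.2])]
      simp only [hV, mem_ofPred_eq, this]
      constructor <;> nlinarith [hs.1, hs.2]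
    have h3 : (f + ε • z) p = 0 := by simp [hfp, hz, radialBarrier_self hp]
    simp only [zero_add, zero_smul, add_zero, h3, sub_zero, smul_eq_mul]
    exact mul_nonpos_of_nonneg_of_nonpos (by have := hs.1; positivity) h2
  simp only [add_apply, smul_apply, map_neg, hdz,
    smul_eq_mul] at hnonpos
  have : 0 < ε * (2 * k * Real.exp (-k * R ^ 2) * R ^ 2) := by positivity
  linarith

/-- A nonpositive subsolution which vanishes at a point vanishes near that point. -/
lemma SubAt.eventually_eq_zero [ProperSpace E] {l L C r : ℝ} (hl : 0 < l) (hC : 0 ≤ C) (hr : 0 < r)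
    {f : E → ℝ} {x : E}
    (hsub : ∀ y ∈ Metric.ball x r, ContDiffAt ℝ 2 f y ∧ SubAt l L C f y)
    (hle : ∀ y ∈ Metric.ball x r, f y ≤ 0) (hx : f x = 0) : ∀ᶠ y in 𝓝 x, f y = 0 := by
  refine Metric.eventually_nhds_iff_ball.2 ⟨r / 3, by positivity, fun y hy => ?_⟩
  by_contra hne
  have hcont : ContinuousOn f (Metric.ball x r) := fun z hz =>
    (hsub z hz).1.continuousAt.continuousWithinAt
  have hd : dist x y < r / 3 := by rw [dist_comm]; exact hy
  set K : Set E := Metric.closedBall y (dist x y) ∩ f ⁻¹' {0} with hK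
  have hsubset : Metric.closedBall y (dist x y) ⊆ Metric.ball x r := by
    intro z hz
    rw [Metric.mem_closedBall] at hz
    rw [Metric.mem_ball]
    calc dist z x ≤ dist z y + dist y x := dist_triangle _ _ _
      _ < r := by rw [dist_comm y x]; linarith
  have hKclosed : IsClosed K :=
    (hcont.mono hsubset).preimage_isClosed_of_isClosed Metric.isClosed_closedBall isClosed_singleton
  have hKc : IsCompact K := (isCompact_closedBall y (dist x y)).of_isClosed_subset hKclosed inter_subset_left
  have hxK : x ∈ K := ⟨by simp, hx⟩
  obtain ⟨p, hpK, hpmin⟩ := hKc.exists_isMinOn ⟨x, hxK⟩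
    (f := fun z => ‖z - y‖) (by fun_prop)
  have hpball : p ∈ Metric.ball x r := hsubset hpK.1
  have hRpos : 0 < ‖p - y‖ := by
    rw [norm_pos_iff, sub_ne_zero]
    rintro rfl
    exact hne hpK.2
  have hpx : ‖p - y‖ ≤ dist x y := by rw [dist_eq_norm]; exact hpmin hxK
  have hsub2 : Metric.closedBall y ‖p - y‖ ⊆ Metric.ball x r :=
    (Metric.closedBall_subset_closedBall hpx).trans hsubset
  have h1 := hopf_boundary_point hl hC hRpos (f := f) (c := y) (p := p) rfl
    (fun z hz => hsub z (hsub2 (Metric.ball_subset_closedBall hz)))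
    (hcont.mono hsub2)
    (fun z hz => lt_of_le_of_ne (hle z (hsub2 (Metric.ball_subset_closedBall hz))) (fun h0 => by
      rw [mem_ball_iff_norm] at hz
      have : ‖p - y‖ ≤ ‖z - y‖ := hpmin ⟨by
        rw [mem_closedBall_iff_norm]; linarith, h0⟩
      linarith))
    hpK.2 ((hsub p hpball).1.differentiableAt (by simp))
  have hmax : IsLocalMax f p := by
    filter_upwards [Metric.isOpen_ball.mem_nhds hpball] with z hz
    rw [show f p = 0 from hpK.2]
    exact hle z hz
  rw [hmax.fderiv_eq_zero] at h1
  simp at h1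

/-- The strong maximum principle on a preconnected open set. -/
lemma SubAt.eq_zero_or_neg [ProperSpace E] {f : E → ℝ} {V : Set E} (hV : IsOpen V)
    (hVc : IsPreconnected V) (hle : ∀ y ∈ V, f y ≤ 0) (hcont : ContinuousOn f V)
    (hz : ∀ x ∈ V, f x = 0 → ∀ᶠ y in 𝓝 x, f y = 0) :
    (∀ y ∈ V, f y = 0) ∨ (∀ y ∈ V, f y < 0) := by
  by_cases h : ∃ x ∈ V, f x = 0
  · left
    have h1 : IsOpen {x | x ∈ V ∧ f x = 0} := by
      rw [isOpen_iff_mem_nhds]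
      rintro x ⟨hx, hx0⟩
      exact (hV.eventually_mem hx).and (hz x hx hx0)
    have := hVc.subset_of_closure_inter_subset h1 (by
      obtain ⟨x, hx, hx0⟩ := h; exact ⟨x, hx, hx, hx0⟩) (by
      rintro y ⟨hy1, hy2⟩
      refine ⟨hy2, ?_⟩
      by_contra hne
      have h3 : ∀ᶠ z in 𝓝 y, f z ≠ 0 := (hcont.continuousAt (hV.mem_nhds hy2)).eventually_ne hne
      obtain ⟨z, hz1, hz2⟩ := mem_closure_iff_nhds.1 hy1 _ h3
      exact hz1 hz2.2)
    exact fun y hy => (this hy).2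
  · right
    push Not at h
    exact fun y hy => lt_of_le_of_ne (hle y hy) (h y hy)

end LinearTheory

section LinearTheory

variable {E : Type*} [NormedAddCommGroup E] [InnerProductSpace ℝ E]

/-- The tangential factor of the barrier in Serrin's corner lemma. -/
def expBarrier (b : ℝ) (e p : E) (x : E) : ℝ := Real.exp (b * inner ℝ e (x - p)) - 1

lemma contDiff_expBarrier (b : ℝ) (e p : E) : ContDiff ℝ 2 (expBarrier b e p) := by
  unfold expBarrier
  exact ((contDiff_const.mul (contDiff_const.inner ℝ (contDiff_id.sub contDiff_const))).exp).sub
    contDiff_const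

lemma hasFDerivAt_inner_sub (e p x : E) :
    HasFDerivAt (fun x : E => inner ℝ e (x - p)) (innerSL ℝ e) x := by
  have := ((innerSL ℝ e).hasFDerivAt (x := x - p)).comp x ((hasFDerivAt_id x).sub_const p)
  exact this

lemma fderiv_expBarrier (b : ℝ) (e p x : E) : fderiv ℝ (expBarrier b e p) x =
    (b * Real.exp (b * inner ℝ e (x - p))) • innerSL ℝ e := by
  have h2 := (((hasFDerivAt_inner_sub e p x).const_mul b).exp).sub_const 1
  refine h2.fderiv.trans ?_
  ext v
  simp
  ring

lemma hess_expBarrier (b : ℝ) (e p x : E) : hess (expBarrier b e p) x =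
    (b ^ 2 * Real.exp (b * inner ℝ e (x - p))) • outer e e := by
  unfold hess
  have h0 : fderiv ℝ (expBarrier b e p) = fun x =>
    (b * Real.exp (b * inner ℝ e (x - p))) • innerSL ℝ e := by
    ext1 x; exact fderiv_expBarrier b e p x
  rw [h0]
  have h2 := (((hasFDerivAt_inner_sub e p x).const_mul b).exp.const_mul b).smul_const (innerSL ℝ e)
  refine h2.fderiv.trans ?_
  ext v w
  simp [outer]
  ring

set_option maxHeartbeats 1000000 in
/-- The barrier of Serrin's corner lemma is a strict subsolution. -/
lemma cornerBarrier_strict {l L C R k b : ℝ} (hl : 0 < l) (hC : 0 ≤ C) (hR : 0 < R) (hk : 0 < k)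
    (hb : 0 < b) (hbl : C ≤ b * l)
    (hkR : L + C * R + (Real.exp b * C * (1 + R) + 1) ≤ k * l * R ^ 2 / 2)
    {A : (E →L[ℝ] E →L[ℝ] ℝ) →ₗ[ℝ] ℝ} {e c p x : E} (he : ‖e‖ = 1)
    (hec : inner ℝ e (x - c) = inner ℝ e (x - p))
    (hA : Elliptic l L A) (ht0 : 0 < inner ℝ e (x - p)) (ht1 : inner ℝ e (x - p) ≤ (1 : ℝ))
    (hmix : ∀ ξ, |A (outer e ξ + outer ξ e)| ≤ C * (|inner ℝ e ξ| + inner ℝ e (x - p) * ‖ξ‖))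
    (h1 : R / 2 ≤ ‖x - c‖) (h2 : ‖x - c‖ ≤ R) :
    C * ‖fderiv ℝ (fun y => expBarrier b e p y * radialBarrier k R c y) x‖
      < A (hess (fun y => expBarrier b e p y * radialBarrier k R c y) x) := by
  have hS := contDiff_expBarrier b e p
  have hH := contDiff_radialBarrier k R c
  have hstrict := radialBarrier_strict hl hC hR hk hkR hA h1 h2
  have hfd : fderiv ℝ (fun y => expBarrier b e p y * radialBarrier k R c y) x
      = expBarrier b e p x • fderiv ℝ (radialBarrier k R c) x
        + radialBarrier k R c x • fderiv ℝ (expBarrier b e p) x :=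
    fderiv_fun_mul (hS.differentiable (by simp) x) (hH.differentiable (by simp) x)
  rw [hess_mul hS hH, hfd]
  set t : ℝ := inner ℝ e (x - p) with ht
  set s := expBarrier b e p x with hs
  set h := radialBarrier k R c x with hh
  have hh0 : 0 ≤ h := radialBarrier_nonneg hk h2
  have hst : b * t ≤ s := by
    have := Real.add_one_le_exp (b * t)
    rw [hs, expBarrier, ← ht]; linarith
  have hs0 : 0 < s := lt_of_lt_of_le (by positivity) hst
  have hexp : Real.exp (b * t) ≤ Real.exp b := Real.exp_le_exp.2 (by nlinarith)
  set Et := Real.exp (b * t) with hEt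
  have hEt0 : 0 < Et := Real.exp_pos _
  set Ex := Real.exp (-k * ‖x - c‖ ^ 2) with hEx
  have hEx0 : 0 < Ex := Real.exp_pos _
  have hmixed : (fderiv ℝ (expBarrier b e p) x).smulRight (fderiv ℝ (radialBarrier k R c) x)
      + (fderiv ℝ (radialBarrier k R c) x).smulRight (fderiv ℝ (expBarrier b e p) x)
      = (-(2 * k * Ex * b * Et)) • (outer e (x - c) + outer (x - c) e) := by
    rw [fderiv_expBarrier, fderiv_radialBarrier]
    have hEx' : Real.exp (-(k * ‖x - c‖ ^ 2)) = Ex := by rw [hEx, neg_mul]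
    ext v w
    simp [← hEt, hEx', ← ht, outer]
    ring
  have hnS : ‖fderiv ℝ (expBarrier b e p) x‖ = b * Et := by
    rw [fderiv_expBarrier, norm_smul, innerSL_apply_norm, he, mul_one, Real.norm_of_nonneg]
    positivity
  have hAhs : A (hess (expBarrier b e p) x) = b ^ 2 * Et * A (outer e e) := by
    rw [hess_expBarrier, map_smul, smul_eq_mul]
  have hlow := hA.lower e
  rw [he, one_pow, mul_one] at hlow
  have hm := hmix (x - c)
  rw [hec, abs_of_pos ht0] at hm
  have hm2 : A (outer e (x - c) + outer (x - c) e) ≤ C * (t * (1 + R)) := by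
    refine (le_abs_self _).trans (hm.trans ?_)
    gcongr
    nlinarith
  have hsplit : ∀ a b c d : E →L[ℝ] E →L[ℝ] ℝ,
      A (a + b + c + d) = A a + A b + A (c + d) := by
    intro a b c d
    simp only [map_add]
    ring
  refine lt_of_lt_of_eq ?_ (hsplit _ _ _ _).symm
  rw [hmixed, map_smul, map_smul, map_smul, smul_eq_mul, smul_eq_mul, smul_eq_mul, hAhs]
  have hnorm : ‖s • fderiv ℝ (radialBarrier k R c) x + h • fderiv ℝ (expBarrier b e p) x‖
      ≤ s * ‖fderiv ℝ (radialBarrier k R c) x‖ + h * (b * Et) := by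
    refine (norm_add_le _ _).trans ?_
    rw [norm_smul, norm_smul, hnS, Real.norm_of_nonneg hs0.le, Real.norm_of_nonneg hh0]
  have e1 : C * ‖s • fderiv ℝ (radialBarrier k R c) x + h • fderiv ℝ (expBarrier b e p) x‖
      ≤ C * (s * ‖fderiv ℝ (radialBarrier k R c) x‖ + h * (b * Et)) := by gcongr
  have e2 := mul_le_mul_of_nonneg_left hstrict hs0.le
  have e3 : h * (C * (b * Et)) ≤ h * (b ^ 2 * Et * A (outer e e)) := by
    apply mul_le_mul_of_nonneg_left _ hh0
    have : C ≤ b * A (outer e e) := hbl.trans (by gcongr)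
    have h3 := mul_le_mul_of_nonneg_right this (by positivity : 0 ≤ b * Et)
    nlinarith
  have e4 : 2 * k * Ex * b * Et * A (outer e (x - c) + outer (x - c) e)
      ≤ 2 * k * Ex * (s * (Real.exp b * C * (1 + R))) := by
    calc 2 * k * Ex * b * Et * A (outer e (x - c) + outer (x - c) e)
        ≤ 2 * k * Ex * b * Et * (C * (t * (1 + R))) := by gcongr
      _ = 2 * k * Ex * ((b * t) * (Et * C * (1 + R))) := by ring
      _ ≤ 2 * k * Ex * (s * (Real.exp b * C * (1 + R))) := by gcongr
  have e5 : 0 < s * (2 * k * Ex * 1) := by positivity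
  linarith

/-- Serrin's corner lemma. -/
lemma serrin_corner [ProperSpace E] {l L C d R : ℝ} (hl : 0 < l) (hC : 0 ≤ C) (hR : 0 < R)
    (hd0 : 0 < d) (hd1 : d ≤ 1) (hdR : d ≤ R / 2) {e n p : E} (he : ‖e‖ = 1) (hn : ‖n‖ = 1)
    (hen : inner ℝ e n = (0 : ℝ)) {f : E → ℝ}
    (hsub : ∀ x, 0 < (inner ℝ e (x - p) : ℝ) → ‖x - (p - R • n)‖ < R → ‖x - p‖ < d →
      ContDiffAt ℝ 2 f x ∧ ∃ A : (E →L[ℝ] E →L[ℝ] ℝ) →ₗ[ℝ] ℝ, Elliptic l L A ∧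
        (∀ ξ, |A (outer e ξ + outer ξ e)| ≤ C * (|inner ℝ e ξ| + inner ℝ e (x - p) * ‖ξ‖)) ∧
        -(C * ‖fderiv ℝ f x‖) ≤ A (hess f x))
    (hcont : ∀ x, 0 ≤ (inner ℝ e (x - p) : ℝ) → ‖x - (p - R • n)‖ ≤ R → ‖x - p‖ ≤ d →
      ContinuousAt f x)
    (hle : ∀ x, 0 ≤ (inner ℝ e (x - p) : ℝ) → ‖x - (p - R • n)‖ ≤ R → ‖x - p‖ ≤ d → f x ≤ 0)
    {η : ℝ} (hη : 0 < η)
    (hfη : ∀ x, 0 ≤ (inner ℝ e (x - p) : ℝ) → ‖x - (p - R • n)‖ ≤ R → ‖x - p‖ = d →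
      f x ≤ -(η * inner ℝ e (x - p))) :
    ∃ κ > 0, ∀ᶠ s in 𝓝[>] (0 : ℝ), f (p + s • (e - n)) ≤ -(κ * s ^ 2) := by
  set c := p - R • n with hc
  set b : ℝ := (C + 1) / l with hb
  have hb0 : 0 < b := by positivity
  have hbl : C ≤ b * l := by rw [hb]; field_simp; linarith
  set k : ℝ := 2 * (|L| + C * R + (Real.exp b * C * (1 + R) + 1)) / (l * R ^ 2) with hk
  have hk0 : 0 < k := by positivity
  have hkR : L + C * R + (Real.exp b * C * (1 + R) + 1) ≤ k * l * R ^ 2 / 2 := by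
    have : k * l * R ^ 2 / 2 = |L| + C * R + (Real.exp b * C * (1 + R) + 1) := by
      rw [hk]; field_simp
    rw [this]; linarith [le_abs_self L]
  set z : E → ℝ := fun y => expBarrier b e p y * radialBarrier k R c y with hz
  have hzc : ContDiff ℝ 2 z := (contDiff_expBarrier b e p).mul (contDiff_radialBarrier k R c)
  set ε : ℝ := η / (b * Real.exp b) with hε
  have hε0 : 0 < ε := by positivity
  have hnc : Continuous fun x : E => ‖x - c‖ := by fun_prop
  have hnp : Continuous fun x : E => ‖x - p‖ := by fun_prop
  have hit : Continuous fun x : E => (inner ℝ e (x - p) : ℝ) := by fun_prop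
  have hec : ∀ x, (inner ℝ e (x - c) : ℝ) = inner ℝ e (x - p) := by
    intro x
    rw [hc, show x - (p - R • n) = (x - p) + R • n by abel, inner_add_right, inner_smul_right, hen]
    ring
  set V : Set E := {x | 0 < (inner ℝ e (x - p) : ℝ)} ∩ {x | ‖x - c‖ < R} ∩ {x | ‖x - p‖ < d} with hV
  have hVo : IsOpen V := ((isOpen_lt continuous_const hit).inter (isOpen_lt hnc continuous_const)).inter
    (isOpen_lt hnp continuous_const)
  have hclV : closure V ⊆ {x | 0 ≤ (inner ℝ e (x - p) : ℝ)} ∩ {x | ‖x - c‖ ≤ R} ∩ {x | ‖x - p‖ ≤ d} := by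
    apply closure_minimal
    · rintro x ⟨⟨h1, h2⟩, h3⟩
      exact ⟨⟨le_of_lt (a := (0 : ℝ)) h1, le_of_lt (a := ‖x - c‖) h2⟩, le_of_lt (a := ‖x - p‖) h3⟩
    · exact ((isClosed_le continuous_const hit).inter (isClosed_le hnc continuous_const)).inter
        (isClosed_le hnp continuous_const)
  have htle : ∀ x, (inner ℝ e (x - p) : ℝ) ≤ ‖x - p‖ := by
    intro x
    have := real_inner_le_norm e (x - p)
    rwa [he, one_mul] at this
  have key : ∀ x ∈ V, (f + ε • z) x ≤ 0 := by
    apply nonpos_of_no_interior_max hVo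
    · refine (Metric.isBounded_ball (x := c) (r := R)).subset fun x hx => ?_
      rw [mem_ball_iff_norm]; exact hx.1.2
    · refine ContinuousOn.add (fun x hx => ?_) (hzc.continuous.const_smul ε).continuousOn
      have := hclV hx
      exact (hcont x this.1.1 this.1.2 this.2).continuousWithinAt
    · intro x hx
      rw [hVo.frontier_eq] at hx
      obtain ⟨hx1, hx2⟩ := hx
      obtain ⟨⟨ht, hρ⟩, hδ⟩ := hclV hx1
      simp only [mem_ofPred_eq] at ht hρ hδ
      have hf0 := hle x ht hρ hδ
      simp only [Pi.add_apply, Pi.smul_apply, smul_eq_mul]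
      by_cases h1 : (inner ℝ e (x - p) : ℝ) = 0
      · have : z x = 0 := by simp [hz, expBarrier, h1]
        rw [this]; linarith
      by_cases h2 : ‖x - c‖ = R
      · have : z x = 0 := by simp [hz, radialBarrier_self h2]
        rw [this]; linarith
      have h3 : ‖x - p‖ = d := by
        by_contra hne
        exact hx2 ⟨⟨lt_of_le_of_ne ht (Ne.symm h1), lt_of_le_of_ne hρ h2⟩, lt_of_le_of_ne hδ hne⟩
      have h4 := hfη x ht hρ h3
      have ht1 : (inner ℝ e (x - p) : ℝ) ≤ 1 := (htle x).trans (hδ.trans hd1)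
      set t : ℝ := inner ℝ e (x - p) with htt
      have h5 : expBarrier b e p x ≤ b * t * Real.exp b := by
        have e1 : Real.exp (b * t) ≤ Real.exp b := Real.exp_le_exp.2 (by nlinarith)
        have e2 := Real.add_one_le_exp (-(b * t))
        have e3 := mul_le_mul_of_nonneg_right e2 (Real.exp_pos (b * t)).le
        rw [← Real.exp_add, neg_add_cancel, Real.exp_zero] at e3
        have e4 : b * t * Real.exp (b * t) ≤ b * t * Real.exp b := by gcongr
        rw [expBarrier, ← htt]; linarith
      have h6 : 0 ≤ expBarrier b e p x := by
        have := Real.add_one_le_exp (b * t)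
        have : 0 ≤ b * t := by positivity
        rw [expBarrier, ← htt]; linarith
      have h7 : z x ≤ b * t * Real.exp b := by
        have := radialBarrier_le_one hk0 c x (R := R)
        calc z x = expBarrier b e p x * radialBarrier k R c x := rfl
          _ ≤ expBarrier b e p x * 1 := by gcongr
          _ ≤ _ := by rw [mul_one]; exact h5
      have h8 : ε * z x ≤ ε * (b * t * Real.exp b) := by gcongr
      have h9 : ε * (b * t * Real.exp b) = η * t := by rw [hε]; field_simp
      linarith
    · intro x hx
      obtain ⟨h1, A, hA, hmix, h2⟩ := hsub x hx.1.1 hx.1.2 hx.2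
      apply SubAt.not_isLocalMax_add hε0 A hA h2 h1 hzc.contDiffAt
      refine cornerBarrier_strict hl hC hR hk0 hb0 hbl hkR he (hec x) hA hx.1.1 ?_ hmix ?_ hx.1.2.le
      · exact (htle x).trans (hx.2.le.trans hd1)
      · have e1 : ‖R • n‖ ≤ ‖x - c‖ + ‖x - p‖ := by
          rw [show R • n = (x - c) - (x - p) by rw [hc]; abel]
          exact norm_sub_le _ _
        rw [norm_smul, hn, mul_one, Real.norm_of_nonneg hR.le] at e1
        have e2 : ‖x - p‖ < d := hx.2
        linarith
  refine ⟨ε * (b * (k * R * Real.exp (-k * R ^ 2))), by positivity, ?_⟩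
  have hmem : Ioo (0 : ℝ) (d / 2) ∈ 𝓝[>] (0 : ℝ) := Ioo_mem_nhdsGT (by linarith)
  filter_upwards [hmem] with s hs
  obtain ⟨hs0, hs1⟩ := hs
  have ht : (inner ℝ e (p + s • (e - n) - p) : ℝ) = s := by
    rw [add_sub_cancel_left, inner_smul_right, inner_sub_right, hen, real_inner_self_eq_norm_sq, he]
    ring
  have hnorm : ‖p + s • (e - n) - c‖ ^ 2 = R ^ 2 - 2 * R * s + 2 * s ^ 2 := by
    rw [show p + s • (e - n) - c = s • e + (R - s) • n by rw [hc]; module, norm_add_sq_real,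
      inner_smul_left, inner_smul_right, hen, norm_smul, norm_smul, he, hn, mul_one, mul_one,
      Real.norm_eq_abs, Real.norm_eq_abs, sq_abs, sq_abs]
    ring
  have hx := key (p + s • (e - n)) ⟨⟨by rw [mem_ofPred_eq, ht]; exact hs0, by
      rw [mem_ofPred_eq]
      apply lt_of_pow_lt_pow_left₀ 2 hR.le
      rw [hnorm]; nlinarith⟩, by
      rw [mem_ofPred_eq, add_sub_cancel_left, norm_smul, Real.norm_of_nonneg hs0.le]
      have : ‖e - n‖ ≤ 2 := (norm_sub_le e n).trans (by rw [he, hn]; norm_num)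
      nlinarith⟩
  simp only [Pi.add_apply, Pi.smul_apply, smul_eq_mul] at hx
  have h1 : b * s ≤ expBarrier b e p (p + s • (e - n)) := by
    rw [expBarrier, ht]; linarith [Real.add_one_le_exp (b * s)]
  have h2 : k * R * Real.exp (-k * R ^ 2) * s ≤ radialBarrier k R c (p + s • (e - n)) := by
    rw [radialBarrier, hnorm, show -k * (R ^ 2 - 2 * R * s + 2 * s ^ 2)
      = -k * R ^ 2 + k * (2 * R * s - 2 * s ^ 2) by ring, Real.exp_add]
    have e1 := Real.add_one_le_exp (k * (2 * R * s - 2 * s ^ 2))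
    have e2 : k * (R * s) ≤ k * (2 * R * s - 2 * s ^ 2) := by
      apply mul_le_mul_of_nonneg_left _ hk0.le
      nlinarith
    have e3 := mul_le_mul_of_nonneg_left (e2.trans (by linarith : _ ≤
      Real.exp (k * (2 * R * s - 2 * s ^ 2)) - 1)) (Real.exp_pos (-k * R ^ 2)).le
    linarith
  have h3 : b * s * (k * R * Real.exp (-k * R ^ 2) * s) ≤ z (p + s • (e - n)) := by
    apply mul_le_mul h1 h2 (by positivity)
    exact le_trans (by positivity) h1
  have h4 := mul_le_mul_of_nonneg_left h3 hε0.le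
  nlinarith

end LinearTheory

section Operator

variable {E : Type*} [NormedAddCommGroup E] [InnerProductSpace ℝ E]
  {ι : Type*} [Fintype ι]

/-- The principal part of the quasilinear operator `div (g(|∇u|²) ∇u)` at gradient `P`, as a linear
functional of the second derivative. -/
def quasiOp (g : ℝ → ℝ) (b : OrthonormalBasis ι ℝ E) (P : E) : (E →L[ℝ] E →L[ℝ] ℝ) →ₗ[ℝ] ℝ where
  toFun H := g (‖P‖ ^ 2) * ∑ i, H (b i) (b i) + 2 * deriv g (‖P‖ ^ 2) * H P P
  map_add' H K := by
    simp only [add_apply, Finset.sum_add_distrib]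
    ring
  map_smul' c H := by
    simp only [smul_apply, smul_eq_mul, ← Finset.mul_sum, RingHom.id_apply]
    ring

lemma quasiOp_apply (g : ℝ → ℝ) (b : OrthonormalBasis ι ℝ E) (P : E) (H : E →L[ℝ] E →L[ℝ] ℝ) :
    quasiOp g b P H = g (‖P‖ ^ 2) * ∑ i, H (b i) (b i) + 2 * deriv g (‖P‖ ^ 2) * H P P := rfl

lemma bilin_self_eq_sum (b : OrthonormalBasis ι ℝ E) (H : E →L[ℝ] E →L[ℝ] ℝ) (P Q : E) :
    H P Q = ∑ i, ∑ j, inner ℝ (b i) P * inner ℝ (b j) Q * H (b i) (b j) := by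
  conv_lhs => rw [← b.sum_repr' P, ← b.sum_repr' Q]
  simp only [map_sum, map_smul, sum_apply, smul_apply, smul_eq_mul, Finset.mul_sum]
  rw [Finset.sum_comm]
  refine Finset.sum_congr rfl fun i _ => Finset.sum_congr rfl fun j _ => ?_
  ring

lemma norm_sq_mul_trace_le (b : OrthonormalBasis ι ℝ E) (H : E →L[ℝ] E →L[ℝ] ℝ)
    (hH : ∀ v, H v v ≤ 0) (P : E) : ‖P‖ ^ 2 * ∑ i, H (b i) (b i) ≤ H P P := by
  have h1 : ∑ i, ∑ j, H (inner ℝ (b i) P • b j - inner ℝ (b j) P • b i)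
      (inner ℝ (b i) P • b j - inner ℝ (b j) P • b i) ≤ 0 :=
    Finset.sum_nonpos fun i _ => Finset.sum_nonpos fun j _ => hH _
  have h2 : ∀ i j, H (inner ℝ (b i) P • b j - inner ℝ (b j) P • b i)
      (inner ℝ (b i) P • b j - inner ℝ (b j) P • b i)
      = (inner ℝ (b i) P) ^ 2 * H (b j) (b j) + (inner ℝ (b j) P) ^ 2 * H (b i) (b i)
        - (inner ℝ (b j) P * inner ℝ (b i) P * H (b j) (b i))
        - (inner ℝ (b i) P * inner ℝ (b j) P * H (b i) (b j)) := by
    intro i j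
    simp only [map_sub, map_smul, sub_apply, smul_apply, smul_eq_mul]
    ring
  simp only [h2, Finset.sum_sub_distrib, Finset.sum_add_distrib] at h1
  rw [← bilin_self_eq_sum b H P P, Finset.sum_comm (f := fun i j => inner ℝ (b j) P * inner ℝ (b i) P * H (b j) (b i)),
    ← bilin_self_eq_sum b H P P, Finset.sum_comm (f := fun i j => inner ℝ (b j) P ^ 2 * H (b i) (b i))] at h1
  simp only [← Finset.mul_sum, ← Finset.sum_mul] at h1
  have h3 : ∑ i, (inner ℝ (b i) P) ^ 2 = ‖P‖ ^ 2 := by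
    rw [← b.sum_sq_norm_inner_right P]; simp
  rw [h3] at h1
  linarith

lemma sum_outer (b : OrthonormalBasis ι ℝ E) (v w : E) :
    ∑ i, outer v w (b i) (b i) = inner ℝ v w := by
  rw [← b.sum_inner_mul_inner v w]
  refine Finset.sum_congr rfl fun i _ => ?_
  rw [outer_apply, real_inner_comm w]

lemma quasiOp_outer (g : ℝ → ℝ) (b : OrthonormalBasis ι ℝ E) (P v w : E) :
    quasiOp g b P (outer v w) = g (‖P‖ ^ 2) * inner ℝ v w
      + 2 * deriv g (‖P‖ ^ 2) * (inner ℝ v P * inner ℝ w P) := by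
  rw [quasiOp_apply, sum_outer, outer_apply]

lemma elliptic_quasiOp {g : ℝ → ℝ} (b : OrthonormalBasis ι ℝ E) {P : E} {l L : ℝ} (hP : P ≠ 0)
    (hl : 0 < l) (h1 : l ≤ g (‖P‖ ^ 2)) (h2 : l ≤ Gfun g (‖P‖ ^ 2))
    (hL : Fintype.card ι * g (‖P‖ ^ 2) + 2 * |deriv g (‖P‖ ^ 2)| * ‖P‖ ^ 2 ≤ L) :
    Elliptic l L (quasiOp g b P) := by
  have hP0 : 0 < ‖P‖ ^ 2 := by positivity
  unfold Gfun at h2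
  refine ⟨fun H hH => ?_, fun ξ => ?_, ?_⟩
  · have h3 := norm_sq_mul_trace_le b H hH P
    have h4 := mul_le_mul_of_nonneg_left h3 (hl.le.trans h1)
    have h5 := mul_nonpos_of_nonneg_of_nonpos (hl.le.trans h2) (hH P)
    rw [quasiOp_apply]
    have h6 : ‖P‖ ^ 2 * (g (‖P‖ ^ 2) * ∑ i, H (b i) (b i) + 2 * deriv g (‖P‖ ^ 2) * H P P) ≤ 0 := by
      linarith
    exact nonpos_of_mul_nonpos_right h6 hP0
  · rw [quasiOp_outer, real_inner_self_eq_norm_sq]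
    have h3 := real_inner_mul_inner_self_le ξ P
    rw [real_inner_self_eq_norm_sq, real_inner_self_eq_norm_sq] at h3
    have h4 : 0 ≤ inner ℝ ξ P * inner ℝ ξ P := mul_self_nonneg _
    rcases le_total 0 (deriv g (‖P‖ ^ 2)) with h | h
    · have : 0 ≤ 2 * deriv g (‖P‖ ^ 2) * (inner ℝ ξ P * inner ℝ ξ P) := by positivity
      have := mul_le_mul_of_nonneg_right h1 (sq_nonneg ‖ξ‖)
      linarith
    · have := mul_le_mul_of_nonneg_right h2 (sq_nonneg ‖ξ‖)
      have := mul_le_mul_of_nonpos_left h3 h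
      linarith
  · rw [quasiOp_apply]
    simp only [innerForm_apply, real_inner_self_eq_norm_sq, b.norm_eq_one, one_pow,
      Finset.sum_const, nsmul_eq_mul, mul_one, Finset.card_univ]
    have := mul_le_mul_of_nonneg_right (le_abs_self (deriv g (‖P‖ ^ 2))) (sq_nonneg ‖P‖)
    linarith

lemma abs_sum_bilin_le (b : OrthonormalBasis ι ℝ E) (H : E →L[ℝ] E →L[ℝ] ℝ) :
    |∑ i, H (b i) (b i)| ≤ Fintype.card ι * ‖H‖ := by
  refine (Finset.abs_sum_le_sum_abs _ _).trans ?_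
  rw [← nsmul_eq_mul, ← Finset.card_univ]
  refine Finset.sum_le_card_nsmul _ _ _ fun i _ => ?_
  have := H.le_opNorm₂ (b i) (b i)
  simpa using this

lemma Cond24.contDiffAt {g : ℝ → ℝ} (hg : Cond24 g) {ξ : ℝ} (hξ : 0 < ξ) :
    ContDiffAt ℝ 2 g ξ :=
  ((hg.1.contDiffAt (Ioi_mem_nhds hξ)).of_le (WithTop.coe_le_coe.2 (le_top (a := (2 : ℕ∞)))))

lemma Cond24.contDiffAt_deriv {g : ℝ → ℝ} (hg : Cond24 g) {ξ : ℝ} (hξ : 0 < ξ) :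
    ContDiffAt ℝ 1 (deriv g) ξ :=
  (hg.1.deriv_of_isOpen (m := 1) isOpen_Ioi (WithTop.coe_le_coe.2 (le_top (a := (2 : ℕ∞))))).contDiffAt
    (Ioi_mem_nhds hξ)

/-- Near a nonzero gradient, `quasiOp` is uniformly elliptic and Lipschitz in the gradient. -/
lemma exists_quasiOp_bounds {g : ℝ → ℝ} (hg : Cond24 g) (b : OrthonormalBasis ι ℝ E) {P₀ : E}
    (hP₀ : P₀ ≠ 0) : ∃ r > 0, ∃ l > 0, ∃ L C : ℝ, 0 ≤ C ∧
      (∀ P ∈ Metric.ball P₀ r, Elliptic l L (quasiOp g b P) ∧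
        ∀ e ξ, |quasiOp g b P (outer e ξ + outer ξ e)|
          ≤ C * (|inner ℝ e ξ| + |inner ℝ e P| * ‖ξ‖)) ∧
      ∀ P ∈ Metric.ball P₀ r, ∀ Q ∈ Metric.ball P₀ r, ∀ H,
        |quasiOp g b P H - quasiOp g b Q H| ≤ C * ‖P - Q‖ * ‖H‖ := by
  have hpos : 0 < ‖P₀‖ ^ 2 := by positivity
  have hnsq : ContDiff ℝ 1 fun P : E => ‖P‖ ^ 2 := contDiff_norm_sq ℝ
  have hα : ContDiffAt ℝ 1 (fun P : E => g (‖P‖ ^ 2)) P₀ :=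
    ContDiffAt.comp P₀ ((hg.contDiffAt hpos).of_le (by norm_num)) hnsq.contDiffAt
  have hβ : ContDiffAt ℝ 1 (fun P : E => 2 * deriv g (‖P‖ ^ 2)) P₀ :=
    contDiffAt_const.mul (ContDiffAt.comp P₀ (hg.contDiffAt_deriv hpos) hnsq.contDiffAt)
  have hG : ContinuousAt (fun P : E => Gfun g (‖P‖ ^ 2)) P₀ := by
    have : (fun P : E => Gfun g (‖P‖ ^ 2)) = fun P : E =>
        g (‖P‖ ^ 2) + ‖P‖ ^ 2 * (2 * deriv g (‖P‖ ^ 2)) := by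
      ext P; unfold Gfun; ring
    rw [this]
    exact hα.continuousAt.add (hnsq.continuous.continuousAt.mul hβ.continuousAt)
  have hg1 := hg.2.1 _ hpos
  have hg2 := hg.2.2.2.2 _ hpos
  set l : ℝ := min (g (‖P₀‖ ^ 2)) (Gfun g (‖P₀‖ ^ 2)) / 2 with hl
  have hmin : 0 < min (g (‖P₀‖ ^ 2)) (Gfun g (‖P₀‖ ^ 2)) := lt_min hg1 hg2
  have hl0 : 0 < l := by positivity
  have hl1 : l < g (‖P₀‖ ^ 2) := by
    have := min_le_left (g (‖P₀‖ ^ 2)) (Gfun g (‖P₀‖ ^ 2)); linarith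
  have hl2 : l < Gfun g (‖P₀‖ ^ 2) := by
    have := min_le_right (g (‖P₀‖ ^ 2)) (Gfun g (‖P₀‖ ^ 2)); linarith
  obtain ⟨K₁, s₁, hs₁, hK₁⟩ := hα.exists_lipschitzOnWith
  obtain ⟨K₂, s₂, hs₂, hK₂⟩ := hβ.exists_lipschitzOnWith
  set a : ℝ := g (‖P₀‖ ^ 2) + 1 with ha
  set B : ℝ := |2 * deriv g (‖P₀‖ ^ 2)| + 1 with hB
  set m : ℝ := ‖P₀‖ + 1 with hm
  have hB0 : 0 < B := by positivity
  have hm0 : 0 < m := by positivity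
  have ha0 : 0 < a := by positivity
  have hev : ∀ᶠ P in 𝓝 P₀, P ∈ s₁ ∧ P ∈ s₂ ∧ P ≠ 0 ∧ l < g (‖P‖ ^ 2) ∧ l < Gfun g (‖P‖ ^ 2) ∧
      g (‖P‖ ^ 2) < a ∧ |2 * deriv g (‖P‖ ^ 2)| < B ∧ ‖P‖ < m := by
    refine (eventually_mem_set.2 hs₁).and ((eventually_mem_set.2 hs₂).and
      ((eventually_ne_nhds hP₀).and ?_))
    refine (hα.continuousAt.eventually (lt_mem_nhds hl1)).and
      ((hG.eventually (lt_mem_nhds hl2)).and ?_)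
    refine (hα.continuousAt.eventually (gt_mem_nhds (by linarith))).and
      ((hβ.continuousAt.abs.eventually (gt_mem_nhds (by linarith))).and
      (continuous_norm.continuousAt.eventually (gt_mem_nhds (by linarith))))
  obtain ⟨r, hr, hrP⟩ := Metric.eventually_nhds_iff_ball.1 hev
  set C : ℝ := 2 * a + 2 * B * m + (K₁ * Fintype.card ι + K₂ * m ^ 2 + 2 * B * m) with hC
  refine ⟨r, hr, l, hl0, Fintype.card ι * a + B * m ^ 2, C, by positivity, fun P hP => ⟨?_, ?_⟩, ?_⟩
  · obtain ⟨-, -, h0, h1, h2, h3, h4, h5⟩ := hrP P hP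
    refine elliptic_quasiOp b h0 hl0 h1.le h2.le ?_
    rw [abs_mul, abs_two] at h4
    gcongr
  · obtain ⟨-, -, h0, h1, h2, h3, h4, h5⟩ := hrP P hP
    intro e ξ
    rw [map_add, quasiOp_outer, quasiOp_outer, real_inner_comm e ξ]
    have e1 : g (‖P‖ ^ 2) * inner ℝ e ξ + 2 * deriv g (‖P‖ ^ 2) * (inner ℝ e P * inner ℝ ξ P)
        + (g (‖P‖ ^ 2) * inner ℝ e ξ + 2 * deriv g (‖P‖ ^ 2) * (inner ℝ ξ P * inner ℝ e P))
        = 2 * g (‖P‖ ^ 2) * inner ℝ e ξ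
          + 2 * (2 * deriv g (‖P‖ ^ 2)) * inner ℝ e P * inner ℝ ξ P := by ring
    rw [e1]
    refine (abs_add_le _ _).trans ?_
    rw [abs_mul (2 * g (‖P‖ ^ 2)), abs_mul _ (inner ℝ ξ P), abs_mul _ (inner ℝ e P),
      abs_mul 2 (2 * _), abs_of_pos (by linarith : 0 < 2 * g (‖P‖ ^ 2)), abs_two]
    have e2 : |inner ℝ ξ P| ≤ ‖ξ‖ * m := (abs_real_inner_le_norm ξ P).trans (by gcongr)
    calc 2 * g (‖P‖ ^ 2) * |inner ℝ e ξ| + 2 * |2 * deriv g (‖P‖ ^ 2)| * |inner ℝ e P| * |inner ℝ ξ P|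
        ≤ 2 * a * |inner ℝ e ξ| + 2 * B * |inner ℝ e P| * (‖ξ‖ * m) := by gcongr
      _ = 2 * a * |inner ℝ e ξ| + 2 * B * m * (|inner ℝ e P| * ‖ξ‖) := by ring
      _ ≤ C * |inner ℝ e ξ| + C * (|inner ℝ e P| * ‖ξ‖) := by
          have : 0 ≤ (K₁ : ℝ) * Fintype.card ι + K₂ * m ^ 2 + 2 * B * m := by positivity
          gcongr
          · rw [hC]; nlinarith
          · rw [hC]; nlinarith
      _ = _ := by ring
  · intro P hP Q hQ H
    obtain ⟨p1, p2, -, -, -, -, -, hPm⟩ := hrP P hP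
    obtain ⟨q1, q2, -, -, -, -, hQB, hQm⟩ := hrP Q hQ
    have e1 := hK₁.dist_le_mul P p1 Q q1
    have e2 := hK₂.dist_le_mul P p2 Q q2
    rw [dist_eq_norm, dist_eq_norm, Real.norm_eq_abs] at e1 e2
    have e3 := abs_sum_bilin_le b H
    have e4 : |H P P| ≤ ‖H‖ * m ^ 2 := by
      have := H.le_opNorm₂ P P
      rw [Real.norm_eq_abs] at this
      calc |H P P| ≤ ‖H‖ * ‖P‖ * ‖P‖ := this
        _ ≤ ‖H‖ * m * m := by gcongr
        _ = _ := by ring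
    have e5 : |H P P - H Q Q| ≤ ‖H‖ * ‖P - Q‖ * (2 * m) := by
      have h1 : H P P - H Q Q = H (P - Q) P + H Q (P - Q) := by
        simp only [map_sub, sub_apply]; ring
      rw [h1]
      have h2 := H.le_opNorm₂ (P - Q) P
      have h3 := H.le_opNorm₂ Q (P - Q)
      rw [Real.norm_eq_abs] at h2 h3
      calc |H (P - Q) P + H Q (P - Q)| ≤ ‖H‖ * ‖P - Q‖ * ‖P‖ + ‖H‖ * ‖Q‖ * ‖P - Q‖ :=
            (abs_add_le _ _).trans (add_le_add h2 h3)
        _ ≤ ‖H‖ * ‖P - Q‖ * m + ‖H‖ * m * ‖P - Q‖ := by gcongr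
        _ = _ := by ring
    have e6 : quasiOp g b P H - quasiOp g b Q H
        = (g (‖P‖ ^ 2) - g (‖Q‖ ^ 2)) * (∑ i, H (b i) (b i))
          + (2 * deriv g (‖P‖ ^ 2) - 2 * deriv g (‖Q‖ ^ 2)) * H P P
          + 2 * deriv g (‖Q‖ ^ 2) * (H P P - H Q Q) := by
      rw [quasiOp_apply, quasiOp_apply]; ring
    rw [e6]
    refine (abs_add_three _ _ _).trans ?_
    rw [abs_mul, abs_mul _ (H P P), abs_mul _ (H P P - H Q Q)]
    calc _ ≤ K₁ * ‖P - Q‖ * (Fintype.card ι * ‖H‖) + K₂ * ‖P - Q‖ * (‖H‖ * m ^ 2)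
          + B * (‖H‖ * ‖P - Q‖ * (2 * m)) := by gcongr
      _ = (K₁ * Fintype.card ι + K₂ * m ^ 2 + 2 * B * m) * (‖P - Q‖ * ‖H‖) := by ring
      _ ≤ C * (‖P - Q‖ * ‖H‖) := by
          gcongr
          rw [hC]
          have : 0 ≤ 2 * a + 2 * B * m := by positivity
          linarith
      _ = _ := by ring

end Operator

section Linearization

variable {E : Type*} [NormedAddCommGroup E] [InnerProductSpace ℝ E] [CompleteSpace E]
  {ι : Type*} [Fintype ι]

lemma norm_gradient_eq (u : E → ℝ) (x : E) : ‖gradient u x‖ = ‖fderiv ℝ u x‖ := by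
  rw [gradient, LinearIsometryEquiv.norm_map]

lemma ContDiffAt.continuousAt_gradient {u : E → ℝ} {x : E} (hu : ContDiffAt ℝ 2 u x) :
    ContinuousAt (gradient u) x := by
  have h := (hu.differentiableAt_fderiv).continuousAt
  exact (InnerProductSpace.toDual ℝ E).symm.continuous.continuousAt.comp h

/-- Expansion of the divergence-form operator. -/
lemma sum_fderiv_eq_quasiOp {g : ℝ → ℝ} (hg : Cond24 g) (b : OrthonormalBasis ι ℝ E) {u : E → ℝ}
    {x : E} (hu : ContDiffAt ℝ 2 u x) (h0 : gradient u x ≠ 0) :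
    ∑ i, fderiv ℝ (fun y => g (‖gradient u y‖ ^ 2) * fderiv ℝ u y (b i)) x (b i)
      = quasiOp g b (gradient u x) (hess u x) := by
  have hD : HasFDerivAt (fderiv ℝ u) (hess u x) x := hu.differentiableAt_fderiv.hasFDerivAt
  have hi : ∀ i, HasFDerivAt (fun y => fderiv ℝ u y (b i)) ((hess u x).flip (b i)) x := by
    intro i
    have h1 := hD.clm_apply (hasFDerivAt_const (b i) x)
    refine h1.congr_fderiv ?_
    ext v; simp
  have hn : ∀ y, ‖gradient u y‖ ^ 2 = ∑ i, (fderiv ℝ u y (b i)) ^ 2 := by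
    intro y
    rw [← b.sum_sq_norm_inner_left]
    simp [inner_gradient_left]
  have hN : HasFDerivAt (fun y => ‖gradient u y‖ ^ 2)
      ((2 : ℝ) • (hess u x).flip (gradient u x)) x := by
    have h1 : HasFDerivAt (fun y => ∑ i, (fderiv ℝ u y (b i)) ^ 2) _ x :=
      HasFDerivAt.fun_sum (u := Finset.univ) fun i _ => (hi i).pow 2
    simp only [← hn] at h1
    refine h1.congr_fderiv ?_
    ext v
    have h2 : hess u x v (gradient u x) = ∑ i, fderiv ℝ u x (b i) * hess u x v (b i) := by
      conv_lhs => rw [← b.sum_repr' (gradient u x)]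
      simp only [map_sum, map_smul, smul_eq_mul]
      refine Finset.sum_congr rfl fun i _ => ?_
      rw [real_inner_comm, inner_gradient_left]
    simp only [sum_apply, smul_apply, ContinuousLinearMap.flip_apply, smul_eq_mul, h2,
      Finset.mul_sum]
    refine Finset.sum_congr rfl fun i _ => ?_
    simp
    ring
  have hpos : 0 < ‖gradient u x‖ ^ 2 := by positivity
  have hgd : HasDerivAt g (deriv g (‖gradient u x‖ ^ 2)) (‖gradient u x‖ ^ 2) :=
    ((hg.contDiffAt hpos).differentiableAt (by norm_num)).hasDerivAt
  have hG := hgd.comp_hasFDerivAt x hN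
  have hterm : ∀ i, fderiv ℝ (fun y => g (‖gradient u y‖ ^ 2) * fderiv ℝ u y (b i)) x (b i)
      = g (‖gradient u x‖ ^ 2) * hess u x (b i) (b i)
        + 2 * deriv g (‖gradient u x‖ ^ 2) *
          (inner ℝ (b i) (gradient u x) * hess u x (b i) (gradient u x)) := by
    intro i
    have := (hG.fun_mul (hi i)).fderiv
    simp only [Function.comp_def] at this
    rw [this]
    simp only [add_apply, smul_apply, ContinuousLinearMap.flip_apply, smul_eq_mul]
    rw [real_inner_comm, inner_gradient_left]
    ring
  rw [Finset.sum_congr rfl fun i _ => hterm i, Finset.sum_add_distrib, ← Finset.mul_sum,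
    ← Finset.mul_sum, quasiOp_apply]
  congr 2
  conv_rhs => rw [← b.sum_repr' (gradient u x)]
  rw [b.sum_repr']
  conv_rhs => enter [1]; rw [← b.sum_repr' (gradient u x)]
  simp only [map_sum, map_smul, sum_apply, smul_apply, smul_eq_mul]

lemma ContDiffAt.continuousAt_norm_hess {u : E → ℝ} {x : E} (hu : ContDiffAt ℝ 2 u x) :
    ContinuousAt (fun y => ‖hess u y‖) x :=
  ((hu.fderiv_right (m := 1) (by norm_num)).fderiv_right (m := 0) (by norm_num)).continuousAt.norm

lemma gradient_sub_eq {u v : E → ℝ} {x : E} (hu : DifferentiableAt ℝ u x)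
    (hv : DifferentiableAt ℝ v x) :
    ‖gradient v x - gradient u x‖ = ‖fderiv ℝ (v - u) x‖ := by
  rw [fderiv_sub hv hu, gradient, gradient, ← map_sub, LinearIsometryEquiv.norm_map]

lemma hess_sub {u v : E → ℝ} {x : E} (hu : ContDiffAt ℝ 2 u x) (hv : ContDiffAt ℝ 2 v x) :
    hess (v - u) x = hess v x - hess u x := by
  unfold hess
  have : fderiv ℝ (v - u) =ᶠ[𝓝 x] fderiv ℝ v - fderiv ℝ u := by
    filter_upwards [hu.eventually (by simp), hv.eventually (by simp)] with y h1 h2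
    rw [Pi.sub_apply, fderiv_sub (h2.differentiableAt (by norm_num))
      (h1.differentiableAt (by norm_num))]
  rw [this.fderiv_eq, fderiv_sub hv.differentiableAt_fderiv hu.differentiableAt_fderiv]

/-- The difference of two solutions with the same nonzero gradient at `x₀` satisfies, near `x₀`, a
uniformly elliptic differential inequality. -/
lemma exists_linearization {g : ℝ → ℝ} (hg : Cond24 g) (b : OrthonormalBasis ι ℝ E) {u v : E → ℝ}
    {x₀ : E} (hu : ContDiffAt ℝ 2 u x₀) (hv : ContDiffAt ℝ 2 v x₀)
    (huv : gradient v x₀ = gradient u x₀) (h0 : gradient u x₀ ≠ 0) (c : ℝ) :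
    ∃ r > 0, ∃ l > 0, ∃ L C : ℝ, 0 ≤ C ∧ ∀ y ∈ Metric.ball x₀ r,
      ContDiffAt ℝ 2 u y ∧ ContDiffAt ℝ 2 v y ∧
      (quasiOp g b (gradient u y) (hess u y) = c → quasiOp g b (gradient v y) (hess v y) = c →
        ∃ A : (E →L[ℝ] E →L[ℝ] ℝ) →ₗ[ℝ] ℝ, Elliptic l L A ∧
          (∀ e ξ, |A (outer e ξ + outer ξ e)| ≤
            C * (|inner ℝ e ξ| + |inner ℝ e (gradient u y + gradient v y)| * ‖ξ‖)) ∧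
          -(C * ‖fderiv ℝ (v - u) y‖) ≤ A (hess (v - u) y)) := by
  obtain ⟨r₀, hr₀, l, hl, L, C, hC, hE, hLip⟩ := exists_quasiOp_bounds hg b h0
  set M : ℝ := ‖hess u x₀‖ + ‖hess v x₀‖ + 1 with hM
  have hev : ∀ᶠ y in 𝓝 x₀, ContDiffAt ℝ 2 u y ∧ ContDiffAt ℝ 2 v y ∧
      gradient u y ∈ Metric.ball (gradient u x₀) r₀ ∧
      gradient v y ∈ Metric.ball (gradient u x₀) r₀ ∧ ‖hess u y‖ + ‖hess v y‖ < M := by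
    refine (hu.eventually (by simp)).and ((hv.eventually (by simp)).and
      ((hu.continuousAt_gradient.eventually (Metric.ball_mem_nhds _ hr₀)).and
      ((hv.continuousAt_gradient.eventually (huv ▸ Metric.ball_mem_nhds _ hr₀)).and ?_)))
    exact (hu.continuousAt_norm_hess.add hv.continuousAt_norm_hess).eventually
      (gt_mem_nhds (by simp only [hM, Pi.add_apply]; linarith))
  obtain ⟨r, hr, hrP⟩ := Metric.eventually_nhds_iff_ball.1 hev
  have hM0 : 0 < M := by positivity
  refine ⟨r, hr, l, hl, L, C + C * M, by positivity, fun y hy => ?_⟩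
  obtain ⟨h1, h2, hP, hQ, hH⟩ := hrP y hy
  refine ⟨h1, h2, fun e1 e2 => ?_⟩
  set P := gradient u y with hPdef
  set Q := gradient v y with hQdef
  set S : E := (1 / 2 : ℝ) • P + (1 / 2 : ℝ) • Q with hS
  have hSmem : S ∈ Metric.ball (gradient u x₀) r₀ :=
    (convex_ball _ _) hP hQ (by norm_num) (by norm_num) (by norm_num)
  have hSP : P + Q = (2 : ℝ) • S := by rw [hS]; module
  have hCM : 0 ≤ C * M := by positivity
  refine ⟨quasiOp g b S, (hE S hSmem).1, fun e ξ => ((hE S hSmem).2 e ξ).trans ?_, ?_⟩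
  · rw [hSP, inner_smul_right, abs_mul, abs_two]
    have h3 : 0 ≤ |inner ℝ e S| * ‖ξ‖ := by positivity
    have h4 : 0 ≤ |inner ℝ e ξ| := abs_nonneg _
    have h5 := mul_nonneg hCM (add_nonneg h4 h3)
    have h6 := mul_nonneg (add_nonneg hC hCM) h3
    nlinarith
  · have hnorm := gradient_sub_eq (h1.differentiableAt (by norm_num))
      (h2.differentiableAt (by norm_num))
    rw [← hPdef, ← hQdef] at hnorm
    rw [← hnorm, hess_sub h1 h2]
    refine le_of_le_of_eq ?_ (map_sub (quasiOp g b S) (hess v y) (hess u y)).symm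
    have hSQ : ‖S - Q‖ = ‖Q - P‖ / 2 := by
      rw [show S - Q = (-(1 / 2) : ℝ) • (Q - P) by rw [hS]; module, norm_smul]
      norm_num; ring
    have hSP' : ‖S - P‖ = ‖Q - P‖ / 2 := by
      rw [show S - P = ((1 / 2) : ℝ) • (Q - P) by rw [hS]; module, norm_smul]
      norm_num; ring
    have a1 := (abs_le.1 (hLip S hSmem Q hQ (hess v y))).1
    have a2 := (abs_le.1 (hLip S hSmem P hP (hess u y))).2
    rw [hSQ, e2] at a1
    rw [hSP', e1] at a2
    have h3 : C * ‖Q - P‖ * (‖hess u y‖ + ‖hess v y‖) ≤ C * ‖Q - P‖ * M := by gcongr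
    have h4 : 0 ≤ C * ‖Q - P‖ := by positivity
    have h5 : 0 ≤ C * ‖Q - P‖ * M := by positivity
    nlinarith

/-- The linear reflection in the hyperplane orthogonal to `e`. -/
def linRefl (e : E) : E →L[ℝ] E := ContinuousLinearMap.id ℝ E - (2 : ℝ) • (innerSL ℝ e).smulRight e

/-- The reflection in the hyperplane `⟪e, x⟫ = c`. -/
def planeRefl (e : E) (c : ℝ) (x : E) : E := x + (2 * (c - inner ℝ e x)) • e

lemma linRefl_apply (e v : E) : linRefl e v = v - (2 * inner ℝ e v) • e := by
  simp [linRefl, smul_smul]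

lemma inner_linRefl {e : E} (he : ‖e‖ = 1) (v : E) : inner ℝ e (linRefl e v) = -inner ℝ e v := by
  rw [linRefl_apply, inner_sub_right, inner_smul_right, real_inner_self_eq_norm_sq, he]
  ring

lemma linRefl_linRefl {e : E} (he : ‖e‖ = 1) (v : E) : linRefl e (linRefl e v) = v := by
  rw [linRefl_apply, inner_linRefl he, linRefl_apply]
  module

lemma inner_linRefl_left (e v w : E) : inner ℝ (linRefl e v) w = inner ℝ v (linRefl e w) := by
  rw [linRefl_apply, linRefl_apply, inner_sub_left, inner_sub_right, inner_smul_left,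
    inner_smul_right, real_inner_comm v e]
  simp
  ring

lemma norm_linRefl {e : E} (he : ‖e‖ = 1) (v : E) : ‖linRefl e v‖ = ‖v‖ := by
  have : ‖linRefl e v‖ ^ 2 = ‖v‖ ^ 2 := by
    rw [← real_inner_self_eq_norm_sq, inner_linRefl_left, linRefl_linRefl he,
      real_inner_self_eq_norm_sq]
  exact (pow_left_inj₀ (norm_nonneg _) (norm_nonneg _) two_ne_zero).1 this

lemma planeRefl_sub (e : E) (c : ℝ) (x y : E) :
    planeRefl e c x - planeRefl e c y = linRefl e (x - y) := by
  rw [planeRefl, planeRefl, linRefl_apply, inner_sub_right]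
  module

lemma norm_planeRefl_sub {e : E} (he : ‖e‖ = 1) (c : ℝ) (x y : E) :
    ‖planeRefl e c x - planeRefl e c y‖ = ‖x - y‖ := by
  rw [planeRefl_sub, norm_linRefl he]

lemma inner_planeRefl {e : E} (he : ‖e‖ = 1) (c : ℝ) (x : E) :
    inner ℝ e (planeRefl e c x) = 2 * c - inner ℝ e x := by
  rw [planeRefl, inner_add_right, inner_smul_right, real_inner_self_eq_norm_sq, he]
  ring

lemma planeRefl_eq_self {e : E} {c : ℝ} {x : E} (hx : inner ℝ e x = c) : planeRefl e c x = x := by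
  rw [planeRefl, hx]; simp

lemma hasFDerivAt_planeRefl (e : E) (c : ℝ) (x : E) :
    HasFDerivAt (planeRefl e c) (linRefl e) x := by
  have h : planeRefl e c = fun x => linRefl e x + (2 * c) • e := by
    ext1 x; rw [planeRefl, linRefl_apply]; module
  rw [h]
  exact (linRefl e).hasFDerivAt.add_const _

lemma contDiff_planeRefl (e : E) (c : ℝ) : ContDiff ℝ 2 (planeRefl e c) := by
  have h : planeRefl e c = fun x => linRefl e x + (2 * c) • e := by
    ext1 x; rw [planeRefl, linRefl_apply]; module
  rw [h]
  exact (linRefl e).contDiff.add contDiff_const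

lemma continuous_planeRefl (e : E) (c : ℝ) : Continuous (planeRefl e c) :=
  (contDiff_planeRefl e c).continuous

lemma fderiv_comp_planeRefl {u : E → ℝ} {e : E} {c : ℝ} {x : E}
    (hu : DifferentiableAt ℝ u (planeRefl e c x)) :
    fderiv ℝ (u ∘ planeRefl e c) x = (fderiv ℝ u (planeRefl e c x)).comp (linRefl e) :=
  (hu.hasFDerivAt.comp x (hasFDerivAt_planeRefl e c x)).fderiv

lemma gradient_comp_planeRefl {u : E → ℝ} {e : E} {c : ℝ} {x : E}
    (hu : DifferentiableAt ℝ u (planeRefl e c x)) :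
    gradient (u ∘ planeRefl e c) x = linRefl e (gradient u (planeRefl e c x)) := by
  refine ext_inner_right ℝ fun v => ?_
  rw [inner_gradient_left, fderiv_comp_planeRefl hu, inner_linRefl_left, inner_gradient_left]
  rfl

lemma hess_comp_planeRefl {u : E → ℝ} {e : E} {c : ℝ} {x : E}
    (hu : ContDiffAt ℝ 2 u (planeRefl e c x)) (v w : E) :
    hess (u ∘ planeRefl e c) x v w = hess u (planeRefl e c x) (linRefl e v) (linRefl e w) := by
  have hev : fderiv ℝ (u ∘ planeRefl e c) =ᶠ[𝓝 x]
      fun y => (fderiv ℝ u (planeRefl e c y)).comp (linRefl e) := by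
    have := (continuous_planeRefl e c).continuousAt.eventually (hu.eventually (by simp))
    filter_upwards [this] with y hy
    exact fderiv_comp_planeRefl (hy.differentiableAt (by norm_num))
  have h1 : HasFDerivAt (fun y => fderiv ℝ u (planeRefl e c y)) _ x :=
    hu.differentiableAt_fderiv.hasFDerivAt.comp x (hasFDerivAt_planeRefl e c x)
  unfold hess
  rw [hev.fderiv_eq, (h1.clm_comp (hasFDerivAt_const (linRefl e) x)).fderiv]
  simp

lemma ContDiffAt.comp_planeRefl {u : E → ℝ} {e : E} {c : ℝ} {x : E}
    (hu : ContDiffAt ℝ 2 u (planeRefl e c x)) : ContDiffAt ℝ 2 (u ∘ planeRefl e c) x :=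
  hu.comp x (contDiff_planeRefl e c).contDiffAt

/-- Reflected solutions are solutions. -/
lemma quasiOp_comp_planeRefl (g : ℝ → ℝ) (b : OrthonormalBasis ι ℝ E) {u : E → ℝ} {e : E}
    (he : ‖e‖ = 1) {c : ℝ} {x : E} (hu : ContDiffAt ℝ 2 u (planeRefl e c x)) :
    quasiOp g b (gradient (u ∘ planeRefl e c) x) (hess (u ∘ planeRefl e c) x)
      = quasiOp g b (gradient u (planeRefl e c x)) (hess u (planeRefl e c x)) := by
  rw [quasiOp_apply, quasiOp_apply, gradient_comp_planeRefl (hu.differentiableAt (by norm_num)),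
    norm_linRefl he, hess_comp_planeRefl hu, linRefl_linRefl he]
  simp only [hess_comp_planeRefl hu]
  set H := hess u (planeRefl e c x)
  have key : ∑ i, H (linRefl e (b i)) (linRefl e (b i)) = ∑ i, H (b i) (b i) := by
    have h1 : ∀ i, H (linRefl e (b i)) (linRefl e (b i)) = H (b i) (b i)
        - 2 * (inner ℝ (b i) e * H e (b i)) - 2 * (inner ℝ (b i) e * H (b i) e)
        + 4 * ((inner ℝ e (b i) * inner ℝ (b i) e) * H e e) := by
      intro i
      rw [linRefl_apply, real_inner_comm]
      simp only [map_sub, map_smul, sub_apply, smul_apply, smul_eq_mul]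
      ring
    have h2 : H e e = ∑ i, inner ℝ (b i) e * H e (b i) := by
      conv_lhs => enter [2]; rw [← b.sum_repr' e]
      simp only [map_sum, map_smul, smul_eq_mul]
    have h3 : H e e = ∑ i, inner ℝ (b i) e * H (b i) e := by
      conv_lhs => enter [1]; rw [← b.sum_repr' e]
      simp only [map_sum, map_smul, sum_apply, smul_apply, smul_eq_mul]
    simp only [h1, Finset.sum_add_distrib, Finset.sum_sub_distrib, ← Finset.mul_sum,
      ← Finset.sum_mul, b.sum_inner_mul_inner, real_inner_self_eq_norm_sq, he]
    rw [← h2, ← h3]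
    ring
  rw [key]

end Linearization

section Overdetermined

variable {E : Type*} [NormedAddCommGroup E] [InnerProductSpace ℝ E] [FiniteDimensional ℝ E]
  {ι : Type*} [Fintype ι]

/-- The overdetermined problem in the ring-shaped domain `Ω \ K`. -/
structure OverdetSol (g : ℝ → ℝ) (b : OrthonormalBasis ι ℝ E) (Ω K U : Set E) (q₀ c₁ c : ℝ)
    (u : E → ℝ) : Prop where
  cond : Cond24 g
  isOpen : IsOpen Ω
  isBounded : Bornology.IsBounded Ω
  convex : Convex ℝ Ω
  isCompact : IsCompact K
  subset : K ⊆ Ω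
  isOpen_U : IsOpen U
  closure_subset : closure (Ω \ K) ⊆ U
  contDiffOn : ContDiffOn ℝ 3 u U
  gradient_ne : ∀ x ∈ Ω \ K, gradient u x ≠ 0
  pde : ∀ x ∈ Ω \ K, quasiOp g b (gradient u x) (hess u x) = c
  q₀_pos : 0 < q₀
  c₁_pos : 0 < c₁
  outer_eq : ∀ x ∈ frontier Ω, u x = 0
  outer_gradient : ∀ x ∈ frontier Ω, ‖gradient u x‖ = q₀
  inner_eq : ∀ x ∈ frontier K, u x = -c₁
  inner_gradient : ∀ x ∈ frontier K, gradient u x = 0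

open Classical in
/-- Extension of `u` by the constant `-c₁` to `K`. -/
def extConst (K : Set E) (c₁ : ℝ) (u : E → ℝ) (x : E) : ℝ := if x ∈ K then -c₁ else u x

lemma extConst_of_mem {K : Set E} {c₁ : ℝ} {u : E → ℝ} {x : E} (hx : x ∈ K) :
    extConst K c₁ u x = -c₁ := by simp [extConst, hx]

lemma extConst_of_notMem {K : Set E} {c₁ : ℝ} {u : E → ℝ} {x : E} (hx : x ∉ K) :
    extConst K c₁ u x = u x := by simp [extConst, hx]

namespace OverdetSol
variable {g : ℝ → ℝ} {b : OrthonormalBasis ι ℝ E} {Ω K U : Set E} {q₀ c₁ c : ℝ} {u : E → ℝ}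

lemma isOpen_ring (h : OverdetSol g b Ω K U q₀ c₁ c u) : IsOpen (Ω \ K) :=
  h.isOpen.sdiff h.isCompact.isClosed

lemma ring_subset (h : OverdetSol g b Ω K U q₀ c₁ c u) : Ω \ K ⊆ U :=
  subset_closure.trans h.closure_subset

lemma notMem_of_frontier (h : OverdetSol g b Ω K U q₀ c₁ c u) {x : E} (hx : x ∈ frontier Ω) :
    x ∉ K := by
  rw [h.isOpen.frontier_eq] at hx
  exact fun hK => hx.2 (h.subset hK)

lemma frontier_subset (h : OverdetSol g b Ω K U q₀ c₁ c u) : frontier Ω ⊆ U := by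
  intro x hx
  apply h.closure_subset
  have hK : Kᶜ ∈ 𝓝 x := h.isCompact.isClosed.isOpen_compl.mem_nhds (h.notMem_of_frontier hx)
  rw [mem_closure_iff_nhds]
  intro t ht
  obtain ⟨y, hy, hy2⟩ := mem_closure_iff_nhds.1 (frontier_subset_closure hx) _ (inter_mem ht hK)
  exact ⟨y, hy.1, hy2, hy.2⟩

lemma inner_frontier_subset (h : OverdetSol g b Ω K U q₀ c₁ c u) : frontier K ⊆ U := by
  intro x hx
  apply h.closure_subset
  rw [frontier_eq_closure_inter_closure, h.isCompact.isClosed.closure_eq] at hx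
  have hO := h.isOpen.mem_nhds (h.subset hx.1)
  rw [mem_closure_iff_nhds]
  intro t ht
  obtain ⟨y, hy, hy2⟩ := mem_closure_iff_nhds.1 hx.2 _ (inter_mem ht hO)
  exact ⟨y, hy.1, hy.2, hy2⟩

lemma contDiffAt (h : OverdetSol g b Ω K U q₀ c₁ c u) {x : E} (hx : x ∈ U) :
    ContDiffAt ℝ 2 u x :=
  (h.contDiffOn.contDiffAt (h.isOpen_U.mem_nhds hx)).of_le (by norm_num)

lemma differentiableAt (h : OverdetSol g b Ω K U q₀ c₁ c u) {x : E} (hx : x ∈ U) :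
    DifferentiableAt ℝ u x := (h.contDiffAt hx).differentiableAt (by norm_num)

lemma fderiv_eq_zero_iff {f : E → ℝ} {x : E} : gradient f x = 0 ↔ fderiv ℝ f x = 0 := by
  rw [← norm_eq_zero, norm_gradient_eq, norm_eq_zero]

lemma closure_ring_cases (h : OverdetSol g b Ω K U q₀ c₁ c u) {x : E} (hx : x ∈ closure (Ω \ K)) :
    x ∈ Ω \ K ∨ x ∈ frontier Ω ∨ x ∈ frontier K := by
  by_cases h1 : x ∈ Ω
  · by_cases h2 : x ∈ K
    · right; right
      rw [frontier_eq_closure_inter_closure]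
      exact ⟨subset_closure h2, closure_mono (fun y hy => hy.2) hx⟩
    · exact Or.inl ⟨h1, h2⟩
  · right; left
    rw [h.isOpen.frontier_eq]
    exact ⟨closure_mono sdiff_subset hx, h1⟩

lemma isCompact_closure_ring (h : OverdetSol g b Ω K U q₀ c₁ c u) : IsCompact (closure (Ω \ K)) :=
  (h.isBounded.subset sdiff_subset).isCompact_closure

lemma continuousOn_closure_ring (h : OverdetSol g b Ω K U q₀ c₁ c u) :
    ContinuousOn u (closure (Ω \ K)) := fun _ hx =>
  (h.differentiableAt (h.closure_subset hx)).continuousAt.continuousWithinAt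

lemma not_isLocalExtr (h : OverdetSol g b Ω K U q₀ c₁ c u) {x : E} (hx : x ∈ Ω \ K) :
    ¬ IsLocalExtr u x := fun hl => h.gradient_ne x hx (fderiv_eq_zero_iff.2 hl.fderiv_eq_zero)

lemma neg (h : OverdetSol g b Ω K U q₀ c₁ c u) {x : E} (hx : x ∈ Ω \ K) : u x < 0 := by
  obtain ⟨m, hm, hmax⟩ := h.isCompact_closure_ring.exists_isMaxOn ⟨x, subset_closure hx⟩
    h.continuousOn_closure_ring
  have hm0 : u m ≤ 0 := by
    rcases h.closure_ring_cases hm with h1 | h1 | h1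
    · exact absurd (Or.inr (hmax.isLocalMax (mem_of_superset (h.isOpen_ring.mem_nhds h1)
        subset_closure))) (h.not_isLocalExtr h1)
    · exact (h.outer_eq m h1).le
    · rw [h.inner_eq m h1]; linarith [h.c₁_pos]
  have hle : ∀ y ∈ Ω \ K, u y ≤ 0 := fun y hy => (hmax (subset_closure hy)).trans hm0
  refine lt_of_le_of_ne (hle x hx) fun h0 => h.not_isLocalExtr hx (Or.inr ?_)
  filter_upwards [h.isOpen_ring.mem_nhds hx] with y hy
  rw [h0]; exact hle y hy

lemma gt (h : OverdetSol g b Ω K U q₀ c₁ c u) {x : E} (hx : x ∈ Ω \ K) : -c₁ < u x := by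
  obtain ⟨m, hm, hmin⟩ := h.isCompact_closure_ring.exists_isMinOn ⟨x, subset_closure hx⟩
    h.continuousOn_closure_ring
  have hm0 : -c₁ ≤ u m := by
    rcases h.closure_ring_cases hm with h1 | h1 | h1
    · exact absurd (Or.inl (hmin.isLocalMin (mem_of_superset (h.isOpen_ring.mem_nhds h1)
        subset_closure))) (h.not_isLocalExtr h1)
    · rw [h.outer_eq m h1]; linarith [h.c₁_pos]
    · exact (h.inner_eq m h1).ge
  have hle : ∀ y ∈ Ω \ K, -c₁ ≤ u y := fun y hy => hm0.trans (hmin (subset_closure hy))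
  refine lt_of_le_of_ne (hle x hx) fun h0 => h.not_isLocalExtr hx (Or.inl ?_)
  filter_upwards [h.isOpen_ring.mem_nhds hx] with y hy
  rw [← h0]; exact hle y hy

local notation "𝔴" => extConst K c₁ u

lemma ext_eventuallyEq (h : OverdetSol g b Ω K U q₀ c₁ c u) {x : E} (hx : x ∉ K) :
    𝔴 =ᶠ[𝓝 x] u := by
  filter_upwards [h.isCompact.isClosed.isOpen_compl.mem_nhds hx] with y hy
  exact extConst_of_notMem hy

lemma ext_hasFDerivAt (h : OverdetSol g b Ω K U q₀ c₁ c u) {x : E} (hx : x ∈ K) :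
    HasFDerivAt 𝔴 (0 : E →L[ℝ] ℝ) x := by
  by_cases hi : x ∈ interior K
  · have : 𝔴 =ᶠ[𝓝 x] fun _ => -c₁ := by
      filter_upwards [isOpen_interior.mem_nhds hi] with y hy
      exact extConst_of_mem (interior_subset hy)
    exact (hasFDerivAt_const (-c₁) x).congr_of_eventuallyEq this
  · have hf : x ∈ frontier K := ⟨subset_closure hx, hi⟩
    have h1 := (h.differentiableAt (h.inner_frontier_subset hf)).hasFDerivAt
    rw [fderiv_eq_zero_iff.1 (h.inner_gradient x hf)] at h1
    rw [hasFDerivAt_iff_isLittleO] at h1 ⊢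
    refine Asymptotics.IsLittleO.of_norm_left (Asymptotics.IsBigO.trans_isLittleO ?_ h1)
    refine Asymptotics.IsBigO.of_bound 1 (Eventually.of_forall fun y => ?_)
    rw [extConst_of_mem hx, h.inner_eq x hf]
    by_cases hy : y ∈ K
    · rw [extConst_of_mem hy]; simp
    · rw [extConst_of_notMem hy]; simp

lemma mem_cases (h : OverdetSol g b Ω K U q₀ c₁ c u) {x : E} (hx : x ∈ closure Ω) :
    x ∈ K ∨ x ∈ Ω \ K ∨ x ∈ frontier Ω := by
  by_cases h1 : x ∈ Ω
  · by_cases h2 : x ∈ K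
    · exact Or.inl h2
    · exact Or.inr (Or.inl ⟨h1, h2⟩)
  · right; right; rw [h.isOpen.frontier_eq]; exact ⟨hx, h1⟩

lemma ext_differentiableAt (h : OverdetSol g b Ω K U q₀ c₁ c u) {x : E} (hx : x ∈ closure Ω) :
    DifferentiableAt ℝ 𝔴 x := by
  rcases h.mem_cases hx with h1 | h1 | h1
  · exact (h.ext_hasFDerivAt h1).differentiableAt
  · exact (h.differentiableAt (h.ring_subset h1)).congr_of_eventuallyEq (h.ext_eventuallyEq h1.2)
  · exact (h.differentiableAt (h.frontier_subset h1)).congr_of_eventuallyEq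
      (h.ext_eventuallyEq (h.notMem_of_frontier h1))

lemma ext_neg (h : OverdetSol g b Ω K U q₀ c₁ c u) {x : E} (hx : x ∈ Ω) : 𝔴 x < 0 := by
  by_cases hK : x ∈ K
  · rw [extConst_of_mem hK]; linarith [h.c₁_pos]
  · rw [extConst_of_notMem hK]; exact h.neg ⟨hx, hK⟩

lemma ext_frontier (h : OverdetSol g b Ω K U q₀ c₁ c u) {x : E} (hx : x ∈ frontier Ω) :
    𝔴 x = 0 := by
  rw [extConst_of_notMem (h.notMem_of_frontier hx), h.outer_eq x hx]

lemma ext_nonpos (h : OverdetSol g b Ω K U q₀ c₁ c u) {x : E} (hx : x ∈ closure Ω) : 𝔴 x ≤ 0 := by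
  by_cases h1 : x ∈ Ω
  · exact (h.ext_neg h1).le
  · exact (h.ext_frontier (by rw [h.isOpen.frontier_eq]; exact ⟨hx, h1⟩)).le

lemma le_ext (h : OverdetSol g b Ω K U q₀ c₁ c u) {x : E} (hx : x ∈ Ω) : -c₁ ≤ 𝔴 x := by
  by_cases hK : x ∈ K
  · rw [extConst_of_mem hK]
  · rw [extConst_of_notMem hK]; exact (h.gt ⟨hx, hK⟩).le

lemma linearization (h : OverdetSol g b Ω K U q₀ c₁ c u) {e : E} (he : ‖e‖ = 1) {l₀ : ℝ} {x : E}
    (hx : x ∈ U) (hRx : planeRefl e l₀ x ∈ U)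
    (hgr : gradient (u ∘ planeRefl e l₀) x = gradient u x) (h0 : gradient u x ≠ 0) :
    ∃ r > 0, ∃ l > 0, ∃ L C : ℝ, 0 ≤ C ∧ ∀ y ∈ Metric.ball x r,
      ContDiffAt ℝ 2 (u ∘ planeRefl e l₀ - u) y ∧ (y ∈ Ω \ K → planeRefl e l₀ y ∈ Ω \ K →
        ∃ A : (E →L[ℝ] E →L[ℝ] ℝ) →ₗ[ℝ] ℝ, Elliptic l L A ∧
          (∀ e' ξ, |A (outer e' ξ + outer ξ e')| ≤ C * (|inner ℝ e' ξ| +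
            |inner ℝ e' (gradient u y + gradient (u ∘ planeRefl e l₀) y)| * ‖ξ‖)) ∧
          -(C * ‖fderiv ℝ (u ∘ planeRefl e l₀ - u) y‖) ≤ A (hess (u ∘ planeRefl e l₀ - u) y)) := by
  obtain ⟨r, hr, l, hl, L, C, hC, hP⟩ := exists_linearization h.cond b (h.contDiffAt hx)
    (h.contDiffAt hRx).comp_planeRefl hgr h0 c
  refine ⟨r, hr, l, hl, L, C, hC, fun y hy => ?_⟩
  obtain ⟨h1, h2, h3⟩ := hP y hy
  refine ⟨h2.sub h1, fun hy1 hy2 => h3 (h.pde y hy1) ?_⟩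
  rw [quasiOp_comp_planeRefl g b he (h.contDiffAt (h.ring_subset hy2))]
  exact h.pde _ hy2

lemma SubAt_sub_const {l L C : ℝ} {f : E → ℝ} {x : E} (hf : SubAt l L C f x) (m : ℝ) :
    SubAt l L C (fun y => f y - m) x := by
  have h1 : fderiv ℝ (fun y => f y - m) = fderiv ℝ f := by ext1 y; exact fderiv_sub_const m
  obtain ⟨A, hA, h2⟩ := hf
  refine ⟨A, hA, ?_⟩
  unfold hess at h2 ⊢
  rwa [h1]

/-- Comparison of the solution with its reflection. -/
lemma comparison (h : OverdetSol g b Ω K U q₀ c₁ c u) {e : E} (he : ‖e‖ = 1) {l₀ : ℝ}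
    (hadm : ∀ x ∈ Ω, l₀ < inner ℝ e x → planeRefl e l₀ x ∈ Ω) :
    ∀ x ∈ Ω, l₀ < inner ℝ e x → 𝔴 (planeRefl e l₀ x) ≤ 𝔴 x := by
  intro x₁ hx₁ hx₁'
  by_contra! hlt
  set R := planeRefl e l₀ with hR
  set C : Set E := {x | x ∈ Ω ∧ l₀ < inner ℝ e x} with hC
  have hinn : Continuous fun x : E => (inner ℝ e x : ℝ) := by fun_prop
  have hRc : Continuous R := continuous_planeRefl e l₀
  have hCo : IsOpen C := h.isOpen.inter (isOpen_lt continuous_const hinn)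
  have hCc : IsCompact (closure C) := (h.isBounded.subset fun x hx => hx.1).isCompact_closure
  have hC1 : closure C ⊆ closure Ω := closure_mono fun x hx => hx.1
  have hC2 : ∀ x ∈ closure C, l₀ ≤ inner ℝ e x := fun x hx =>
    closure_minimal (t := {x | l₀ ≤ inner ℝ e x}) (fun y hy => le_of_lt hy.2)
      (isClosed_le continuous_const hinn) hx
  have hC3 : ∀ x ∈ closure C, R x ∈ closure Ω := by
    have : MapsTo R C Ω := fun x hx => hadm x hx.1 hx.2
    exact fun x hx => this.closure hRc hx
  set φ : E → ℝ := fun x => 𝔴 (R x) - 𝔴 x with hφ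
  have hφd : ∀ x ∈ closure C, DifferentiableAt ℝ φ x := fun x hx =>
    ((h.ext_differentiableAt (hC3 x hx)).comp x
      (hasFDerivAt_planeRefl e l₀ x).differentiableAt).sub (h.ext_differentiableAt (hC1 hx))
  have hφc : ContinuousOn φ (closure C) := fun x hx =>
    (hφd x hx).continuousAt.continuousWithinAt
  have hx₁C : x₁ ∈ C := ⟨hx₁, hx₁'⟩
  obtain ⟨xm, hxm, hmax⟩ := hCc.exists_isMaxOn ⟨x₁, subset_closure hx₁C⟩ hφc
  set m := φ xm with hm
  have hm0 : 0 < m := lt_of_lt_of_le (by simp only [hφ]; linarith) (hmax (subset_closure hx₁C))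
  set M : Set E := {x | x ∈ closure C ∧ φ x = m} with hM
  have hMC : M ⊆ C := by
    rintro x ⟨hx, hxm⟩
    have h1 : l₀ < inner ℝ e x := by
      refine lt_of_le_of_ne (hC2 x hx) fun heq => ?_
      have : φ x = 0 := by simp only [hφ, hR, planeRefl_eq_self heq.symm, sub_self]
      linarith
    refine ⟨?_, h1⟩
    by_contra h2
    have h3 : 𝔴 x = 0 := h.ext_frontier (by rw [h.isOpen.frontier_eq]; exact ⟨hC1 hx, h2⟩)
    have h4 := h.ext_nonpos (hC3 x hx)
    have : φ x ≤ 0 := by simp only [hφ]; linarith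
    linarith
  have hMclosed : IsClosed M := hφc.preimage_isClosed_of_isClosed isClosed_closure isClosed_singleton
  have hMopen : IsOpen M := by
    rw [isOpen_iff_mem_nhds]
    intro x hx
    have hxC := hMC hx
    have hRx : R x ∈ Ω := hadm x hxC.1 hxC.2
    have hgt : 𝔴 x < 𝔴 (R x) := by
      have : φ x = m := hx.2
      simp only [hφ] at this; linarith
    have hRK : R x ∉ K := by
      intro hk
      rw [extConst_of_mem hk] at hgt
      linarith [h.le_ext hxC.1]
    have hloc : IsLocalMax φ x := by
      filter_upwards [hCo.mem_nhds hxC] with y hy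
      rw [hx.2]
      exact hmax (subset_closure hy)
    have hu' : DifferentiableAt ℝ u (R x) := h.differentiableAt (h.ring_subset ⟨hRx, hRK⟩)
    have hwR : (fun y => 𝔴 (R y)) =ᶠ[𝓝 x] u ∘ R :=
      hRc.continuousAt.eventually (h.ext_eventuallyEq hRK)
    have hdR : DifferentiableAt ℝ (u ∘ R) x :=
      hu'.comp x (hasFDerivAt_planeRefl e l₀ x).differentiableAt
    have hfd : fderiv ℝ (u ∘ R) x = fderiv ℝ 𝔴 x := by
      have h1 := hloc.fderiv_eq_zero
      have h2 : fderiv ℝ φ x = fderiv ℝ (fun y => 𝔴 (R y)) x - fderiv ℝ 𝔴 x :=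
        fderiv_fun_sub (hdR.congr_of_eventuallyEq hwR) (h.ext_differentiableAt (hC1 hx.1))
      rw [h2, hwR.fderiv_eq] at h1
      exact sub_eq_zero.1 h1
    have hgne : gradient (u ∘ R) x ≠ 0 := by
      rw [hR, gradient_comp_planeRefl hu', ← norm_ne_zero_iff, norm_linRefl he, norm_ne_zero_iff]
      exact h.gradient_ne _ ⟨hRx, hRK⟩
    have hxK : x ∉ K := by
      intro hk
      rw [(h.ext_hasFDerivAt hk).fderiv] at hfd
      exact hgne (fderiv_eq_zero_iff.2 hfd)
    have hgr : gradient (u ∘ R) x = gradient u x := by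
      unfold gradient
      rw [hfd, (h.ext_eventuallyEq hxK).fderiv_eq]
    obtain ⟨r, hr, l, hl, L, C', hC', hlin⟩ := h.linearization he (h.ring_subset ⟨hxC.1, hxK⟩)
      (h.ring_subset ⟨hRx, hRK⟩) hgr (hgr ▸ hgne)
    have hev : ∀ᶠ y in 𝓝 x, y ∈ C ∧ y ∈ Ω \ K ∧ R y ∈ Ω \ K ∧ 𝔴 y = u y ∧ 𝔴 (R y) = u (R y) := by
      filter_upwards [hCo.mem_nhds hxC, h.isOpen_ring.mem_nhds ⟨hxC.1, hxK⟩,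
        hRc.continuousAt.eventually (h.isOpen_ring.mem_nhds ⟨hRx, hRK⟩)] with y h1 h2 h3
      exact ⟨h1, h2, h3, extConst_of_notMem h2.2, extConst_of_notMem h3.2⟩
    obtain ⟨r', hr', hball⟩ := Metric.eventually_nhds_iff_ball.1 hev
    have hzero : ∀ᶠ y in 𝓝 x, (fun y => (u ∘ R - u) y - m) y = 0 := by
      refine SubAt.eventually_eq_zero (r := min r r') hl hC' (lt_min hr hr') (L := L) ?_ ?_ ?_
      · intro y hy
        have hy1 := Metric.ball_subset_ball (min_le_left r r') hy
        have hy2 := Metric.ball_subset_ball (min_le_right r r') hy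
        obtain ⟨-, h2, h3, -, -⟩ := hball y hy2
        obtain ⟨h4, h5⟩ := hlin y hy1
        refine ⟨h4.sub contDiffAt_const, SubAt_sub_const ?_ m⟩
        obtain ⟨A, hA, -, hA2⟩ := h5 h2 h3
        exact ⟨A, hA, hA2⟩
      · intro y hy
        obtain ⟨h1, -, -, h4, h5⟩ := hball y (Metric.ball_subset_ball (min_le_right r r') hy)
        have := hmax (subset_closure h1)
        simp only [mem_ofPred_eq, hφ] at this
        rw [h4, h5] at this
        simp only [Pi.sub_apply, Function.comp_apply]
        linarith
      · obtain ⟨-, -, -, h4, h5⟩ := hball x (Metric.mem_ball_self hr')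
        have : φ x = m := hx.2
        simp only [hφ, h4, h5] at this
        simp only [Pi.sub_apply, Function.comp_apply]
        linarith
    filter_upwards [hzero, hev] with y h1 h2
    refine ⟨subset_closure h2.1, ?_⟩
    simp only [Pi.sub_apply, Function.comp_apply] at h1
    simp only [hφ, h2.2.2.2.1, h2.2.2.2.2]
    linarith
  have hne : e ≠ 0 := by rintro rfl; simp at he
  have : Nontrivial E := ⟨⟨e, 0, hne⟩⟩
  have : NoncompactSpace E := NormedSpace.noncompactSpace ℝ E
  have huniv : M = univ := IsClopen.eq_univ ⟨hMclosed, hMopen⟩ ⟨xm, hxm, rfl⟩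
  have : IsCompact (univ : Set E) := huniv ▸ hCc.of_isClosed_subset hMclosed fun x hx => hx.1
  exact noncompact_univ E this

end OverdetSol
end Overdetermined

section Boundary

variable {E : Type*} [NormedAddCommGroup E] [InnerProductSpace ℝ E] [FiniteDimensional ℝ E]
  {ι : Type*} [Fintype ι]

lemma ContDiffAt.exists_taylor_bound {f : E → ℝ} {p : E} (hf : ContDiffAt ℝ 2 f p) :
    ∃ r > 0, ∃ M : ℝ, 0 ≤ M ∧ ∀ x ∈ Metric.ball p r, ContDiffAt ℝ 2 f x ∧
      |f x - f p - fderiv ℝ f p (x - p)| ≤ M * ‖x - p‖ ^ 2 ∧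
      ∀ y ∈ Metric.ball p r, ‖fderiv ℝ f x - fderiv ℝ f y‖ ≤ M * ‖x - y‖ := by
  have h1 : ContDiffAt ℝ 1 (fderiv ℝ f) p := hf.fderiv_right (by norm_num)
  obtain ⟨M, t, ht, hM⟩ := h1.exists_lipschitzOnWith
  obtain ⟨r, hr, hrt⟩ := Metric.mem_nhds_iff.1 (inter_mem ht (hf.eventually (by simp)))
  have hL : ∀ x ∈ Metric.ball p r, ∀ y ∈ Metric.ball p r,
      ‖fderiv ℝ f x - fderiv ℝ f y‖ ≤ M * ‖x - y‖ := by
    intro x hx y hy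
    simpa [dist_eq_norm] using hM.dist_le_mul x (hrt hx).1 y (hrt hy).1
  refine ⟨r, hr, M, M.2, fun x hx => ⟨(hrt hx).2, ?_, hL x hx⟩⟩
  have hp : p ∈ Metric.ball p r := Metric.mem_ball_self hr
  have hsub : Metric.closedBall p ‖x - p‖ ⊆ Metric.ball p r :=
    Metric.closedBall_subset_ball (by rwa [← dist_eq_norm])
  have := (convex_closedBall p ‖x - p‖).norm_image_sub_le_of_norm_hasFDerivWithin_le'
    (f := f) (f' := fderiv ℝ f) (φ := fderiv ℝ f p) (C := M * ‖x - p‖) (x := p) (y := x)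
    (fun y hy => (ContDiffAt.differentiableAt (n := 2) (hrt (hsub hy)).2
      (by norm_num)).hasFDerivAt.hasFDerivWithinAt)
    (fun y hy => (hL y (hsub hy) p hp).trans (by
      have : ‖y - p‖ ≤ ‖x - p‖ := by simpa [dist_eq_norm] using hy
      gcongr)) (Metric.mem_closedBall_self (norm_nonneg _)) (by simp [dist_eq_norm])
  rw [Real.norm_eq_abs] at this
  calc _ ≤ _ := this
    _ = _ := by ring

lemma IsPreconnected.exists_mem_frontier {X : Type*} [TopologicalSpace X] {T Ω : Set X}
    (hT : IsPreconnected T) (hO : IsOpen Ω) {a b : X} (ha : a ∈ T) (haΩ : a ∈ Ω) (hb : b ∈ T)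
    (hbΩ : b ∉ Ω) : ∃ z ∈ T, z ∈ frontier Ω := by
  by_contra! hno
  have hsub : T ⊆ Ω ∪ (closure Ω)ᶜ := by
    intro z hz
    by_contra hz2
    simp only [mem_union, mem_compl_iff, not_or, not_not] at hz2
    exact hno z hz (by rw [hO.frontier_eq]; exact ⟨hz2.2, hz2.1⟩)
  exact hbΩ (hT.subset_left_of_subset_union hO isClosed_closure.isOpen_compl
    (disjoint_compl_right_iff_subset.2 subset_closure) hsub ⟨a, ha, haΩ⟩ hb)

namespace OverdetSol
variable {g : ℝ → ℝ} {b : OrthonormalBasis ι ℝ E} {Ω K U : Set E} {q₀ c₁ c : ℝ} {u : E → ℝ}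
local notation "𝔴" => extConst K c₁ u

lemma compl_mem_nhds (h : OverdetSol g b Ω K U q₀ c₁ c u) {p : E} (hp : p ∈ frontier Ω) :
    Kᶜ ∈ 𝓝 p := h.isCompact.isClosed.isOpen_compl.mem_nhds (h.notMem_of_frontier hp)

lemma nonempty (_h : OverdetSol g b Ω K U q₀ c₁ c u) {p : E} (hp : p ∈ frontier Ω) :
    Ω.Nonempty := closure_nonempty_iff.1 ⟨p, frontier_subset_closure hp⟩

lemma inner_gradient_eq (_h : OverdetSol g b Ω K U q₀ c₁ c u) (p v : E) :
    inner ℝ (gradient u p) v = fderiv ℝ u p v := inner_gradient_left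

/-- `Ω` lies on one side of its tangent plane. -/
lemma inner_neg (h : OverdetSol g b Ω K U q₀ c₁ c u) {p : E} (hp : p ∈ frontier Ω) {x : E}
    (hx : x ∈ Ω) : inner ℝ (gradient u p) (x - p) < 0 := by
  have hle : ∀ y ∈ Ω, fderiv ℝ u p (y - p) ≤ 0 := by
    intro y hy
    have hmax : IsLocalMaxOn u (closure Ω) p := by
      filter_upwards [self_mem_nhdsWithin, mem_nhdsWithin_of_mem_nhds (h.compl_mem_nhds hp)]
        with z hz hzK
      rw [h.outer_eq p hp, ← extConst_of_notMem (c₁ := c₁) (u := u) hzK]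
      exact h.ext_nonpos hz
    refine hmax.hasFDerivWithinAt_nonpos
      (h.differentiableAt (h.frontier_subset hp)).hasFDerivAt.hasFDerivWithinAt
      (sub_mem_posTangentConeAt_of_segment_subset ?_)
    exact h.convex.closure.segment_subset (frontier_subset_closure hp) (subset_closure hy)
  have hev : ∀ᶠ s in 𝓝[>] (0:ℝ), x + s • gradient u p ∈ Ω := by
    have : ContinuousAt (fun s : ℝ => x + s • gradient u p) 0 := by fun_prop
    exact (this.eventually (by simpa using h.isOpen.mem_nhds hx)).filter_mono nhdsWithin_le_nhds
  obtain ⟨s, hs, hs0⟩ := (hev.and self_mem_nhdsWithin).exists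
  have h1 := hle _ hs
  rw [← h.inner_gradient_eq, show x + s • gradient u p - p = (x - p) + s • gradient u p by abel,
    inner_add_right, inner_smul_right, real_inner_self_eq_norm_sq, h.outer_gradient p hp] at h1
  have : 0 < s * q₀ ^ 2 := mul_pos hs0 (pow_pos h.q₀_pos 2)
  linarith

lemma exists_mem_of_neg (h : OverdetSol g b Ω K U q₀ c₁ c u) {p : E} (hp : p ∈ frontier Ω) :
    ∃ r > 0, ∀ x ∈ Metric.ball p r, u x < 0 → x ∈ Ω := by
  obtain ⟨y, hy⟩ := h.nonempty hp
  set v := y - p with hv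
  have hv0 : fderiv ℝ u p v < 0 := by
    rw [← h.inner_gradient_eq]; exact h.inner_neg hp hy
  have hc : ∀ᶠ x in 𝓝 p, DifferentiableAt ℝ u x ∧ fderiv ℝ u x v < 0 := by
    have h2 := h.contDiffAt (h.frontier_subset hp)
    have h1 : ContinuousAt (fun x => fderiv ℝ u x v) p :=
      h2.differentiableAt_fderiv.continuousAt.clm_apply continuousAt_const
    filter_upwards [h1.eventually_lt continuousAt_const hv0, h2.eventually (by simp)] with x hx hx2
    exact ⟨hx2.differentiableAt (by norm_num), hx⟩
  obtain ⟨r, hr, hrs⟩ := Metric.eventually_nhds_iff_ball.1 hc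
  obtain ⟨s, hs0, hs1, hsv⟩ : ∃ s : ℝ, 0 < s ∧ s ≤ 1 ∧ s * ‖v‖ < r / 2 := by
    refine ⟨min 1 (r / 2 / (‖v‖ + 1)), by positivity, min_le_left _ _, ?_⟩
    have : 0 < r / 2 / (‖v‖ + 1) := by positivity
    calc _ ≤ r / 2 / (‖v‖ + 1) * ‖v‖ := by gcongr; exact min_le_right _ _
      _ < r / 2 / (‖v‖ + 1) * (‖v‖ + 1) := by gcongr; linarith
      _ = r / 2 := by field_simp
  have hps : p + s • v ∈ Ω := by
    have := h.convex.add_smul_sub_mem_interior' (frontier_subset_closure hp)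
      (by rwa [h.isOpen.interior_eq]) (⟨hs0, hs1⟩ : s ∈ Ioc (0:ℝ) 1) (y := y)
    rwa [h.isOpen.interior_eq] at this
  have hev : ∀ᶠ x in 𝓝 p, x + s • v ∈ Ω := by
    have : ContinuousAt (fun x : E => x + s • v) p := by fun_prop
    exact this.eventually (h.isOpen.mem_nhds hps)
  obtain ⟨r', hr', hrs'⟩ := Metric.eventually_nhds_iff_ball.1 hev
  refine ⟨min r' (r / 2), by positivity, fun x hx hxu => ?_⟩
  rw [Metric.mem_ball, lt_min_iff] at hx
  by_contra hxΩ
  have hball : ∀ τ ∈ Icc (0:ℝ) s, x + τ • v ∈ Metric.ball p r := by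
    intro τ hτ
    rw [Metric.mem_ball, dist_eq_norm, show x + τ • v - p = (x - p) + τ • v by abel]
    have h1 : ‖τ • v‖ ≤ s * ‖v‖ := by
      rw [norm_smul, Real.norm_eq_abs, abs_of_nonneg hτ.1]; gcongr; exact hτ.2
    have h2 := hx.2
    rw [dist_eq_norm] at h2
    linarith [norm_add_le (x - p) (τ • v)]
  have hT : IsPreconnected ((fun τ : ℝ => x + τ • v) '' Icc 0 s) :=
    isPreconnected_Icc.image _ (by fun_prop)
  obtain ⟨z, ⟨τ, hτ, rfl⟩, hz⟩ := hT.exists_mem_frontier h.isOpen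
    ⟨s, ⟨hs0.le, le_rfl⟩, rfl⟩ (hrs' x hx.1) ⟨0, ⟨le_rfl, hs0.le⟩, (by simp : _ = x)⟩ hxΩ
  have hder : ∀ τ ∈ Icc (0:ℝ) s,
      HasDerivAt (fun τ : ℝ => u (x + τ • v)) (fderiv ℝ u (x + τ • v) v) τ := fun τ hτ =>
    (hrs _ (hball τ hτ)).1.hasFDerivAt.comp_hasDerivAt τ (hasDerivAt_line x v τ)
  have hanti : AntitoneOn (fun τ : ℝ => u (x + τ • v)) (Icc 0 s) := by
    refine antitoneOn_of_deriv_nonpos (convex_Icc _ _)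
      (fun τ hτ => (hder τ hτ).continuousAt.continuousWithinAt)
      (fun τ hτ => (hder τ (interior_subset hτ)).differentiableAt.differentiableWithinAt)
      fun τ hτ => ?_
    rw [(hder τ (interior_subset hτ)).deriv]
    exact (hrs _ (hball τ (interior_subset hτ))).2.le
  have := hanti ⟨le_rfl, hs0.le⟩ hτ hτ.1
  simp only [zero_smul, add_zero, h.outer_eq _ hz] at this
  linarith

lemma exists_interior_ball (h : OverdetSol g b Ω K U q₀ c₁ c u) {p : E} (hp : p ∈ frontier Ω) :
    ∃ R₀ > 0, ∀ R, 0 < R → R ≤ R₀ →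
      Metric.ball (p - R • (q₀⁻¹ • gradient u p)) R ⊆ Ω := by
  obtain ⟨r, hr, M, hM, ht⟩ := (h.contDiffAt (h.frontier_subset hp)).exists_taylor_bound
  obtain ⟨r', hr', hn⟩ := h.exists_mem_of_neg hp
  have hq := h.q₀_pos
  refine ⟨min (min r r' / 2) (q₀ / (2 * (M + 1))), by positivity, fun R hR hRle x hx => ?_⟩
  have hR1 : 2 * R ≤ min r r' := by linarith [hRle.trans (min_le_left _ _)]
  have hR2 : 2 * R * (M + 1) ≤ q₀ := by
    have := hRle.trans (min_le_right _ _)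
    rw [le_div_iff₀ (by positivity)] at this
    linarith
  set n := q₀⁻¹ • gradient u p with hn_def
  have hnn : ‖n‖ = 1 := by
    rw [hn_def, norm_smul, h.outer_gradient p hp, norm_inv, Real.norm_eq_abs, abs_of_pos hq]
    field_simp
  rw [Metric.mem_ball, dist_eq_norm] at hx
  have hxp : ‖x - p‖ < 2 * R := by
    have : x - p = (x - (p - R • n)) - R • n := by abel
    rw [this]
    refine (norm_sub_le _ _).trans_lt ?_
    rw [norm_smul, hnn, Real.norm_eq_abs, abs_of_pos hR]; linarith
  have hin : ‖x - p‖ ^ 2 + 2 * R * inner ℝ n (x - p) < 0 := by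
    have e1 : ‖x - (p - R • n)‖ ^ 2 = ‖x - p‖ ^ 2 + 2 * R * inner ℝ n (x - p) + R ^ 2 := by
      rw [show x - (p - R • n) = (x - p) + R • n by abel, norm_add_sq_real, inner_smul_right,
        norm_smul, hnn, Real.norm_eq_abs, mul_one, sq_abs, real_inner_comm]; ring
    have : ‖x - (p - R • n)‖ ^ 2 < R ^ 2 := by gcongr
    linarith
  have hPn : inner ℝ (gradient u p) (x - p) = q₀ * inner ℝ n (x - p) := by
    rw [hn_def, inner_smul_left]; simp; field_simp
  have hmin := hR1.trans_eq rfl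
  have hxr : x ∈ Metric.ball p r := by
    rw [Metric.mem_ball, dist_eq_norm]; linarith [min_le_left r r']
  have hxr' : x ∈ Metric.ball p r' := by
    rw [Metric.mem_ball, dist_eq_norm]; linarith [min_le_right r r']
  refine hn x hxr' ?_
  have h3 := (abs_le.1 (ht x hxr).2.1).2
  rw [h.outer_eq p hp, ← h.inner_gradient_eq, hPn] at h3
  have h4 : 0 < R := hR
  nlinarith [mul_nonneg hM (sq_nonneg ‖x - p‖), sq_nonneg ‖x - p‖,
    mul_le_mul_of_nonneg_right hR2 (sq_nonneg ‖x - p‖), mul_lt_mul_of_pos_left hin hq]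

end OverdetSol
end Boundary

section Reflection

variable {E : Type*} [NormedAddCommGroup E] [InnerProductSpace ℝ E] [FiniteDimensional ℝ E]
  {ι : Type*} [Fintype ι]

namespace OverdetSol
variable {g : ℝ → ℝ} {b : OrthonormalBasis ι ℝ E} {Ω K U : Set E} {q₀ c₁ c : ℝ} {u : E → ℝ}
local notation "𝔴" => extConst K c₁ u

lemma mem_closure_inter_halfspace {e : E} {l₀ : ℝ} {x : E} (hx : x ∈ closure Ω)
    (hl : l₀ < inner ℝ e x) : x ∈ closure ({x | l₀ < inner ℝ e x} ∩ Ω) :=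
  (isOpen_lt continuous_const (by fun_prop : Continuous fun x : E => (inner ℝ e x : ℝ))).inter_closure
    ⟨hl, hx⟩

lemma planeRefl_mem_closure {e : E} {l₀ : ℝ}
    (hadm : ∀ x ∈ Ω, l₀ < inner ℝ e x → planeRefl e l₀ x ∈ Ω) {x : E} (hx : x ∈ closure Ω)
    (hl : l₀ ≤ inner ℝ e x) : planeRefl e l₀ x ∈ closure Ω := by
  rcases hl.eq_or_lt with hl | hl
  · rwa [planeRefl_eq_self hl.symm]
  · have : MapsTo (planeRefl e l₀) ({x | l₀ < inner ℝ e x} ∩ Ω) Ω := fun y hy => hadm y hy.2 hy.1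
    exact this.closure (continuous_planeRefl e l₀) (mem_closure_inter_halfspace hx hl)

lemma closure_comparison (h : OverdetSol g b Ω K U q₀ c₁ c u) {e : E} (he : ‖e‖ = 1) {l₀ : ℝ}
    (hadm : ∀ x ∈ Ω, l₀ < inner ℝ e x → planeRefl e l₀ x ∈ Ω) {x : E} (hx : x ∈ closure Ω)
    (hl : l₀ ≤ inner ℝ e x) : 𝔴 (planeRefl e l₀ x) ≤ 𝔴 x := by
  rcases hl.eq_or_lt with hl' | hl'
  · rw [planeRefl_eq_self hl'.symm]
  · refine ContinuousWithinAt.closure_le (mem_closure_inter_halfspace hx hl')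
      (f := fun x => 𝔴 (planeRefl e l₀ x)) ?_ ?_ fun y hy => h.comparison he hadm y hy.2 hy.1
    · have h1 := (h.ext_differentiableAt (planeRefl_mem_closure hadm hx hl)).continuousAt
      exact (ContinuousAt.comp (x := x) h1
        (continuous_planeRefl e l₀).continuousAt).continuousWithinAt
    · exact (h.ext_differentiableAt hx).continuousAt.continuousWithinAt

lemma mem_frontier_of_ext_nonneg (h : OverdetSol g b Ω K U q₀ c₁ c u) {x : E}
    (hx : x ∈ closure Ω) (h0 : 0 ≤ 𝔴 x) : x ∈ frontier Ω := by
  rw [h.isOpen.frontier_eq]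
  exact ⟨hx, fun hΩ => absurd (h.ext_neg hΩ) (not_lt.2 h0)⟩

lemma exists_local_reflection (h : OverdetSol g b Ω K U q₀ c₁ c u) {e : E} (he : ‖e‖ = 1) {l₀ : ℝ}
    (hadm : ∀ x ∈ Ω, l₀ < inner ℝ e x → planeRefl e l₀ x ∈ Ω) {p : E} (hp : p ∈ frontier Ω)
    (hRp : planeRefl e l₀ p ∈ frontier Ω)
    (hgr : gradient (u ∘ planeRefl e l₀) p = gradient u p) :
    ∃ r > 0, ∃ l > 0, ∃ L C : ℝ, 0 ≤ C ∧ ∀ y ∈ Metric.ball p r,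
      ContDiffAt ℝ 2 (u ∘ planeRefl e l₀ - u) y ∧
      𝔴 (planeRefl e l₀ y) - 𝔴 y = (u ∘ planeRefl e l₀ - u) y ∧
      (y ∈ Ω → l₀ < inner ℝ e y →
        ∃ A : (E →L[ℝ] E →L[ℝ] ℝ) →ₗ[ℝ] ℝ, Elliptic l L A ∧
          (∀ e' ξ, |A (outer e' ξ + outer ξ e')| ≤ C * (|inner ℝ e' ξ| +
            |inner ℝ e' (gradient u y + gradient (u ∘ planeRefl e l₀) y)| * ‖ξ‖)) ∧
          -(C * ‖fderiv ℝ (u ∘ planeRefl e l₀ - u) y‖) ≤ A (hess (u ∘ planeRefl e l₀ - u) y)) := by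
  have h0 : gradient u p ≠ 0 := by
    rw [← norm_pos_iff, h.outer_gradient p hp]; exact h.q₀_pos
  obtain ⟨r, hr, l, hl, L, C, hC, hP⟩ :=
    h.linearization he (h.frontier_subset hp) (h.frontier_subset hRp) hgr h0
  obtain ⟨r', hr', hK⟩ := Metric.mem_nhds_iff.1 (inter_mem (h.compl_mem_nhds hp)
    ((continuous_planeRefl e l₀).continuousAt.preimage_mem_nhds (h.compl_mem_nhds hRp)))
  refine ⟨min r r', by positivity, l, hl, L, C, hC, fun y hy => ?_⟩
  obtain ⟨h1, h2⟩ := hP y (Metric.ball_subset_ball (min_le_left _ _) hy)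
  obtain ⟨hk1, hk2⟩ := hK (Metric.ball_subset_ball (min_le_right _ _) hy)
  refine ⟨h1, ?_, fun hyΩ hyl => h2 ⟨hyΩ, hk1⟩ ⟨hadm y hyΩ hyl, hk2⟩⟩
  rw [extConst_of_notMem hk1, extConst_of_notMem hk2]; rfl

/-- Near a boundary point, the solution and its reflection either coincide or are strictly
ordered. -/
lemma reflection_dichotomy (h : OverdetSol g b Ω K U q₀ c₁ c u) {e : E} (he : ‖e‖ = 1) {l₀ : ℝ}
    (hadm : ∀ x ∈ Ω, l₀ < inner ℝ e x → planeRefl e l₀ x ∈ Ω) {p : E} {r l L C : ℝ}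
    (hl : 0 < l) (hC : 0 ≤ C)
    (hP : ∀ y ∈ Metric.ball p r, ContDiffAt ℝ 2 (u ∘ planeRefl e l₀ - u) y ∧
      𝔴 (planeRefl e l₀ y) - 𝔴 y = (u ∘ planeRefl e l₀ - u) y ∧
      (y ∈ Ω → l₀ < inner ℝ e y → SubAt l L C (u ∘ planeRefl e l₀ - u) y)) :
    (∀ y ∈ Metric.ball p r, y ∈ Ω → l₀ < inner ℝ e y → (u ∘ planeRefl e l₀ - u) y = 0) ∨
    (∀ y ∈ Metric.ball p r, y ∈ Ω → l₀ < inner ℝ e y → (u ∘ planeRefl e l₀ - u) y < 0) := by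
  set V : Set E := Metric.ball p r ∩ (Ω ∩ {x | l₀ < inner ℝ e x}) with hV
  have hVo : IsOpen V := Metric.isOpen_ball.inter (h.isOpen.inter
    (isOpen_lt continuous_const (by fun_prop)))
  have hVc : Convex ℝ V := (convex_ball p r).inter (h.convex.inter
    (convex_halfSpace_gt (innerSL ℝ e).isLinear l₀))
  have hle : ∀ y ∈ V, (u ∘ planeRefl e l₀ - u) y ≤ 0 := fun y hy => by
    rw [← (hP y hy.1).2.1]
    linarith [h.comparison he hadm y hy.2.1 hy.2.2]
  have := SubAt.eq_zero_or_neg hVo hVc.isPreconnected hle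
    (fun y hy => (hP y hy.1).1.continuousAt.continuousWithinAt) (fun x hx h0 => by
      obtain ⟨ρ, hρ, hρV⟩ := Metric.isOpen_iff.1 hVo x hx
      exact SubAt.eventually_eq_zero hl hC hρ
        (fun y hy => ⟨(hP y (hρV hy).1).1, (hP y (hρV hy).1).2.2 (hρV hy).2.1 (hρV hy).2.2⟩)
        (fun y hy => hle y (hρV hy)) h0)
  exact this.imp (fun H y h1 h2 h3 => H y ⟨h1, h2, h3⟩) (fun H y h1 h2 h3 => H y ⟨h1, h2, h3⟩)

lemma planeRefl_mem_frontier_of_eq_zero (h : OverdetSol g b Ω K U q₀ c₁ c u) {e : E} {l₀ : ℝ}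
    (hadm : ∀ x ∈ Ω, l₀ < inner ℝ e x → planeRefl e l₀ x ∈ Ω) {p : E} {r : ℝ}
    (hP : ∀ y ∈ Metric.ball p r, ContDiffAt ℝ 2 (u ∘ planeRefl e l₀ - u) y ∧
      𝔴 (planeRefl e l₀ y) - 𝔴 y = (u ∘ planeRefl e l₀ - u) y)
    (hz : ∀ y ∈ Metric.ball p r, y ∈ Ω → l₀ < inner ℝ e y → (u ∘ planeRefl e l₀ - u) y = 0)
    {z : E} (hzr : z ∈ Metric.ball p r) (hzΩ : z ∈ frontier Ω) (hzl : l₀ < inner ℝ e z) :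
    planeRefl e l₀ z ∈ frontier Ω := by
  refine h.mem_frontier_of_ext_nonneg
    (planeRefl_mem_closure hadm (frontier_subset_closure hzΩ) hzl.le) (le_of_eq ?_)
  have h1 : (u ∘ planeRefl e l₀ - u) z = 0 := by
    have hcl : z ∈ closure (Metric.ball p r ∩ ({x | l₀ < inner ℝ e x} ∩ Ω)) :=
      Metric.isOpen_ball.inter_closure
        ⟨hzr, mem_closure_inter_halfspace (frontier_subset_closure hzΩ) hzl⟩
    have := (hP z hzr).1.continuousAt.continuousWithinAt.mem_closure_image hcl
    have h2 : (u ∘ planeRefl e l₀ - u) '' (Metric.ball p r ∩ ({x | l₀ < inner ℝ e x} ∩ Ω)) ⊆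
        {0} := by
      rintro _ ⟨y, hy, rfl⟩; exact hz y hy.1 hy.2.2 hy.2.1
    simpa using closure_mono h2 this
  have h3 := (hP z hzr).2
  rw [h1, h.ext_frontier hzΩ] at h3
  linarith

/-- At a boundary point with reflection on the boundary, nearby boundary points reflect to the
boundary. -/
lemma eventually_planeRefl_mem_frontier (h : OverdetSol g b Ω K U q₀ c₁ c u) {e : E}
    (he : ‖e‖ = 1) {l₀ : ℝ} (hadm : ∀ x ∈ Ω, l₀ < inner ℝ e x → planeRefl e l₀ x ∈ Ω) {p : E}
    (hp : p ∈ frontier Ω) (hl₀ : l₀ < inner ℝ e p) (hRp : planeRefl e l₀ p ∈ frontier Ω) :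
    ∀ᶠ z in 𝓝 p, z ∈ frontier Ω → planeRefl e l₀ z ∈ frontier Ω := by
  set P := gradient u p with hPdef
  set Q := gradient (u ∘ planeRefl e l₀) p with hQdef
  have hq := h.q₀_pos
  have hPn : ‖P‖ = q₀ := h.outer_gradient p hp
  have hQn : ‖Q‖ = q₀ := by
    rw [hQdef, gradient_comp_planeRefl (h.differentiableAt (h.frontier_subset hRp)),
      norm_linRefl he, h.outer_gradient _ hRp]
  have hd1 : DifferentiableAt ℝ u p := h.differentiableAt (h.frontier_subset hp)
  have hd2 : DifferentiableAt ℝ (u ∘ planeRefl e l₀) p :=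
    ((h.contDiffAt (h.frontier_subset hRp)).comp_planeRefl).differentiableAt (by norm_num)
  set n := q₀⁻¹ • P with hn
  have hnn : ‖n‖ = 1 := by
    rw [hn, norm_smul, hPn, norm_inv, Real.norm_eq_abs, abs_of_pos hq]; field_simp
  have hPq : P = q₀ • n := by rw [hn, smul_smul, mul_inv_cancel₀ hq.ne', one_smul]
  obtain ⟨R₀, hR₀, hball⟩ := h.exists_interior_ball hp
  rw [← hPdef, ← hn] at hball
  clear_value n
  have hT : ∀ᶠ y in 𝓝 p, l₀ < inner ℝ e y :=
    (by fun_prop : ContinuousAt (fun y : E => (inner ℝ e y : ℝ)) p).eventually (lt_mem_nhds hl₀)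
  have hQP : Q = P := by
    have hmax : IsLocalMaxOn (u ∘ planeRefl e l₀ - u) (closure Ω) p := by
      filter_upwards [self_mem_nhdsWithin, mem_nhdsWithin_of_mem_nhds hT,
        mem_nhdsWithin_of_mem_nhds (inter_mem (h.compl_mem_nhds hp)
        ((continuous_planeRefl e l₀).continuousAt.preimage_mem_nhds (h.compl_mem_nhds hRp)))]
        with y hy hyl hyK
      have h1 := h.closure_comparison he hadm hy hyl.le
      rw [extConst_of_notMem hyK.1, extConst_of_notMem hyK.2] at h1
      simp only [Pi.sub_apply, Function.comp, h.outer_eq _ hp, h.outer_eq _ hRp]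
      linarith
    have hcl : p - R₀ • n ∈ closure Ω := subset_closure (hball R₀ hR₀ le_rfl (Metric.mem_ball_self hR₀))
    have h2 := hmax.hasFDerivWithinAt_nonpos (hd2.sub hd1).hasFDerivAt.hasFDerivWithinAt
      (sub_mem_posTangentConeAt_of_segment_subset
        (h.convex.closure.segment_subset (frontier_subset_closure hp) hcl))
    rw [fderiv_sub hd2 hd1, sub_apply, ← inner_gradient_left, ← inner_gradient_left,
      ← hPdef, ← hQdef, show p - R₀ • n - p = -(R₀ • n) by abel, inner_neg_right, inner_neg_right,
      inner_smul_right, inner_smul_right] at h2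
    have h3 : (inner ℝ P n : ℝ) = q₀ := by
      rw [hPq, inner_smul_left, real_inner_self_eq_norm_sq, hnn]; simp
    have h4 : q₀ ≤ inner ℝ Q n := by
      rw [h3] at h2; exact le_of_mul_le_mul_left (by linarith) hR₀
    have h5 : ‖Q - P‖ ^ 2 ≤ 0 := by
      rw [norm_sub_sq_real, hQn, hPn, hPq, inner_smul_right]
      nlinarith
    have h6 : ‖Q - P‖ = 0 := by nlinarith [norm_nonneg (Q - P)]
    exact sub_eq_zero.1 (norm_eq_zero.1 h6)
  obtain ⟨r, hr, l, hl, L, C, hC, hP⟩ := h.exists_local_reflection he hadm hp hRp hQP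
  have hP' : ∀ y ∈ Metric.ball p r, ContDiffAt ℝ 2 (u ∘ planeRefl e l₀ - u) y ∧
      𝔴 (planeRefl e l₀ y) - 𝔴 y = (u ∘ planeRefl e l₀ - u) y ∧
      (y ∈ Ω → l₀ < inner ℝ e y → SubAt l L C (u ∘ planeRefl e l₀ - u) y) := by
    intro y hy
    obtain ⟨h1, h2, h3⟩ := hP y hy
    refine ⟨h1, h2, fun h4 h5 => ?_⟩
    obtain ⟨A, hA, -, hA2⟩ := h3 h4 h5
    exact ⟨A, hA, hA2⟩
  rcases h.reflection_dichotomy he hadm hl hC hP' with hz | hneg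
  · filter_upwards [hT, Metric.ball_mem_nhds p hr] with z hzl hzr hzΩ
    exact h.planeRefl_mem_frontier_of_eq_zero hadm (fun y hy => ⟨(hP y hy).1, (hP y hy).2.1⟩) hz
      hzr hzΩ hzl
  · exfalso
    obtain ⟨δ, hδ, hδT⟩ := Metric.eventually_nhds_iff_ball.1
      (hT.and (Metric.ball_mem_nhds p hr))
    obtain ⟨ρ, hρ, hρ1, hρ2⟩ : ∃ ρ > 0, ρ ≤ R₀ ∧ 2 * ρ < δ :=
      ⟨min R₀ (δ / 4), by positivity, min_le_left _ _, by linarith [min_le_right R₀ (δ / 4)]⟩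
    have hsub : Metric.closedBall (p - ρ • n) ρ ⊆ Metric.ball p δ := by
      intro y hy
      rw [Metric.mem_closedBall] at hy
      rw [Metric.mem_ball]
      have : dist (p - ρ • n) p = ρ := by
        rw [dist_eq_norm, show p - ρ • n - p = -(ρ • n) by abel, norm_neg, norm_smul, hnn,
          Real.norm_eq_abs, abs_of_pos hρ, mul_one]
      linarith [dist_triangle y (p - ρ • n) p]
    have hb := fun y hy => hδT y (hsub (Metric.ball_subset_closedBall hy))
    have hbΩ := hball ρ hρ hρ1
    have := hopf_boundary_point (f := u ∘ planeRefl e l₀ - u) (c := p - ρ • n) (p := p) hl hC hρ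
      (by rw [sub_sub_cancel, norm_smul, hnn, Real.norm_eq_abs, abs_of_pos hρ, mul_one])
      (fun y hy => ⟨(hP' y (hb y hy).2).1, (hP' y (hb y hy).2).2.2 (hbΩ hy) (hb y hy).1⟩)
      (fun y hy => (hP' y (hδT y (hsub hy)).2).1.continuousAt.continuousWithinAt)
      (fun y hy => hneg y (hb y hy).2 (hbΩ hy) (hb y hy).1)
      (by simp [h.outer_eq _ hp, h.outer_eq _ hRp]) (hd2.sub hd1)
    rw [fderiv_sub hd2 hd1, sub_apply, ← inner_gradient_left, ← inner_gradient_left,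
      ← hPdef, ← hQdef, hQP, sub_self] at this
    exact lt_irrefl _ this

end OverdetSol
end Reflection

section Corner

variable {E : Type*} [NormedAddCommGroup E] [InnerProductSpace ℝ E] [FiniteDimensional ℝ E]
  {ι : Type*} [Fintype ι]

/-- Hopf's lemma on a compact piece of a hyperplane, in quantitative form. -/
lemma exists_linear_bound {φ : E → ℝ} {e p : E} (he : ‖e‖ = 1) {O S : Set E} (hO : IsOpen O)
    (hS : IsCompact S) (hSO : S ⊆ O) (hS0 : ∀ x ∈ S, 0 ≤ inner ℝ e (x - p)) {l L C : ℝ}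
    (hl : 0 < l) (hC : 0 ≤ C) (hφ : ∀ x ∈ O, ContDiffAt ℝ 2 φ x)
    (hsub : ∀ x ∈ O, 0 < inner ℝ e (x - p) → SubAt l L C φ x)
    (hneg : ∀ x ∈ O, 0 < inner ℝ e (x - p) → φ x < 0)
    (h0 : ∀ x ∈ O, inner ℝ e (x - p) = 0 → φ x = 0) :
    ∃ η > 0, ∀ x ∈ S, φ x ≤ -(η * inner ℝ e (x - p)) := by
  have hee : (inner ℝ e e : ℝ) = 1 := by rw [real_inner_self_eq_norm_sq, he]; norm_num
  suffices H : ∃ η > 0, ∀ x ∈ S, 0 ≤ inner ℝ e (x - p) → φ x ≤ -(η * inner ℝ e (x - p)) by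
    obtain ⟨η, hη, H⟩ := H
    exact ⟨η, hη, fun x hx => H x hx (hS0 x hx)⟩
  refine hS.induction_on (p := fun s => ∃ η > 0, ∀ x ∈ s, 0 ≤ inner ℝ e (x - p) →
    φ x ≤ -(η * inner ℝ e (x - p))) ⟨1, one_pos, by simp⟩ ?_ ?_ ?_
  · rintro s t hst ⟨η, hη, H⟩
    exact ⟨η, hη, fun x hx => H x (hst hx)⟩
  · rintro s t ⟨η, hη, H⟩ ⟨η', hη', H'⟩
    refine ⟨min η η', lt_min hη hη', fun x hx hx0 => ?_⟩
    rcases hx with hx | hx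
    · refine (H x hx hx0).trans (neg_le_neg ?_)
      gcongr; exact min_le_left _ _
    · refine (H' x hx hx0).trans (neg_le_neg ?_)
      gcongr; exact min_le_right _ _
  · intro x hx
    suffices HH : ∃ η > 0, ∀ᶠ y in 𝓝 x, 0 ≤ inner ℝ e (y - p) → φ y ≤ -(η * inner ℝ e (y - p)) by
      obtain ⟨η, hη, HH⟩ := HH
      exact ⟨_, mem_nhdsWithin_of_mem_nhds HH, η, hη, fun y hy => hy⟩
    have hxO := hSO hx
    have htc : ContinuousAt (fun y : E => (inner ℝ e (y - p) : ℝ)) x := by fun_prop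
    rcases (hS0 x hx).eq_or_lt with hx0 | hx0
    · obtain ⟨ε, hε, hεO⟩ := Metric.isOpen_iff.1 hO x hxO
      have hτ : 0 < ε / 4 := by positivity
      set τ := ε / 4 with hτdef
      have hcb : Metric.closedBall (x + τ • e) τ ⊆ O := by
        intro y hy
        apply hεO
        rw [Metric.mem_closedBall] at hy
        rw [Metric.mem_ball]
        have : dist (x + τ • e) x = τ := by
          rw [dist_eq_norm, add_sub_cancel_left, norm_smul, he, Real.norm_eq_abs, abs_of_pos hτ,
            mul_one]
        linarith [dist_triangle y (x + τ • e) x]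
      have hpos : ∀ y ∈ Metric.ball (x + τ • e) τ, 0 < inner ℝ e (y - p) := by
        intro y hy
        rw [Metric.mem_ball, dist_eq_norm] at hy
        have e1 : (inner ℝ e (y - p) : ℝ) = inner ℝ e (y - (x + τ • e)) + τ := by
          rw [show y - p = (y - (x + τ • e)) + (x - p) + τ • e by abel, inner_add_right,
            inner_add_right, ← hx0, inner_smul_right, hee]; ring
        have e2 := abs_le.1 (abs_real_inner_le_norm e (y - (x + τ • e)))
        rw [he, one_mul] at e2
        linarith [e2.1]
      have hdx : DifferentiableAt ℝ φ x := (hφ x hxO).differentiableAt (by norm_num)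
      have hopf := hopf_boundary_point (f := φ) (c := x + τ • e) (p := x) hl hC hτ
        (by rw [sub_add_cancel_left, norm_neg, norm_smul, he, Real.norm_eq_abs, abs_of_pos hτ,
          mul_one])
        (fun y hy => ⟨hφ y (hcb (Metric.ball_subset_closedBall hy)),
          hsub y (hcb (Metric.ball_subset_closedBall hy)) (hpos y hy)⟩)
        (fun y hy => (hφ y (hcb hy)).continuousAt.continuousWithinAt)
        (fun y hy => hneg y (hcb (Metric.ball_subset_closedBall hy)) (hpos y hy))
        (h0 x hxO hx0.symm) hdx
      rw [sub_add_cancel_left, map_neg, map_smul, smul_eq_mul] at hopf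
      have hd : fderiv ℝ φ x e < 0 := by
        by_contra! hge
        nlinarith [mul_nonneg hτ.le hge]
      set η := -(fderiv ℝ φ x e) / 2 with hη
      have hη0 : 0 < η := by rw [hη]; linarith
      have hev : ∀ᶠ y in 𝓝 x, y ∈ O ∧ fderiv ℝ φ y e ≤ -η := by
        have hc : ContinuousAt (fun y => fderiv ℝ φ y e) x :=
          (hφ x hxO).differentiableAt_fderiv.continuousAt.clm_apply continuousAt_const
        have : fderiv ℝ φ x e < -η := by rw [hη]; linarith
        filter_upwards [hO.mem_nhds hxO, hc.eventually (gt_mem_nhds this)] with y h1 h2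
        exact ⟨h1, h2.le⟩
      obtain ⟨δ, hδ, hδb⟩ := Metric.eventually_nhds_iff_ball.1 hev
      refine ⟨η, hη0, ?_⟩
      filter_upwards [Metric.ball_mem_nhds x (by positivity : 0 < δ / 2)] with y hy hy0
      set t : ℝ := inner ℝ e (y - p) with ht
      rw [Metric.mem_ball, dist_eq_norm] at hy
      have htle : t ≤ ‖y - x‖ := by
        have e1 : t = inner ℝ e (y - x) := by
          rw [ht, show y - p = (y - x) + (x - p) by abel, inner_add_right, ← hx0, add_zero]
        have := (abs_le.1 (abs_real_inner_le_norm e (y - x))).2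
        rw [he, one_mul] at this
        linarith
      have hseg : ∀ s ∈ Icc (0:ℝ) t, (y - t • e) + s • e ∈ Metric.ball x δ := by
        intro s hs
        rw [Metric.mem_ball, dist_eq_norm,
          show (y - t • e) + s • e - x = (y - x) - (t - s) • e by module]
        refine (norm_sub_le _ _).trans_lt ?_
        rw [norm_smul, he, Real.norm_eq_abs, abs_of_nonneg (by linarith [hs.2])]
        linarith [hs.1]
      have hder : ∀ s ∈ Icc (0:ℝ) t, HasDerivAt (fun s : ℝ => φ ((y - t • e) + s • e))
          (fderiv ℝ φ ((y - t • e) + s • e) e) s := fun s hs =>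
        ((hφ _ (hδb _ (hseg s hs)).1).differentiableAt
          (by norm_num)).hasFDerivAt.comp_hasDerivAt s (hasDerivAt_line (y - t • e) e s)
      have hmv := (convex_Icc (0:ℝ) t).image_sub_le_mul_sub_of_deriv_le
        (f := fun s : ℝ => φ ((y - t • e) + s • e)) (C := -η)
        (fun s hs => (hder s hs).continuousAt.continuousWithinAt)
        (fun s hs => (hder s (interior_subset hs)).differentiableAt.differentiableWithinAt)
        (fun s hs => by
          rw [(hder s (interior_subset hs)).deriv]
          exact (hδb _ (hseg s (interior_subset hs))).2)
        0 ⟨le_rfl, hy0⟩ t ⟨hy0, le_rfl⟩ hy0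
      have hz : φ (y - t • e) = 0 := by
        refine h0 _ (by simpa using (hδb _ (hseg 0 ⟨le_rfl, hy0⟩)).1) ?_
        rw [show y - t • e - p = (y - p) - t • e by abel, inner_sub_right, inner_smul_right, hee]
        simp [ht]
      simp only [zero_smul, add_zero, sub_add_cancel, sub_zero, hz] at hmv
      linarith
    · set t : ℝ := inner ℝ e (x - p) with ht
      have hφx := hneg x hxO hx0
      refine ⟨(-φ x / 2) / (t + 1), div_pos (by linarith) (by linarith), ?_⟩
      filter_upwards [htc.eventually (gt_mem_nhds (lt_add_one t)),
        (hφ x hxO).continuousAt.eventually (gt_mem_nhds (by linarith : φ x < φ x / 2))]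
        with y h1 h2 _
      have : (-φ x / 2) / (t + 1) * inner ℝ e (y - p) ≤ (-φ x / 2) / (t + 1) * (t + 1) :=
        mul_le_mul_of_nonneg_left h1.le (div_pos (by linarith) (by linarith)).le
      rw [div_mul_cancel₀ _ (by linarith)] at this
      linarith

namespace OverdetSol
variable {g : ℝ → ℝ} {b : OrthonormalBasis ι ℝ E} {Ω K U : Set E} {q₀ c₁ c : ℝ} {u : E → ℝ}
local notation "𝔴" => extConst K c₁ u

lemma closedBall_subset_of_ball {p n : E} (hn : ‖n‖ = 1) {ρ : ℝ} (hρ : 0 < ρ)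
    (hb : Metric.ball (p - (2 * ρ) • n) (2 * ρ) ⊆ Ω) {x : E} (hx : ‖x - (p - ρ • n)‖ ≤ ρ)
    (hxp : x ≠ p) : x ∈ Ω := by
  apply hb
  rw [Metric.mem_ball, dist_eq_norm]
  have e1 : ∀ R : ℝ, ‖x - (p - R • n)‖ ^ 2 = ‖x - p‖ ^ 2 + 2 * R * inner ℝ n (x - p) + R ^ 2 := by
    intro R
    rw [show x - (p - R • n) = (x - p) + R • n by abel, norm_add_sq_real, inner_smul_right,
      norm_smul, hn, Real.norm_eq_abs, mul_one, sq_abs, real_inner_comm]; ring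
  have h1 : ‖x - (p - ρ • n)‖ ^ 2 ≤ ρ ^ 2 := by gcongr
  have h2 : 0 < ‖x - p‖ ^ 2 := pow_pos (norm_pos_iff.2 (sub_ne_zero.2 hxp)) 2
  rw [e1] at h1
  have h3 := e1 (2 * ρ)
  exact lt_of_pow_lt_pow_left₀ 2 (by linarith) (by rw [h3]; linarith)

end OverdetSol
end Corner

section Tangency

variable {E : Type*} [NormedAddCommGroup E] [InnerProductSpace ℝ E] [FiniteDimensional ℝ E]
  {ι : Type*} [Fintype ι]

namespace OverdetSol
variable {g : ℝ → ℝ} {b : OrthonormalBasis ι ℝ E} {Ω K U : Set E} {q₀ c₁ c : ℝ} {u : E → ℝ}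
local notation "𝔴" => extConst K c₁ u

lemma false_of_quadratic_bound {f : E → ℝ} {p v : E} {κ : ℝ} (hκ : 0 < κ)
    (hf : ContDiffAt ℝ 2 f p) (h0 : f p = 0) (h1 : fderiv ℝ f p v = 0) (h2 : hess f p v v = 0)
    (hle : ∀ᶠ s in 𝓝[>] (0 : ℝ), f (p + s • v) ≤ -(κ * s ^ 2)) : False := by
  have := second_deriv_nonpos (G := fun s : ℝ => f (p + s • v) + κ * s ^ 2)
    (G' := fun s : ℝ => fderiv ℝ f (p + s • v) v + κ * (2 * s)) (c := hess f p v v + κ * 2) ?_ ?_ ?_ ?_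
  · linarith
  · filter_upwards [hf.eventually_hasDerivAt_line v] with s hs
    exact hs.add (by simpa using ((hasDerivAt_pow 2 s).const_mul κ))
  · refine (hf.hasDerivAt_fderiv_line v v).add ?_
    simpa using (((hasDerivAt_id (0:ℝ)).const_mul 2).const_mul κ)
  · simp [h1]
  · filter_upwards [hle] with s hs
    simp only [zero_smul, add_zero, h0]
    linarith

/-- If the reflection plane is orthogonal to the boundary at `p`, the solution agrees with its
reflection. -/
lemma exists_reflected_of_tangent (h : OverdetSol g b Ω K U q₀ c₁ c u) {e : E}
    (he : ‖e‖ = 1) {l₀ : ℝ} (hadm : ∀ x ∈ Ω, l₀ < inner ℝ e x → planeRefl e l₀ x ∈ Ω) {p : E}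
    (hp : p ∈ frontier Ω) (hep : inner ℝ e p = l₀) (heP : inner ℝ e (gradient u p) = (0 : ℝ))
    (hH : hess u p e (gradient u p) = 0) :
    ∃ z ∈ frontier Ω, l₀ < inner ℝ e z ∧ planeRefl e l₀ z ∈ frontier Ω := by
  have hq := h.q₀_pos
  have hRp : planeRefl e l₀ p = p := planeRefl_eq_self hep
  have hu2 := h.contDiffAt (h.frontier_subset hp)
  have hd1 : DifferentiableAt ℝ u p := h.differentiableAt (h.frontier_subset hp)
  have hd2 : DifferentiableAt ℝ (u ∘ planeRefl e l₀) p :=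
    (ContDiffAt.comp_planeRefl (by rwa [hRp])).differentiableAt (n := 2) (by norm_num)
  have hgr : gradient (u ∘ planeRefl e l₀) p = gradient u p := by
    rw [gradient_comp_planeRefl (by rwa [hRp]), hRp, linRefl_apply, heP]; simp
  obtain ⟨n, hn⟩ : ∃ n, n = q₀⁻¹ • gradient u p := ⟨_, rfl⟩
  have hnn : ‖n‖ = 1 := by
    rw [hn, norm_smul, h.outer_gradient p hp, norm_inv, Real.norm_eq_abs, abs_of_pos hq]; field_simp
  have hen : (inner ℝ e n : ℝ) = 0 := by rw [hn, inner_smul_right, heP, mul_zero]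
  have hHn : hess u p e n = 0 := by rw [hn, map_smul, hH, smul_zero]
  have hHn' : hess u p n e = 0 := by
    rw [← hHn]
    exact (hu2.isSymmSndFDerivAt (by rw [minSmoothness_of_isRCLikeNormedField])) n e
  obtain ⟨R₀, hR₀, hball⟩ := h.exists_interior_ball hp
  rw [← hn] at hball
  have hee : (inner ℝ e e : ℝ) = 1 := by rw [real_inner_self_eq_norm_sq, he]; norm_num
  obtain ⟨r, hr, l, hl, L, C, hC, hP⟩ :=
    h.exists_local_reflection he hadm hp (by rwa [hRp]) hgr
  have hP' : ∀ y ∈ Metric.ball p r, ContDiffAt ℝ 2 (u ∘ planeRefl e l₀ - u) y ∧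
      𝔴 (planeRefl e l₀ y) - 𝔴 y = (u ∘ planeRefl e l₀ - u) y ∧
      (y ∈ Ω → l₀ < inner ℝ e y → SubAt l L C (u ∘ planeRefl e l₀ - u) y) := by
    intro y hy
    obtain ⟨h1, h2, h3⟩ := hP y hy
    refine ⟨h1, h2, fun h4 h5 => ?_⟩
    obtain ⟨A, hA, -, hA2⟩ := h3 h4 h5
    exact ⟨A, hA, hA2⟩
  have hsub0 : ∀ x, (inner ℝ e (x - p) : ℝ) = inner ℝ e x - l₀ := fun x => by
    rw [inner_sub_right, hep]
  rcases h.reflection_dichotomy he hadm hl hC hP' with hz | hneg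
  · obtain ⟨ρ, hρ, hρ1, hρ2⟩ : ∃ ρ > 0, ρ ≤ R₀ ∧ 2 * ρ < r :=
      ⟨min R₀ (r / 4), by positivity, min_le_left _ _, by linarith [min_le_right R₀ (r / 4)]⟩
    set s := ρ / 2 with hs
    have hT : IsPreconnected ((fun τ : ℝ => p - τ • n + s • e) '' Icc 0 ρ) :=
      isPreconnected_Icc.image _ (by fun_prop)
    obtain ⟨z, ⟨τ, hτ, rfl⟩, hz2⟩ := hT.exists_mem_frontier h.isOpen
      (a := p - ρ • n + s • e) (b := p + s • e) ⟨ρ, ⟨hρ.le, le_rfl⟩, rfl⟩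
      (hball ρ hρ hρ1 (by
        rw [Metric.mem_ball, dist_eq_norm, add_sub_cancel_left, norm_smul, he, Real.norm_eq_abs,
          abs_of_pos (by positivity)]; linarith))
      ⟨0, ⟨le_rfl, hρ.le⟩, by simp⟩ (fun hin => by
        have := h.inner_neg hp hin
        rw [add_sub_cancel_left, inner_smul_right, real_inner_comm, heP, mul_zero] at this
        exact lt_irrefl _ this)
    have hzl : l₀ < inner ℝ e (p - τ • n + s • e) := by
      rw [inner_add_right, inner_sub_right, inner_smul_right, inner_smul_right, hen, hee, hep]
      linarith
    refine ⟨_, hz2, hzl, h.planeRefl_mem_frontier_of_eq_zero hadm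
      (fun y hy => ⟨(hP y hy).1, (hP y hy).2.1⟩) hz ?_ hz2 hzl⟩
    rw [Metric.mem_ball, dist_eq_norm, show p - τ • n + s • e - p = s • e - τ • n by abel]
    refine (norm_sub_le _ _).trans_lt ?_
    rw [norm_smul, norm_smul, he, hnn, Real.norm_eq_abs, Real.norm_eq_abs,
      abs_of_pos (by positivity), abs_of_nonneg hτ.1]
    linarith [hτ.2]
  · exfalso
    obtain ⟨r', hr', M, hM, ht⟩ := hu2.exists_taylor_bound
    obtain ⟨ρ, hρ, hρ1⟩ : ∃ ρ > 0, 2 * ρ ≤ R₀ := ⟨R₀ / 2, by positivity, by linarith⟩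
    obtain ⟨d, hd, hdr, hdr', hd1', hdρ⟩ : ∃ d > 0, d < r ∧ d < r' ∧ d ≤ 1 ∧ d ≤ ρ / 2 := by
      refine ⟨min (min (r / 2) (r' / 2)) (min 1 (ρ / 2)), by positivity, ?_, ?_, ?_, ?_⟩
      · linarith [(min_le_left (min (r / 2) (r' / 2)) (min 1 (ρ / 2))).trans (min_le_left _ _)]
      · linarith [(min_le_left (min (r / 2) (r' / 2)) (min 1 (ρ / 2))).trans (min_le_right _ _)]
      · exact (min_le_right _ _).trans (min_le_left _ _)
      · exact (min_le_right _ _).trans (min_le_right _ _)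
    have hcb : ∀ x, ‖x - (p - ρ • n)‖ ≤ ρ → x ≠ p → x ∈ Ω := fun x hx hxp =>
      closedBall_subset_of_ball hnn hρ (hball _ (by positivity) hρ1) hx hxp
    have hmr : ∀ x, ‖x - p‖ ≤ d → x ∈ Metric.ball p r := fun x hx => by
      rw [Metric.mem_ball, dist_eq_norm]; linarith
    have hmr' : ∀ x, ‖x - p‖ ≤ d → x ∈ Metric.ball p r' := fun x hx => by
      rw [Metric.mem_ball, dist_eq_norm]; linarith
    have hRn : ∀ x, ‖planeRefl e l₀ x - p‖ = ‖x - p‖ := fun x => by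
      conv_lhs => rw [← hRp]
      exact norm_planeRefl_sub he l₀ x p
    set φ := u ∘ planeRefl e l₀ - u with hφ
    set S : Set E := {x | 0 ≤ (inner ℝ e (x - p) : ℝ) ∧ ‖x - (p - ρ • n)‖ ≤ ρ ∧ ‖x - p‖ = d} with hS
    have hSc : IsCompact S := by
      refine Metric.isCompact_of_isClosed_isBounded ?_
        ((Metric.isBounded_closedBall (x := p) (r := d)).subset fun x hx => ?_)
      · exact (isClosed_le continuous_const
          (by fun_prop : Continuous fun x : E => (inner ℝ e (x - p) : ℝ))).inter
          ((isClosed_le (by fun_prop : Continuous fun x : E => ‖x - (p - ρ • n)‖)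
            continuous_const).inter
            (isClosed_eq (by fun_prop : Continuous fun x : E => ‖x - p‖) continuous_const))
      · rw [Metric.mem_closedBall, dist_eq_norm]; exact hx.2.2.le
    obtain ⟨η, hη, hηS⟩ := exists_linear_bound (φ := φ) (p := p) he
      (h.isOpen.inter (Metric.isOpen_ball (x := p) (ε := r))) hSc
      (fun x hx => ⟨hcb x hx.2.1 (fun hxp => by
        have := hx.2.2; rw [hxp, sub_self, norm_zero] at this; linarith), hmr x hx.2.2.le⟩)
      (fun x hx => hx.1) hl hC (fun x hx => (hP x hx.2).1)
      (fun x hx hx0 => (hP' x hx.2).2.2 hx.1 (by rw [hsub0] at hx0; linarith))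
      (fun x hx hx0 => hneg x hx.2 hx.1 (by rw [hsub0] at hx0; linarith))
      (fun x hx hx0 => by
        have : planeRefl e l₀ x = x := planeRefl_eq_self (by rw [hsub0] at hx0; linarith)
        simp [hφ, this])
    obtain ⟨κ, hκ, hκs⟩ := serrin_corner (C := C * (1 + 2 * M)) (f := φ) hl (by positivity) hρ hd
      hd1' hdρ he hnn hen (fun x hx0 hxρ hxd => by
        have hxp : x ≠ p := fun hxp => by simp [hxp] at hx0
        have hxl : l₀ < inner ℝ e x := by rw [hsub0] at hx0; linarith
        obtain ⟨h1, -, h3⟩ := hP x (hmr x hxd.le)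
        obtain ⟨A, hA, hA1, hA2⟩ := h3 (hcb x hxρ.le hxp) hxl
        refine ⟨h1, A, hA, fun ξ => (hA1 e ξ).trans ?_, le_trans ?_ hA2⟩
        · have hRx := hmr' (planeRefl e l₀ x) (by rw [hRn]; exact hxd.le)
          have h4 : |inner ℝ e (gradient u x + gradient (u ∘ planeRefl e l₀) x)| ≤
              2 * M * inner ℝ e (x - p) := by
            rw [gradient_comp_planeRefl ((ht _ hRx).1.differentiableAt (by norm_num)),
              inner_add_right, inner_linRefl he, ← sub_eq_add_neg, real_inner_comm,
              real_inner_comm (gradient u (planeRefl e l₀ x)), inner_gradient_left,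
              inner_gradient_left, ← sub_apply]
            refine ((Real.norm_eq_abs _).symm.le.trans (ContinuousLinearMap.le_opNorm _ _)).trans ?_
            rw [he, mul_one]
            refine ((ht x (hmr' x hxd.le)).2.2 _ hRx).trans (le_of_eq ?_)
            rw [planeRefl, sub_add_cancel_left, norm_neg, norm_smul, he, Real.norm_eq_abs,
              hsub0, mul_one, abs_of_neg (by linarith)]
            ring
          have h5 : |inner ℝ e (gradient u x + gradient (u ∘ planeRefl e l₀) x)| * ‖ξ‖ ≤
              2 * M * inner ℝ e (x - p) * ‖ξ‖ := by gcongr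
          have h6 : 0 ≤ M * |inner ℝ e ξ| := by positivity
          have h7 : 0 ≤ inner ℝ e (x - p) * ‖ξ‖ := by positivity
          rw [mul_assoc C]
          refine mul_le_mul_of_nonneg_left ?_ hC
          nlinarith
        · have : C ≤ C * (1 + 2 * M) := by nlinarith [mul_nonneg hC hM]
          exact neg_le_neg (mul_le_mul_of_nonneg_right this (norm_nonneg _)))
      (fun x _ _ hx => (hP x (hmr x hx)).1.continuousAt)
      (fun x hx0 hxρ hx => by
        rw [← (hP x (hmr x hx)).2.1]
        have hxc : x ∈ closure Ω := by
          by_cases hxp : x = p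
          · rw [hxp]; exact frontier_subset_closure hp
          · exact subset_closure (hcb x hxρ hxp)
        linarith [h.closure_comparison he hadm hxc (by rw [hsub0] at hx0; linarith)])
      hη (fun x h1 h2 h3 => hηS x ⟨h1, h2, h3⟩)
    refine false_of_quadratic_bound hκ (hP p (Metric.mem_ball_self hr)).1
      (by simp [hφ, hRp]) ?_ ?_ hκs
    · rw [fderiv_sub hd2 hd1, sub_apply, ← inner_gradient_left, ← inner_gradient_left, hgr,
        sub_self]
    · rw [hess_sub hu2 (ContDiffAt.comp_planeRefl (by rwa [hRp])), sub_apply, sub_apply,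
        hess_comp_planeRefl (by rwa [hRp]), hRp]
      have : linRefl e (e - n) = -e - n := by
        rw [linRefl_apply, inner_sub_right, hee, hen]; module
      rw [this]
      have h1 : hess u p (-e - n) (-e - n) =
          hess u p e e + hess u p e n + hess u p n e + hess u p n n := by
        rw [show -e - n = (-1 : ℝ) • (e + n) by module, map_smul, map_smul, smul_apply, map_add,
          map_add]
        simp only [add_apply, smul_eq_mul]; ring
      have h2 : hess u p (e - n) (e - n) =
          hess u p e e - hess u p e n - hess u p n e + hess u p n n := by
        rw [map_sub, map_sub]
        simp only [sub_apply]
        ring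
      rw [h1, h2, hHn, hHn']; ring

end OverdetSol
end Tangency

section Symmetry

variable {E : Type*} [NormedAddCommGroup E] [InnerProductSpace ℝ E] [FiniteDimensional ℝ E]
  {ι : Type*} [Fintype ι]

lemma exists_radial_function {Ω : Set E} (hO : IsOpen Ω) (hc : Convex ℝ Ω)
    (hb : Bornology.IsBounded Ω) {x : E} (hx : x ∈ Ω) :
    ∃ γ : E → ℝ, Continuous γ ∧ (∀ v, v ≠ 0 → 0 < γ v) ∧
      (∀ a : ℝ, 0 ≤ a → ∀ v, γ (a • v) = a * γ v) ∧
      (∀ v, γ v = 1 ↔ x + v ∈ frontier Ω) ∧ (∀ v, γ v < 1 ↔ x + v ∈ Ω) := by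
  set s : Set E := (fun v => x + v) ⁻¹' Ω with hs
  have hso : IsOpen s := hO.preimage (by fun_prop)
  have hs0 : s ∈ 𝓝 (0 : E) := hso.mem_nhds (by simpa [hs] using hx)
  have hsc : Convex ℝ s := hc.translate_preimage_right x
  have hsb : Bornology.IsBounded s := by
    obtain ⟨B, hB⟩ := hb.exists_norm_le
    refine isBounded_iff_forall_norm_le.2 ⟨B + ‖x‖, fun v hv => ?_⟩
    have h1 := hB _ hv
    have h2 := norm_sub_le (x + v) x
    rw [add_sub_cancel_left] at h2
    linarith
  refine ⟨gauge s, continuous_gauge hsc hs0, fun v hv => ?_, fun a ha v => ?_, fun v => ?_,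
    fun v => ?_⟩
  · exact (gauge_pos (absorbent_nhds_zero hs0) ((NormedSpace.isVonNBounded_iff ℝ).2 hsb)).2 hv
  · rw [gauge_smul_of_nonneg ha, smul_eq_mul]
  · rw [gauge_eq_one_iff_mem_frontier hsc hs0]
    have := (Homeomorph.addLeft x).preimage_frontier Ω
    exact (Set.ext_iff.1 this v).symm
  · rw [gauge_lt_one_iff_mem_interior hsc hs0, hso.interior_eq]; rfl

lemma exists_chord {Ω : Set E} (hO : IsOpen Ω) (hc : Convex ℝ Ω) (hb : Bornology.IsBounded Ω)
    {e : E} (he : ‖e‖ = 1) {x : E} (hx : x ∈ Ω) :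
    ∃ l : ℝ, 0 < l ∧ x + l • e ∈ frontier Ω ∧ ∀ s : ℝ, 0 ≤ s → s < l → x + s • e ∈ Ω := by
  obtain ⟨γ, -, hpos, hhom, hfr, hlt⟩ := exists_radial_function hO hc hb hx
  have he0 : 0 < γ e := hpos e (by rw [← norm_pos_iff, he]; exact one_pos)
  refine ⟨(γ e)⁻¹, inv_pos.2 he0, ?_, fun s hs hsl => ?_⟩
  · rw [← hfr, hhom _ (inv_pos.2 he0).le, inv_mul_cancel₀ he0.ne']
  · rw [← hlt, hhom s hs]
    calc s * γ e < (γ e)⁻¹ * γ e := by gcongr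
      _ = 1 := inv_mul_cancel₀ he0.ne'

lemma HasStrictFDerivAt.tendsto_slope_seq {F : Type*} [NormedAddCommGroup F] [NormedSpace ℝ F]
    {f : E → F} {f' : E →L[ℝ] F} {p e : E} (hf : HasStrictFDerivAt f f' p) {a b : ℕ → E}
    {l : ℕ → ℝ} (ha : Tendsto a atTop (𝓝 p)) (hb : Tendsto b atTop (𝓝 p)) (hl : ∀ k, 0 < l k)
    (hab : ∀ k, b k = a k + l k • e) :
    Tendsto (fun k => (l k)⁻¹ • (f (b k) - f (a k))) atTop (𝓝 (f' e)) := by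
  rw [tendsto_iff_norm_sub_tendsto_zero]
  have h1 := hf.isLittleO.comp_tendsto (hb.prodMk_nhds ha)
  have h2 : (fun k => (l k)⁻¹ • (f (b k) - f (a k)) - f' e) =o[atTop] fun _ : ℕ => e := by
    have h3 := (Asymptotics.isBigO_refl (fun k => (l k)⁻¹) atTop).smul_isLittleO h1
    refine h3.congr (fun k => ?_) (fun k => ?_)
    · simp only [Function.comp, hab k, add_sub_cancel_left, map_smul]
      rw [smul_sub, smul_smul, inv_mul_cancel₀ (hl k).ne', one_smul]
    · simp only [Function.comp, hab k, add_sub_cancel_left]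
      rw [smul_smul, inv_mul_cancel₀ (hl k).ne', one_smul]
  have h4 := h2.trans_isBigO (Asymptotics.isBigO_const_const e (one_ne_zero : (1 : ℝ) ≠ 0) atTop)
  rw [Asymptotics.isLittleO_one_iff] at h4
  simpa using h4.norm

namespace OverdetSol
variable {g : ℝ → ℝ} {b : OrthonormalBasis ι ℝ E} {Ω K U : Set E} {q₀ c₁ c : ℝ} {u : E → ℝ}

lemma isCompact_frontier (h : OverdetSol g b Ω K U q₀ c₁ c u) : IsCompact (frontier Ω) :=
  h.isBounded.isCompact_closure.of_isClosed_subset isClosed_frontier frontier_subset_closure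

/-- Midpoint levels of chords of `Ω` in direction `e`. -/
def chordLevels (Ω : Set E) (e : E) : Set ℝ :=
  {s | ∃ a ∈ frontier Ω, ∃ b ∈ frontier Ω, ∃ l : ℝ, 0 < l ∧ b = a + l • e ∧
    s = (inner ℝ e a + inner ℝ e b) / 2}

lemma chordLevels_bddAbove (h : OverdetSol g b Ω K U q₀ c₁ c u) {e : E} (he : ‖e‖ = 1) :
    BddAbove (chordLevels Ω e) := by
  obtain ⟨B, hB⟩ := h.isCompact_frontier.isBounded.exists_norm_le
  refine ⟨B, ?_⟩
  rintro _ ⟨a, ha, b, hb, l, -, -, rfl⟩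
  have h1 := (abs_le.1 (abs_real_inner_le_norm e a)).2
  have h2 := (abs_le.1 (abs_real_inner_le_norm e b)).2
  rw [he, one_mul] at h1 h2
  linarith [hB a ha, hB b hb]

lemma chordLevels_nonempty (h : OverdetSol g b Ω K U q₀ c₁ c u) {e : E} (he : ‖e‖ = 1)
    (hne : Ω.Nonempty) : (chordLevels Ω e).Nonempty := by
  obtain ⟨x, hx⟩ := hne
  obtain ⟨l, hl, h1, -⟩ := exists_chord h.isOpen h.convex h.isBounded he hx
  obtain ⟨l', hl', h2, -⟩ := exists_chord h.isOpen h.convex h.isBounded (e := -e) (by rwa [norm_neg]) hx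
  exact ⟨_, _, h2, _, h1, l + l', by positivity, by module, rfl⟩

/-- The maximal moving-plane position is admissible. -/
lemma planeRefl_mem_of_sSup_lt (h : OverdetSol g b Ω K U q₀ c₁ c u) {e : E} (he : ‖e‖ = 1) {x : E}
    (hx : x ∈ Ω) (hl : sSup (chordLevels Ω e) < inner ℝ e x) :
    planeRefl e (sSup (chordLevels Ω e)) x ∈ Ω := by
  obtain ⟨l, hl0, h1, -⟩ := exists_chord h.isOpen h.convex h.isBounded he hx
  obtain ⟨l', hl'0, h2, h3⟩ := exists_chord h.isOpen h.convex h.isBounded (e := -e) (by rwa [norm_neg]) hx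
  have hee : (inner ℝ e e : ℝ) = 1 := by rw [real_inner_self_eq_norm_sq, he]; norm_num
  have hle := le_csSup (h.chordLevels_bddAbove he)
    (⟨_, h2, _, h1, l + l', by positivity, by module, rfl⟩ :
      (inner ℝ e (x + l' • -e) + inner ℝ e (x + l • e)) / 2 ∈ chordLevels Ω e)
  simp only [inner_add_right, inner_smul_right, inner_neg_right, hee] at hle
  have := h3 (2 * (inner ℝ e x - sSup (chordLevels Ω e))) (by linarith) (by linarith)
  convert this using 1
  rw [planeRefl]; module

lemma exists_reflected_point (h : OverdetSol g b Ω K U q₀ c₁ c u) {e : E} (he : ‖e‖ = 1)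
    (hne : Ω.Nonempty) : ∃ z ∈ frontier Ω, sSup (chordLevels Ω e) < inner ℝ e z ∧
      planeRefl e (sSup (chordLevels Ω e)) z ∈ frontier Ω := by
  obtain ⟨s, -, hs, hsm⟩ := exists_seq_tendsto_sSup (h.chordLevels_nonempty he hne)
    (h.chordLevels_bddAbove he)
  have hadm : ∀ x ∈ Ω, sSup (chordLevels Ω e) < inner ℝ e x →
    planeRefl e (sSup (chordLevels Ω e)) x ∈ Ω := fun x => h.planeRefl_mem_of_sSup_lt he
  set l₀ := sSup (chordLevels Ω e) with hl₀
  have hee : (inner ℝ e e : ℝ) = 1 := by rw [real_inner_self_eq_norm_sq, he]; norm_num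
  choose a ha b hb l hl hab hsab using hsm
  obtain ⟨⟨p, p'⟩, ⟨hp, hp'⟩, φ, hφ, hlim⟩ := (h.isCompact_frontier.prod
    h.isCompact_frontier).tendsto_subseq (x := fun k => (a k, b k)) (fun k => ⟨ha k, hb k⟩)
  have hlima : Tendsto (fun k => a (φ k)) atTop (𝓝 p) :=
    (continuous_fst.tendsto (p, p')).comp hlim
  have hlimb : Tendsto (fun k => b (φ k)) atTop (𝓝 p') :=
    (continuous_snd.tendsto (p, p')).comp hlim
  have hlk : ∀ k, l k = inner ℝ e (b k - a k) := fun k => by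
    rw [hab k, add_sub_cancel_left, inner_smul_right, hee, mul_one]
  have hiA : Tendsto (fun k => (inner ℝ e (a (φ k)) : ℝ)) atTop (𝓝 (inner ℝ e p)) :=
    tendsto_const_nhds.inner hlima
  have hiB : Tendsto (fun k => (inner ℝ e (b (φ k)) : ℝ)) atTop (𝓝 (inner ℝ e p')) :=
    tendsto_const_nhds.inner hlimb
  have hmid : (inner ℝ e p + inner ℝ e p') / 2 = l₀ := by
    refine tendsto_nhds_unique ((hiA.add hiB).div_const 2) ?_
    refine (hs.comp hφ.tendsto_atTop).congr fun k => ?_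
    simp only [Function.comp, hsab]
  have hd : p' = p + (inner ℝ e (p' - p) : ℝ) • e := by
    refine tendsto_nhds_unique hlimb ?_
    refine (hlima.add (Tendsto.smul_const
      (tendsto_const_nhds.inner (hlimb.sub hlima)) e)).congr fun k => ?_
    conv_rhs => rw [hab, hlk]
  have hd0 : (0:ℝ) ≤ inner ℝ e (p' - p) := by
    refine ge_of_tendsto' (tendsto_const_nhds.inner (hlimb.sub hlima)) fun k => ?_
    rw [← hlk]; exact (hl _).le
  rcases hd0.eq_or_lt with hd1 | hd1
  · rw [← hd1, zero_smul, add_zero] at hd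
    subst hd
    have hep : (inner ℝ e p' : ℝ) = l₀ := by linarith
    have hu2 := h.contDiffAt (h.frontier_subset hp)
    have hlφ : ∀ k, 0 < l (φ k) := fun k => hl _
    have habφ : ∀ k, b (φ k) = a (φ k) + l (φ k) • e := fun k => hab _
    have h1 : fderiv ℝ u p' e = 0 := by
      refine tendsto_nhds_unique ((hu2.hasStrictFDerivAt (by norm_num)).tendsto_slope_seq
        hlima hlimb hlφ habφ) ?_
      simp [h.outer_eq _ (ha _), h.outer_eq _ (hb _)]
    have h2 : hess u p' e (gradient u p') = 0 := by
      have hH : HasStrictFDerivAt (fderiv ℝ u) (hess u p') p' :=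
        (hu2.fderiv_right (m := 1) (by norm_num)).hasStrictFDerivAt (by norm_num)
      have t1 := hH.tendsto_slope_seq hlima hlimb hlφ habφ
      have hgc := hu2.continuousAt_gradient
      have t2 := (hgc.tendsto.comp hlimb).add (hgc.tendsto.comp hlima)
      have t3 := (isBoundedBilinearMap_apply.continuous.tendsto _).comp (t1.prodMk_nhds t2)
      have h3 : hess u p' e (gradient u p' + gradient u p') = 0 := by
        refine tendsto_nhds_unique t3 ?_
        refine (tendsto_const_nhds (x := (0:ℝ))).congr fun k => ?_
        simp only [Function.comp, smul_apply, sub_apply, ← inner_gradient_left]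
        rw [inner_add_right, inner_add_right, real_inner_self_eq_norm_sq,
          real_inner_self_eq_norm_sq, h.outer_gradient _ (ha _), h.outer_gradient _ (hb _),
          real_inner_comm]
        simp only [smul_eq_mul]
        ring
      rw [map_add] at h3
      linarith
    exact h.exists_reflected_of_tangent he hadm hp hep
      (by rw [real_inner_comm, inner_gradient_left, h1]) h2
  · have e1 : (inner ℝ e p' : ℝ) = inner ℝ e p + inner ℝ e (p' - p) := by
      rw [inner_sub_right]; ring
    refine ⟨p', hp', by linarith, ?_⟩
    convert hp using 1
    rw [planeRefl]
    nth_rewrite 1 [hd]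
    rw [add_assoc, ← add_smul, add_eq_left]
    rw [show (inner ℝ e (p' - p) + 2 * (l₀ - inner ℝ e p') : ℝ) = 0 by linarith, zero_smul]

end OverdetSol
end Symmetry

section SymmetryPlane

variable {E : Type*} [NormedAddCommGroup E] [InnerProductSpace ℝ E] [FiniteDimensional ℝ E]
  {ι : Type*} [Fintype ι]

lemma planeRefl_add {e x : E} {l₀ : ℝ} (hx : inner ℝ e x = l₀) (v : E) :
    planeRefl e l₀ (x + v) = x + linRefl e v := by
  rw [planeRefl, linRefl_apply, inner_add_right, hx]
  module

namespace OverdetSol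
variable {g : ℝ → ℝ} {b : OrthonormalBasis ι ℝ E} {Ω K U : Set E} {q₀ c₁ c : ℝ} {u : E → ℝ}

lemma exists_symmetry_plane (h : OverdetSol g b Ω K U q₀ c₁ c u) {e : E} (he : ‖e‖ = 1)
    (hne : Ω.Nonempty) : ∃ l₀ : ℝ, ∀ z ∈ frontier Ω, planeRefl e l₀ z ∈ frontier Ω := by
  have hadm : ∀ x ∈ Ω, sSup (chordLevels Ω e) < inner ℝ e x →
    planeRefl e (sSup (chordLevels Ω e)) x ∈ Ω := fun x => h.planeRefl_mem_of_sSup_lt he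
  obtain ⟨z, hz, hlz, hRz⟩ := h.exists_reflected_point he hne
  set l₀ := sSup (chordLevels Ω e)
  clear_value l₀
  have hce : Continuous fun x : E => (inner ℝ e x : ℝ) := by fun_prop
  obtain ⟨x, hlx, hx⟩ := mem_closure_iff.1 (frontier_subset_closure hz) _
    (isOpen_lt continuous_const hce) hlz
  set x₁ := (2⁻¹ : ℝ) • x + (2⁻¹ : ℝ) • planeRefl e l₀ x with hx₁def
  have hx₁ : x₁ ∈ Ω := h.convex hx (hadm x hx hlx) (by norm_num) (by norm_num) (by norm_num)
  have hex₁ : (inner ℝ e x₁ : ℝ) = l₀ := by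
    rw [hx₁def, inner_add_right, inner_smul_right, inner_smul_right, inner_planeRefl he]; ring
  clear_value x₁
  obtain ⟨γ, hγc, hpos, hhom, hfr, -⟩ := exists_radial_function h.isOpen h.convex h.isBounded hx₁
  set S := frontier Ω ∩ {y | l₀ < (inner ℝ e y : ℝ)} with hS
  have hSpre : IsPreconnected S := by
    have hconv : Convex ℝ {v : E | 0 < (inner ℝ e v : ℝ)} :=
      convex_halfSpace_gt (f := fun v : E => (inner ℝ e v : ℝ))
        ⟨fun _ _ => inner_add_right _ _ _, fun _ _ => inner_smul_right _ _ _⟩ 0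
    have hne0 : ∀ v ∈ {v : E | 0 < (inner ℝ e v : ℝ)}, 0 < γ v := fun v hv => by
      refine hpos v ?_
      rintro rfl
      simp at hv
    have himg : S = (fun v => x₁ + (γ v)⁻¹ • v) '' {v : E | 0 < (inner ℝ e v : ℝ)} := by
      ext y
      constructor
      · rintro ⟨hy, hly⟩
        have hy1 : γ (y - x₁) = 1 := by rw [hfr, add_sub_cancel]; exact hy
        refine ⟨y - x₁, ?_, ?_⟩
        · change 0 < (inner ℝ e (y - x₁) : ℝ)
          rw [inner_sub_right, hex₁]; exact sub_pos.2 hly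
        · simp only [hy1, inv_one, one_smul, add_sub_cancel]
      · rintro ⟨v, hv, rfl⟩
        have h0 := hne0 v hv
        refine ⟨?_, ?_⟩
        · rw [← hfr, hhom _ (inv_pos.2 h0).le, inv_mul_cancel₀ h0.ne']
        · change l₀ < (inner ℝ e (x₁ + (γ v)⁻¹ • v) : ℝ)
          rw [inner_add_right, hex₁, inner_smul_right]
          exact lt_add_of_pos_right _ (mul_pos (inv_pos.2 h0) hv)
    rw [himg]
    refine hconv.isPreconnected.image _ fun v hv => ContinuousAt.continuousWithinAt ?_
    exact continuousAt_const.add ((hγc.continuousAt.inv₀ (hne0 v hv).ne').smul continuousAt_id)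
  have hall : ∀ y ∈ S, planeRefl e l₀ y ∈ frontier Ω := by
    by_contra! hcon
    obtain ⟨y, hyS, hy⟩ := hcon
    obtain ⟨w, hwS, hw1, hw2⟩ := hSpre
      (interior {z | z ∈ frontier Ω → planeRefl e l₀ z ∈ frontier Ω})
      (planeRefl e l₀ ⁻¹' frontier Ω)ᶜ isOpen_interior
      (isClosed_frontier.preimage (continuous_planeRefl e l₀)).isOpen_compl
      (fun w hw => by
        by_cases hRw : planeRefl e l₀ w ∈ frontier Ω
        · exact Or.inl (mem_interior_iff_mem_nhds.2
            (h.eventually_planeRefl_mem_frontier he hadm hw.1 hw.2 hRw))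
        · exact Or.inr hRw)
      ⟨z, ⟨hz, hlz⟩, mem_interior_iff_mem_nhds.2
            (h.eventually_planeRefl_mem_frontier he hadm hz hlz hRz)⟩
      ⟨y, hyS, hy⟩
    exact hw2 (interior_subset hw1 hwS.1)
  have hγR : ∀ v, 0 < (inner ℝ e v : ℝ) → γ v = 1 → γ (linRefl e v) = 1 := fun v hv hv1 => by
    rw [hfr, ← planeRefl_add hex₁]
    refine hall _ ⟨(hfr v).1 hv1, ?_⟩
    change l₀ < (inner ℝ e (x₁ + v) : ℝ)
    rw [inner_add_right, hex₁]; linarith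
  refine ⟨l₀, fun y hy => ?_⟩
  obtain ⟨v, rfl⟩ : ∃ v, y = x₁ + v := ⟨y - x₁, (add_sub_cancel _ _).symm⟩
  rw [planeRefl_add hex₁, ← hfr]
  rw [← hfr] at hy
  rcases lt_trichotomy (inner ℝ e v : ℝ) 0 with hv | hv | hv
  · have hw : 0 < (inner ℝ e (linRefl e v) : ℝ) := by rw [inner_linRefl he]; linarith
    have hw0 : 0 < γ (linRefl e v) := by
      refine hpos _ fun h0 => ?_
      rw [h0, inner_zero_right] at hw
      exact hw.false
    have h1 := hγR ((γ (linRefl e v))⁻¹ • linRefl e v)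
      (by rw [inner_smul_right]; positivity)
      (by rw [hhom _ (inv_pos.2 hw0).le, inv_mul_cancel₀ hw0.ne'])
    rw [map_smul, linRefl_linRefl he, hhom _ (inv_pos.2 hw0).le, hy, mul_one] at h1
    exact inv_eq_one.1 h1
  · rw [linRefl_apply, hv]; simpa using hy
  · exact hγR v hv hy

end OverdetSol
end SymmetryPlane

section Conclusion

variable {E : Type*} [NormedAddCommGroup E] [InnerProductSpace ℝ E] [FiniteDimensional ℝ E]
  {ι : Type*} [Fintype ι]

/-- A compact set with a symmetry hyperplane in every direction has a centre lying on all of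
them. -/
lemma IsCompact.exists_center (b : OrthonormalBasis ι ℝ E) {S : Set E} (hS : IsCompact S)
    (hne : S.Nonempty)
    (hsym : ∀ e : E, ‖e‖ = 1 → ∃ l₀ : ℝ, ∀ z ∈ S, planeRefl e l₀ z ∈ S) :
    ∃ x₀ : E, ∀ e : E, ‖e‖ = 1 → ∀ z ∈ S, planeRefl e (inner ℝ e x₀) z ∈ S := by
  classical
  choose! l hl using hsym
  have hpart : ∀ s : Finset ι, ∀ z ∈ S,
      z + ∑ i ∈ s, (2 * (l (b i) - inner ℝ (b i) z)) • b i ∈ S := by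
    intro s
    induction s using Finset.induction_on with
    | empty => intro z hz; simpa using hz
    | insert i s hi ih =>
      intro z hz
      have h1 := hl (b i) (b.norm_eq_one i) _ (ih z hz)
      have h2 : (inner ℝ (b i) (z + ∑ j ∈ s, (2 * (l (b j) - inner ℝ (b j) z)) • b j) : ℝ)
          = inner ℝ (b i) z := by
        rw [inner_add_right, inner_sum, Finset.sum_eq_zero, add_zero]
        intro j hj
        rw [inner_smul_right, b.inner_eq_zero (by rintro rfl; exact hi hj), mul_zero]
      rw [planeRefl, h2] at h1
      rw [Finset.sum_insert hi]
      convert h1 using 1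
      abel
  refine ⟨∑ i, l (b i) • b i, fun e he => ?_⟩
  set x₀ := ∑ i, l (b i) • b i with hx₀
  have hpt : ∀ z ∈ S, (2 : ℝ) • x₀ - z ∈ S := fun z hz => by
    convert hpart Finset.univ z hz using 1
    simp only [mul_sub, sub_smul, mul_smul, Finset.sum_sub_distrib, ← Finset.smul_sum]
    rw [b.sum_repr' z, ← hx₀]
    module
  have hce : ContinuousOn (fun x : E => (inner ℝ e x : ℝ)) S := by fun_prop
  obtain ⟨p, hp, hpmax⟩ := hS.exists_isMaxOn hne hce
  obtain ⟨q, hq, hqmin⟩ := hS.exists_isMinOn hne hce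
  have hmax : ∀ z ∈ S, (inner ℝ e z : ℝ) ≤ inner ℝ e p := fun z hz => hpmax hz
  have hmin : ∀ z ∈ S, (inner ℝ e q : ℝ) ≤ inner ℝ e z := fun z hz => hqmin hz
  have h1 := hmin _ (hl e he p hp)
  have h2 := hmax _ (hl e he q hq)
  have h3 := hmin _ (hpt p hp)
  have h4 := hmax _ (hpt q hq)
  rw [inner_planeRefl he] at h1 h2
  rw [inner_sub_right, inner_smul_right] at h3 h4
  have : (inner ℝ e x₀ : ℝ) = l e := by linarith
  rw [this]
  exact hl e he

lemma exists_planeRefl_eq {x₀ x y : E} (hxy : ‖x - x₀‖ = ‖y - x₀‖) (hne : x ≠ y) :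
    ∃ e : E, ‖e‖ = 1 ∧ planeRefl e (inner ℝ e x₀) x = y := by
  have h0 : ‖x - y‖ ≠ 0 := norm_ne_zero_iff.2 (sub_ne_zero.2 hne)
  refine ⟨‖x - y‖⁻¹ • (x - y), ?_, ?_⟩
  · rw [norm_smul, norm_inv, norm_norm, inv_mul_cancel₀ h0]
  · have h1 : 2 * inner ℝ (x - y) (x - x₀) = ‖x - y‖ ^ 2 := by
      have h2 : ‖y - x₀‖ ^ 2 = ‖(x - x₀) - (x - y)‖ ^ 2 := by congr 2; abel
      rw [← hxy, norm_sub_sq_real (x - x₀), real_inner_comm] at h2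
      linarith
    rw [inner_sub_right] at h1
    rw [planeRefl, real_inner_smul_left, real_inner_smul_left, smul_smul]
    have h3 : 2 * (‖x - y‖⁻¹ * inner ℝ (x - y) x₀ - ‖x - y‖⁻¹ * inner ℝ (x - y) x) * ‖x - y‖⁻¹
        = -1 := by
      field_simp
      linarith
    rw [h3]
    module

lemma IsCompact.exists_sphere_subset {S : Set E} (hS : IsCompact S) (hne : S.Nonempty) {x₀ : E}
    (hrot : ∀ x ∈ S, ∀ y, ‖x - x₀‖ = ‖y - x₀‖ → y ∈ S) :
    ∃ r, 0 ≤ r ∧ Metric.sphere x₀ r ⊆ S ∧ S ⊆ Metric.closedBall x₀ r := by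
  obtain ⟨p, hp, hmax⟩ := hS.exists_isMaxOn hne
    (by fun_prop : ContinuousOn (fun x : E => ‖x - x₀‖) S)
  refine ⟨‖p - x₀‖, norm_nonneg _, fun y hy => hrot p hp y ?_, fun y hy => ?_⟩
  · exact (mem_sphere_iff_norm.1 hy).symm
  · exact mem_closedBall_iff_norm.2 (hmax hy)

lemma eq_closedBall_of_rotation_invariant [Nontrivial E] {A : Set E} (hA : IsCompact A)
    (hc : Convex ℝ A) (hne : (interior A).Nonempty) {x₀ : E}
    (hrot : ∀ x ∈ A, ∀ y, ‖x - x₀‖ = ‖y - x₀‖ → y ∈ A) :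
    ∃ r, 0 < r ∧ A = Metric.closedBall x₀ r := by
  obtain ⟨r, hr, h1, h2⟩ := hA.exists_sphere_subset (hne.mono interior_subset) hrot
  have h3 : A = Metric.closedBall x₀ r := by
    refine h2.antisymm ?_
    rw [← convexHull_sphere_eq_closedBall x₀ hr]
    exact convexHull_min h1 hc
  refine ⟨r, ?_, h3⟩
  rwa [h3, interior_closedBall', Metric.nonempty_ball] at hne

lemma eq_ball_of_frontier_rotation_invariant [Nontrivial E] {Ω : Set E} (hO : IsOpen Ω)
    (hc : Convex ℝ Ω) (hb : Bornology.IsBounded Ω) (hne : Ω.Nonempty) {x₀ : E}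
    (hrot : ∀ x ∈ frontier Ω, ∀ y, ‖x - x₀‖ = ‖y - x₀‖ → y ∈ frontier Ω) :
    ∃ r, 0 < r ∧ Ω = Metric.ball x₀ r := by
  have hF : IsCompact (frontier Ω) :=
    hb.isCompact_closure.of_isClosed_subset isClosed_frontier frontier_subset_closure
  have hFne : (frontier Ω).Nonempty := by
    obtain ⟨x, hx⟩ := hne
    obtain ⟨e, he⟩ := exists_norm_eq E zero_le_one
    obtain ⟨l, -, hl, -⟩ := exists_chord hO hc hb he hx
    exact ⟨_, hl⟩
  obtain ⟨r, hr, h1, h2⟩ := hF.exists_sphere_subset hFne hrot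
  have h3 : Ω ⊆ Metric.closedBall x₀ r := fun x hx => by
    by_contra hxr
    rw [mem_closedBall_iff_norm, not_le] at hxr
    have h0 : 0 < ‖x - x₀‖ := hr.trans_lt hxr
    obtain ⟨l, hl0, hl, -⟩ := exists_chord hO hc hb (e := ‖x - x₀‖⁻¹ • (x - x₀))
      (by rw [norm_smul, norm_inv, norm_norm, inv_mul_cancel₀ h0.ne']) hx
    have h4 := mem_closedBall_iff_norm.1 (h2 hl)
    rw [show x + l • ‖x - x₀‖⁻¹ • (x - x₀) - x₀ = (1 + l * ‖x - x₀‖⁻¹) • (x - x₀) by module,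
      norm_smul, Real.norm_of_nonneg (by positivity), add_mul, mul_assoc,
      inv_mul_cancel₀ h0.ne'] at h4
    linarith
  have h4 : Ω = Metric.ball x₀ r := by
    refine Subset.antisymm ?_ ?_
    · rw [← interior_closedBall' x₀ r]
      exact interior_maximal h3 hO
    · have h5 : Metric.closedBall x₀ r ⊆ closure Ω := by
        rw [← convexHull_sphere_eq_closedBall x₀ hr]
        exact convexHull_min (h1.trans frontier_subset_closure) hc.closure
      have h6 := interior_mono h5
      rwa [interior_closedBall', hc.interior_closure_eq_interior_of_nonempty_interior
        (by rwa [hO.interior_eq]), hO.interior_eq] at h6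
  refine ⟨r, ?_, h4⟩
  rwa [h4, Metric.nonempty_ball] at hne

namespace OverdetSol
variable {g : ℝ → ℝ} {b : OrthonormalBasis ι ℝ E} {Ω K U : Set E} {q₀ c₁ c : ℝ} {u : E → ℝ}

local notation "𝔴" => extConst K c₁ u

lemma exists_eq_ball [Nontrivial E] (h : OverdetSol g b Ω K U q₀ c₁ c u) (hne : Ω.Nonempty) :
    ∃ x₀ r, 0 < r ∧ Ω = Metric.ball x₀ r := by
  have hFne : (frontier Ω).Nonempty := by
    obtain ⟨x, hx⟩ := hne
    obtain ⟨e, he⟩ := exists_norm_eq E zero_le_one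
    obtain ⟨l, -, hl, -⟩ := exists_chord h.isOpen h.convex h.isBounded he hx
    exact ⟨_, hl⟩
  obtain ⟨x₀, hx₀⟩ := h.isCompact_frontier.exists_center b hFne
    fun e he => h.exists_symmetry_plane he hne
  refine ⟨x₀, eq_ball_of_frontier_rotation_invariant h.isOpen h.convex h.isBounded hne
    fun x hx y hxy => ?_⟩
  rcases eq_or_ne x y with rfl | hne'
  · exact hx
  · obtain ⟨e, he, rfl⟩ := exists_planeRefl_eq hxy hne'
    exact hx₀ e he x hx

lemma ext_eq_of_norm_eq (h : OverdetSol g b Ω K U q₀ c₁ c u) {x₀ : E} {r : ℝ}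
    (hΩ : Ω = Metric.ball x₀ r) {x y : E} (hx : x ∈ Ω) (hxy : ‖x - x₀‖ = ‖y - x₀‖) :
    𝔴 x = 𝔴 y := by
  have key : ∀ x ∈ Ω, ∀ y, ‖x - x₀‖ = ‖y - x₀‖ → 𝔴 y ≤ 𝔴 x := by
    intro x hx y hxy
    rcases eq_or_ne x y with rfl | hne
    · exact le_rfl
    obtain ⟨e, he, rfl⟩ := exists_planeRefl_eq hxy hne
    have hadm : ∀ e : E, ‖e‖ = 1 → ∀ z ∈ Ω, planeRefl e (inner ℝ e x₀) z ∈ Ω := by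
      intro e he z hz
      rw [hΩ, mem_ball_iff_norm] at hz ⊢
      have := norm_planeRefl_sub he (inner ℝ e x₀) z x₀
      rw [planeRefl_eq_self rfl] at this
      rwa [this]
    rcases le_total (inner ℝ e x₀ : ℝ) (inner ℝ e x) with hl | hl
    · exact h.closure_comparison he (fun z hz _ => hadm e he z hz) (subset_closure hx) hl
    · have h1 := h.closure_comparison (e := -e) (l₀ := inner ℝ (-e) x₀) (by rwa [norm_neg])
        (fun z hz _ => hadm (-e) (by rwa [norm_neg]) z hz) (subset_closure hx)
        (by rw [inner_neg_left, inner_neg_left]; linarith)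
      have h2 : planeRefl (-e) (inner ℝ (-e) x₀) x = planeRefl e (inner ℝ e x₀) x := by
        rw [planeRefl, planeRefl, inner_neg_left, inner_neg_left]; module
      rwa [h2] at h1
  have hy : y ∈ Ω := by
    rw [hΩ, mem_ball_iff_norm] at hx ⊢
    rwa [← hxy]
  exact (key y hy x hxy.symm).antisymm (key x hx y hxy)

theorem radial_symmetry [Nontrivial E] (h : OverdetSol g b Ω K U q₀ c₁ c u) (hK : Convex ℝ K)
    (hKi : (interior K).Nonempty) : ∃ x₀ r₀ r₁, 0 < r₁ ∧ r₁ < r₀ ∧ K = Metric.closedBall x₀ r₁ ∧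
      Ω = Metric.ball x₀ r₀ ∧ ∃ f : ℝ → ℝ, ∀ x ∈ Ω \ K, u x = f ‖x - x₀‖ := by
  have hne : Ω.Nonempty := (hKi.mono interior_subset).mono h.subset
  obtain ⟨x₀, r₀, -, hΩ⟩ := h.exists_eq_ball hne
  obtain ⟨r₁, hr₁, hK'⟩ := eq_closedBall_of_rotation_invariant (x₀ := x₀) h.isCompact hK hKi
    fun x hx y hxy => by
      by_contra hy
      have hyΩ : y ∈ Ω := by
        have hx' := h.subset hx
        rw [hΩ, mem_ball_iff_norm] at hx' ⊢
        rwa [← hxy]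
      have h1 := h.ext_eq_of_norm_eq hΩ (h.subset hx) hxy
      rw [extConst_of_mem hx, extConst_of_notMem hy] at h1
      exact (h.gt ⟨hyΩ, hy⟩).ne h1
  obtain ⟨v, hv⟩ := exists_norm_eq E zero_le_one
  refine ⟨x₀, r₀, r₁, hr₁, ?_, hK', hΩ, fun t => 𝔴 (x₀ + t • v), fun x hx => ?_⟩
  · have h1 : x₀ + r₁ • v ∈ K := by
      rw [hK', mem_closedBall_iff_norm, add_sub_cancel_left, norm_smul, hv, mul_one,
        Real.norm_of_nonneg hr₁.le]
    have h2 := h.subset h1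
    rwa [hΩ, mem_ball_iff_norm, add_sub_cancel_left, norm_smul, hv, mul_one,
        Real.norm_of_nonneg hr₁.le] at h2
  · rw [← extConst_of_notMem (c₁ := c₁) (u := u) hx.2]
    refine h.ext_eq_of_norm_eq hΩ hx.1 ?_
    rw [add_sub_cancel_left, norm_smul, hv, mul_one, norm_norm]

end OverdetSol
end Conclusion

/-- Symmetry conclusion of the paper's Theorem 3.1: if the overdetermined problem
(3.1)–(3.3) has a solution on the ring-shaped domain `Ω = Ω₀ \ closure Ω₁`, then
`Γ₀ = ∂Ω₀` and `Γ₁ = ∂Ω₁` are concentric spheres of radii `r₀ > r₁ > 0`, and `u` is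
a radial function about their common center. -/
theorem stmt11 (N : ℕ) (hN : 2 ≤ N) (g : ℝ → ℝ) (hg : Cond24 g)
    (Ω₀ Ω₁ : Set (EuclideanSpace ℝ (Fin N)))
    (hΩ₀open : IsOpen Ω₀) (hΩ₁open : IsOpen Ω₁)
    (hΩ₀bdd : Bornology.IsBounded Ω₀) (hΩ₁bdd : Bornology.IsBounded Ω₁)
    (hΩ₀conv : Convex ℝ Ω₀) (hΩ₁conv : Convex ℝ Ω₁)
    (hΩ₀ne : Ω₀.Nonempty) (hΩ₁ne : Ω₁.Nonempty)
    (hsub : closure Ω₁ ⊆ Ω₀)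
    (q₀ c₁ : ℝ) (hq₀ : 0 < q₀) (hc₁ : 0 < c₁)
    (u : EuclideanSpace ℝ (Fin N) → ℝ)
    (U : Set (EuclideanSpace ℝ (Fin N))) (hU : IsOpen U)
    (hUsub : closure (Ω₀ \ closure Ω₁) ⊆ U) (hu : ContDiffOn ℝ 3 u U)
    (hgrad : ∀ x ∈ Ω₀ \ closure Ω₁, gradient u x ≠ 0)
    (hpde : ∀ x ∈ Ω₀ \ closure Ω₁,
      ∑ i, fderiv ℝ (fun y => g (‖gradient u y‖ ^ 2) * fderiv ℝ u y (eb N i)) x (eb N i)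
        = (N : ℝ))
    (hu0 : ∀ x ∈ frontier Ω₀, u x = 0)
    (hq0 : ∀ x ∈ frontier Ω₀, ‖gradient u x‖ = q₀)
    (hu1 : ∀ x ∈ frontier Ω₁, u x = -c₁)
    (hq1 : ∀ x ∈ frontier Ω₁, gradient u x = 0) :
    ∃ (x₀ : EuclideanSpace ℝ (Fin N)) (r₀ r₁ : ℝ), 0 < r₁ ∧ r₁ < r₀ ∧
      frontier Ω₁ = Metric.sphere x₀ r₁ ∧ frontier Ω₀ = Metric.sphere x₀ r₀ ∧
      ∃ f : ℝ → ℝ, ∀ x ∈ Ω₀ \ closure Ω₁, u x = f ‖x - x₀‖ := by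
  have : Nonempty (Fin N) := ⟨⟨0, by omega⟩⟩
  have hΩ₁i : interior (closure Ω₁) = Ω₁ := by
    rw [hΩ₁conv.interior_closure_eq_interior_of_nonempty_interior
      (by rwa [hΩ₁open.interior_eq]), hΩ₁open.interior_eq]
  have hfr : frontier (closure Ω₁) ⊆ frontier Ω₁ := frontier_closure_subset
  have h : OverdetSol g (EuclideanSpace.basisFun (Fin N) ℝ) Ω₀ (closure Ω₁) U q₀ c₁ N u :=
    { cond := hg
      isOpen := hΩ₀open
      isBounded := hΩ₀bdd
      convex := hΩ₀conv
      isCompact := hΩ₁bdd.isCompact_closure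
      subset := hsub
      isOpen_U := hU
      closure_subset := hUsub
      contDiffOn := hu
      gradient_ne := hgrad
      pde := fun x hx => by
        have hux : ContDiffAt ℝ 2 u x :=
          (hu.contDiffAt (hU.mem_nhds (hUsub (subset_closure hx)))).of_le (by norm_num)
        rw [← sum_fderiv_eq_quasiOp hg _ hux (hgrad x hx), ← hpde x hx]
        simp only [EuclideanSpace.basisFun_apply, eb]
      q₀_pos := hq₀
      c₁_pos := hc₁
      outer_eq := hu0
      outer_gradient := hq0
      inner_eq := fun x hx => hu1 x (hfr hx)
      inner_gradient := fun x hx => hq1 x (hfr hx) }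
  obtain ⟨x₀, r₀, r₁, hr₁, hr, hK, hΩ, hf⟩ := h.radial_symmetry hΩ₁conv.closure
    (by rwa [hΩ₁i])
  refine ⟨x₀, r₀, r₁, hr₁, hr, ?_, ?_, hf⟩
  · rw [hK, interior_closedBall'] at hΩ₁i
    rw [← hΩ₁i, frontier_ball x₀ hr₁.ne']
  · rw [hΩ, frontier_ball x₀ (hr₁.trans hr).ne']

end
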